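/- Let (R,m) be a Noetherian local ring and M a finitely generated R-module with r = dim_R M ≥ 2. Let U = U_{M̂}(0) be the unmixed component of (0) in the m-adic completion M̂. Then the following are equivalent: (1) M is a Vasconcelos R-module; (2) e_1(Q,M) = 0 for every parameter ideal Q for M; (3) M̂/U is a Cohen–Macaulay R̂-module and dim_{R̂} U ≤ r−2; (4) there exists a proper R̂-submodule L of M̂ such that M̂/L is a Cohen–Macaulay R̂-module and dim_{R̂} L ≤ r−2. When these hold, M̂ is a Vasconcelos R̂-module and H^{r−1}_m(M) = (0). -/

import Mathlib

open IsLocalRing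

section Defs

variable (R : Type) [CommRing R]

/-- The length of a module, as the Krull dimension of its lattice of submodules. -/
noncomputable def mLength (M : Type) [AddCommGroup M] [Module R M] : WithBot ℕ∞ :=
  Order.krullDim (Submodule R M)

/-- The (Krull) dimension of a module. -/
noncomputable def mDim (M : Type) [AddCommGroup M] [Module R M] : WithBot ℕ∞ :=
  ringKrullDim (R ⧸ Submodule.annihilator (⊤ : Submodule R M))

/-- `f` is eventually given by the Hilbert-type polynomial of degree `t` with
coefficients `s 0, …, s t` (written in the binomial basis with alternating signs). -/
def IsHilbPolyAt (f : ℕ → WithBot ℕ∞) (t : ℕ) (s : ℕ → ℤ) : Prop :=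
  ∃ N : ℕ, ∀ n ≥ N, ∃ l : ℕ, f n = (l : ℕ∞) ∧
    (l : ℤ) = ∑ i ∈ Finset.range (t + 1), (-1 : ℤ) ^ i * s i * ((n + t - i).choose (t - i) : ℤ)

/-- `s 0, …, s t` are the Hilbert coefficients `e_i(I, M)`, i.e.
`λ(M/I^{n+1}M) = ∑ (-1)^i e_i(I,M) C(n+t-i, t-i)` for `n ≫ 0`. -/
def HasHilbCoeffs (I : Ideal R) (M : Type) [AddCommGroup M] [Module R M]
    (t : ℕ) (s : ℕ → ℤ) : Prop :=
  IsHilbPolyAt (fun n => mLength R (M ⧸ (I ^ (n + 1) • (⊤ : Submodule R M)))) t s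

/-- The unmixed component `U_M(0)` of `M`: the largest submodule of dimension `< dim M`. -/
noncomputable def unmixedComp (M : Type) [AddCommGroup M] [Module R M] : Submodule R M :=
  sSup {N : Submodule R M | mDim R ↥N < mDim R M}

/-- `x` is a d-sequence on `M`. -/
def IsDSeq {r : ℕ} (x : Fin r → R) (M : Type) [AddCommGroup M] [Module R M] : Prop :=
  ∀ i j : Fin r, i ≤ j →
    Submodule.comap (LinearMap.lsmul R M (x i * x j))
        (Ideal.span (x '' {k | k < i}) • (⊤ : Submodule R M))
      = Submodule.comap (LinearMap.lsmul R M (x j))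
        (Ideal.span (x '' {k | k < i}) • (⊤ : Submodule R M))

/-- `x` is a standard (d⁺-) system: all power sequences in any order are d-sequences. -/
def IsStandardSeq {r : ℕ} (x : Fin r → R) (M : Type) [AddCommGroup M] [Module R M] : Prop :=
  ∀ n : Fin r → ℕ, (∀ k, 1 ≤ n k) → ∀ σ : Equiv.Perm (Fin r),
    IsDSeq R (fun k => x (σ k) ^ n (σ k)) M

/-- The integral closure of an ideal, as a set. -/
def intClos (Q : Ideal R) : Set R :=
  {x : R | ∃ n : ℕ, 0 < n ∧ ∃ a : ℕ → R, (∀ i, 1 ≤ i → i ≤ n → a i ∈ Q ^ i) ∧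
    x ^ n + ∑ i ∈ Finset.Icc 1 n, a i * x ^ (n - i) = 0}

variable [IsLocalRing R]

/-- `h ∈ I` is superficial for `M` with respect to `I`. -/
def IsSuperficial (I : Ideal R) (M : Type) [AddCommGroup M] [Module R M] (h : R) : Prop :=
  h ∈ I ∧ ∃ c N : ℕ, ∀ n ≥ N,
    Submodule.comap (LinearMap.lsmul R M h) (I ^ (n + 1) • (⊤ : Submodule R M))
        ⊓ (I ^ c • (⊤ : Submodule R M))
      = I ^ n • (⊤ : Submodule R M)

/-- `Q` is a parameter ideal for `M` (`r` the dimension of `M`):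
generated by `r` elements of the maximal ideal with `M/QM` of finite length. -/
def IsParamIdeal (Q : Ideal R) (M : Type) [AddCommGroup M] [Module R M] (r : ℕ) : Prop :=
  Q ≤ maximalIdeal R ∧ (∃ x : Fin r → R, Q = Ideal.span (Set.range x)) ∧
    IsFiniteLength R (M ⧸ Q • (⊤ : Submodule R M))

/-- Local cohomology `H^i_𝔪(M)` with support in the maximal ideal. -/
noncomputable def LC (i : ℕ) (M : Type) [AddCommGroup M] [Module R M] : ModuleCat R :=
  (localCohomology (maximalIdeal R) i).obj (ModuleCat.of R M)

/-- `M` is Cohen–Macaulay: there is a regular sequence on `M` in the maximal ideal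
whose length equals `dim M`. -/
def IsCM (M : Type) [AddCommGroup M] [Module R M] : Prop :=
  ∃ rs : List R, (∀ x ∈ rs, x ∈ maximalIdeal R) ∧ RingTheory.Sequence.IsRegular M rs ∧
    (rs.length : WithBot ℕ∞) = mDim R M

/-- `M` is unmixed: `dim R̂/p = dim M` for every associated prime `p` of the completion `M̂`. -/
def IsUnmixed (M : Type) [AddCommGroup M] [Module R M] : Prop :=
  ∀ p ∈ associatedPrimes (AdicCompletion (maximalIdeal R) R)
      (AdicCompletion (maximalIdeal R) M),
    ringKrullDim ((AdicCompletion (maximalIdeal R) R) ⧸ p) = mDim R M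

/-- `M` is generalized Cohen–Macaulay: `H^i_𝔪(M)` has finite length for `i < r = dim M`. -/
def IsGenCM (M : Type) [AddCommGroup M] [Module R M] (r : ℕ) : Prop :=
  ∀ i < r, IsFiniteLength R ↥(LC R i M)

/-- The set `Λ(M)` of first Hilbert coefficients of parameter ideals for `M`. -/
def Lambda (M : Type) [AddCommGroup M] [Module R M] (r : ℕ) : Set ℤ :=
  {a : ℤ | ∃ (Q : Ideal R) (e : ℕ → ℤ),
    IsParamIdeal R Q M r ∧ HasHilbCoeffs R Q M r e ∧ e 1 = a}

/-- A standard parameter ideal: one generated by a standard system of parameters. -/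
def IsStandardParamIdeal (Q : Ideal R) (M : Type) [AddCommGroup M] [Module R M]
    (r : ℕ) : Prop :=
  IsParamIdeal R Q M r ∧ ∃ x : Fin r → R, Q = Ideal.span (Set.range x) ∧
    IsStandardSeq R x M

/-- `M` is Buchsbaum: every parameter ideal for `M` is standard. -/
def IsBuchsbaum (M : Type) [AddCommGroup M] [Module R M] (r : ℕ) : Prop :=
  ∀ Q : Ideal R, IsParamIdeal R Q M r → IsStandardParamIdeal R Q M r

/-- `M` is a Vasconcelos module. -/
def IsVasconcelos (M : Type) [AddCommGroup M] [Module R M] : Prop :=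
  mDim R M ≤ 0 ∨ (0 < mDim R M ∧ ∃ (r : ℕ) (Q : Ideal R) (e : ℕ → ℤ),
    mDim R M = (r : ℕ∞) ∧ IsParamIdeal R Q M r ∧ HasHilbCoeffs R Q M r e ∧ e 1 = 0)

/-- A Gorenstein local ring: Noetherian, Cohen–Macaulay, with an irreducible parameter ideal. -/
def IsGorensteinLocalRing : Prop :=
  IsNoetherianRing R ∧ IsCM R R ∧ ∃ (r : ℕ) (Q : Ideal R),
    mDim R R = (r : ℕ∞) ∧ IsParamIdeal R Q R r ∧
    ∀ I J : Ideal R, Q = I ⊓ J → Q = I ∨ Q = J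

/-- `E` is an injective envelope of the residue field `R/𝔪`. -/
def IsInjEnvResidue (E : Type) [AddCommGroup E] [Module R E] : Prop :=
  Module.Injective R E ∧ ∃ ι : (R ⧸ maximalIdeal R) →ₗ[R] E, Function.Injective ι ∧
    ∀ N : Submodule R E, N ⊓ LinearMap.range ι = ⊥ → N = ⊥

end Defs

/-- A (not necessarily local) Cohen–Macaulay ring: Noetherian,
with all localizations at primes Cohen–Macaulay. -/
def IsCMRing (S : Type) [CommRing S] : Prop :=
  IsNoetherianRing S ∧ ∀ (p : Ideal S) [p.IsPrime],
    IsCM (Localization.AtPrime p) (Localization.AtPrime p)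

/-- A (not necessarily local) Gorenstein ring. -/
def IsGorensteinRing (S : Type) [CommRing S] : Prop :=
  IsNoetherianRing S ∧ ∀ (p : Ideal S) [p.IsPrime],
    IsGorensteinLocalRing (Localization.AtPrime p)

/-- `HDegRel R I E M v` : `v` is the homological degree `hdeg_I(M)` computed
with Matlis duals taken relative to `E`. -/
inductive HDegRel (R : Type) [CommRing R] [IsLocalRing R] (I : Ideal R)
    (E : Type) [AddCommGroup E] [Module R E] : ModuleCat R → ℕ → Prop where
  | base : ∀ (M : ModuleCat R) (l : ℕ), mDim R M ≤ 0 → mLength R M = (l : ℕ∞) →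
      HDegRel R I E M l
  | step : ∀ (M : ModuleCat R) (r : ℕ), mDim R M = (r : ℕ∞) → 0 < r →
      ∀ (e : ℕ → ℤ) (e0 : ℕ), HasHilbCoeffs R I M r e → e 0 = (e0 : ℤ) →
      ∀ v : ℕ → ℕ,
        (∀ j < r, HDegRel R I E (ModuleCat.of R ((LC R j M) →ₗ[R] E)) (v j)) →
      HDegRel R I E M (e0 + ∑ j ∈ Finset.range r, (r - 1).choose j * v j)

namespace Vasconcelos

open Polynomial

section AssociatedPrimes

variable {B G : Type*} [CommRing B] [IsNoetherianRing B] [AddCommGroup G] [Module B G]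

lemma mem_associatedPrimes_iff {P : Ideal B} :
    P ∈ associatedPrimes B G ↔ P.IsPrime ∧ ∃ x : G, ∀ a, a ∈ P ↔ a • x = 0 := by
  rw [AssociatedPrimes.mem_iff, IsAssociatedPrime, Submodule.isAssociatedPrime_iff]
  refine and_congr_right fun _ => exists_congr fun x => ?_
  rw [SetLike.ext_iff]
  simp [Submodule.mem_colon_singleton]

lemma aeval_endomorphism_eq_zero {B G : Type*} [CommRing B] [AddCommGroup G] [Module B G]
    (φ : Module.End B G) (p : B[X]) (z : G) (h : ∀ i, p.coeff i • z = 0) :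
    aeval φ p z = 0 := by
  rw [aeval_endomorphism, Polynomial.sum]
  refine Finset.sum_eq_zero fun i _ => ?_
  rw [← map_smul, h, map_zero]

/-- If `J` lies in every associated prime of `G` modulo which the polynomials `f` and `g` fail to
be coprime and `f` annihilates `φ`, then `g(φ)` is injective on `J ^ n G` for some `n`. -/
lemma exists_pow_smul_aeval_injective [Module.Finite B G] (φ : Module.End B G) (f g : B[X])
    (hf : aeval φ f = 0) (J : Ideal B)
    (h : ∀ P ∈ associatedPrimes B G, J ≤ P ∨
      ∃ (u v : B[X]) (a : B), a ∉ P ∧ ∀ i, (u * g + v * f - C a).coeff i ∈ P) :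
    ∃ n, ∀ z ∈ J ^ n • (⊤ : Submodule B G), aeval φ g z = 0 → z = 0 := by
  set K := LinearMap.ker (aeval φ g)
  have hJ : J ≤ (Module.annihilator B K).radical := by
    rw [← Ideal.sInf_minimalPrimes]
    refine le_sInf fun P hP => ?_
    have hPK := Module.associatedPrimes.minimalPrimes_annihilator_subset_associatedPrimes B K hP
    have hPG := associatedPrimes.subset_of_injective K.subtype_injective hPK
    refine (h P hPG).resolve_right ?_
    rintro ⟨u, v, a, ha, hc⟩
    obtain ⟨-, ⟨z, hz⟩, hPz⟩ := mem_associatedPrimes_iff.1 hPK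
    have hPz' : ∀ a, a ∈ P ↔ a • z = 0 := fun a => by simp [hPz, Subtype.ext_iff]
    have h0 := aeval_endomorphism_eq_zero φ (u * g + v * f - C a) z fun i => (hPz' _).1 (hc i)
    have hz' : aeval φ g z = 0 := hz
    simp only [map_sub, map_add, map_mul, hf, mul_zero, add_zero, LinearMap.sub_apply,
      Module.End.mul_apply, hz', map_zero, aeval_C, Module.algebraMap_end_apply, zero_sub,
      neg_eq_zero] at h0
    exact ha ((hPz' a).2 h0)
  obtain ⟨c, hc⟩ := Ideal.exists_radical_pow_le_of_fg (Module.annihilator B K)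
    ((isNoetherianRing_iff_ideal_fg B).1 inferInstance _)
  obtain ⟨k, hk⟩ := Ideal.exists_pow_inf_eq_pow_smul J K
  refine ⟨k + c, fun z hz hgz => ?_⟩
  have : z ∈ J ^ (k + c) • ⊤ ⊓ K := ⟨hz, hgz⟩
  rw [hk _ (Nat.le_add_right k c), Nat.add_sub_cancel_left] at this
  have hle : J ^ c • (J ^ k • ⊤ ⊓ K) ≤ (⊥ : Submodule B G) := by
    refine Submodule.smul_le.2 fun a ha y hy => ?_
    have := Module.mem_annihilator.1 (hc (Ideal.pow_right_mono hJ c ha)) ⟨y, hy.2⟩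
    simpa [Subtype.ext_iff] using this
  simpa using hle this

end AssociatedPrimes

section Irreducible

variable {k : Type*} [Field k]

lemma exists_monic_irreducible_notMem (S : Set k[X]) (hS : S.Finite)
    (h : ∀ p ∈ S, p.Monic ∧ Irreducible p) : ∃ p : k[X], p.Monic ∧ Irreducible p ∧ p ∉ S := by
  classical
  set F := X * ∏ p ∈ hS.toFinset, p + 1
  have hm : (∏ p ∈ hS.toFinset, p).Monic :=
    monic_prod_of_monic _ _ fun p hp => (h p (by simpa using hp)).1
  have hF : ¬ IsUnit F := by
    intro hu
    have hd := natDegree_eq_zero_of_isUnit hu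
    have : F.natDegree = 1 + (∏ p ∈ hS.toFinset, p).natDegree := by
      rw [show F = X * ∏ p ∈ hS.toFinset, p + C 1 by simp [F], natDegree_add_C,
        natDegree_X_mul hm.ne_zero, add_comm]
    omega
  obtain ⟨q, hq, hqF⟩ := WfDvdMonoid.exists_irreducible_factor hF (by
    rintro h0
    have := congrArg (fun p => p.eval 0) h0
    simp [F] at this)
  refine ⟨normalize q, monic_normalize hq.ne_zero, (associated_normalize q).irreducible hq,
    fun hqS => hq.not_isUnit (isUnit_of_dvd_one ?_)⟩
  have h1 : q ∣ X * ∏ p ∈ hS.toFinset, p :=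
    ((associated_normalize q).dvd.trans
      (Finset.dvd_prod_of_mem (fun p => p) (by simpa using hqS))).mul_left X
  exact (dvd_add_right h1).1 hqF

lemma finite_setOf_not_isCoprime_map {K : Type*} [Field K] (i : k →+* K) (g : K[X]) (hg : g ≠ 0) :
    {p : k[X] | p.Monic ∧ Irreducible p ∧ ¬ IsCoprime (p.map i) g}.Finite := by
  classical
  have key : ∀ p ∈ {p : k[X] | p.Monic ∧ Irreducible p ∧ ¬ IsCoprime (p.map i) g},
      ∃ d ∈ UniqueFactorizationMonoid.normalizedFactors g, d ∣ p.map i := by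
    rintro p ⟨-, -, hp⟩
    by_contra! hcon
    refine hp (isCoprime_of_irreducible_dvd (fun h => hg h.2) fun z hz h1 h2 => ?_)
    obtain ⟨q, hq, hzq⟩ := UniqueFactorizationMonoid.exists_mem_normalizedFactors_of_dvd hg hz h2
    exact hcon q hq (hzq.symm.dvd.trans h1)
  choose! d hd hdvd using key
  refine Set.Finite.of_injOn (f := d)
    (t := ((UniqueFactorizationMonoid.normalizedFactors g).toFinset : Set K[X])) ?_ ?_
    (Finset.finite_toSet _)
  · intro p hp
    simpa only [Finset.mem_coe, Multiset.mem_toFinset] using hd p hp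
  · intro p hp q hq hpq
    by_contra hne
    have hcop : IsCoprime p q := by
      rw [hp.2.1.coprime_iff_not_dvd]
      exact fun hdv => hne (eq_of_monic_of_associated hp.1 hq.1
        (hp.2.1.associated_of_dvd hq.2.1 hdv))
    have := (hcop.map (mapRingHom i)).isUnit_of_dvd' (hdvd p hp) (hpq ▸ hdvd q hq)
    exact (UniqueFactorizationMonoid.irreducible_of_normalized_factor _ (hd p hp)).not_isUnit this

end Irreducible

end Vasconcelos

namespace Vasconcelos

open Polynomial

section Gr

variable {R : Type*} [CommRing R] (I : Ideal R)
variable (V : Type*) [AddCommGroup V] [Module R V]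
variable (W : Type*) [AddCommGroup W] [Module R W]

/-- The filtration `n ↦ I ^ (n + 1) V`. -/
def shiftFiltration : I.Filtration V where
  N i := I ^ (i + 1) • ⊤
  mono i := Submodule.smul_mono_left (Ideal.pow_le_pow_right (Nat.le_succ _))
  smul_le i := by rw [← Submodule.mul_smul, ← pow_succ']

/-- The Rees algebra of `I`, as a type. -/
def Rees : Type _ := reesAlgebra I

noncomputable instance : CommRing (Rees I) := inferInstanceAs (CommRing (reesAlgebra I))

instance [IsNoetherianRing R] : IsNoetherianRing (Rees I) :=
  inferInstanceAs (IsNoetherianRing (reesAlgebra I))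

noncomputable instance : Module (Rees I) (PolynomialModule R V) :=
  inferInstanceAs (Module (reesAlgebra I) (PolynomialModule R V))

/-- The submodule of `V[t]` attached to a filtration, over `Rees I`. -/
noncomputable def filtSubmodule (F : I.Filtration V) :
    Submodule (Rees I) (PolynomialModule R V) := F.submodule

/-- The quotient of `V[t]` by `⨁ I ^ (n + 1) V t ^ n`. -/
def PolyQuot : Type _ := PolynomialModule R V ⧸ filtSubmodule I V (shiftFiltration I V)

noncomputable instance : AddCommGroup (PolyQuot I V) :=
  inferInstanceAs (AddCommGroup (PolynomialModule R V ⧸ filtSubmodule I V (shiftFiltration I V)))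

noncomputable instance : Module (Rees I) (PolyQuot I V) :=
  inferInstanceAs (Module (Rees I) (PolynomialModule R V ⧸ filtSubmodule I V (shiftFiltration I V)))

/-- The quotient map onto `PolyQuot I V`. -/
noncomputable def toPolyQuot : PolynomialModule R V →ₗ[Rees I] PolyQuot I V :=
  (filtSubmodule I V (shiftFiltration I V)).mkQ

/-- The associated graded module `⨁ I ^ n V / I ^ (n + 1) V` over the Rees algebra of `I`,
as a submodule of `PolyQuot I V`. -/
noncomputable def grSubmodule : Submodule (Rees I) (PolyQuot I V) :=
  (filtSubmodule I V (I.stableFiltration (⊤ : Submodule R V))).map (toPolyQuot I V)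

/-- The associated graded module `⨁ I ^ n V / I ^ (n + 1) V` over the Rees algebra of `I`. -/
abbrev Gr : Type _ := grSubmodule I V

instance [IsNoetherianRing R] [Module.Finite R V] : Module.Finite (Rees I) (Gr I V) := by
  rw [Module.Finite.iff_fg]
  refine Submodule.FG.map _ ?_
  change (I.stableFiltration (⊤ : Submodule R V)).submodule.FG
  rw [Ideal.Filtration.submodule_fg_iff_stable _ fun i => IsNoetherian.noetherian _]
  exact I.stableFiltration_stable _

variable {V W}

/-- The map of graded Rees modules induced by a linear map. -/
noncomputable def polyMap (h : V →ₗ[R] W) :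
    PolynomialModule R V →ₗ[Rees I] PolynomialModule R W where
  toFun := PolynomialModule.map R h
  map_add' := map_add _
  map_smul' r p := by
    change PolynomialModule.map R h (r.1 • p) = r.1 • _
    rw [PolynomialModule.map_smul]
    simp

lemma coeff_polyMap (h : V →ₗ[R] W) (p : PolynomialModule R V) (n : ℕ) :
    (polyMap I h p).coeff n = h (p.coeff n) := by
  change (PolynomialModule.map R h p).coeff n = _
  induction p using PolynomialModule.induction_linear with
  | zero => simp
  | add p q hp hq => simp [map_add, hp, hq]
  | single i m =>
    rw [PolynomialModule.map_single, PolynomialModule.coeff_single, PolynomialModule.coeff_single]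
    simp only [Finsupp.single_apply]
    split_ifs <;> simp

lemma map_pow_smul_top_le (h : V →ₗ[R] W) (n : ℕ) {y : V} (hy : y ∈ I ^ n • (⊤ : Submodule R V)) :
    h y ∈ I ^ n • (⊤ : Submodule R W) := by
  have : (I ^ n • (⊤ : Submodule R V)).map h ≤ I ^ n • ⊤ := by
    rw [Submodule.map_smul'']
    exact smul_mono_right _ le_top
  exact this ⟨y, hy, rfl⟩

/-- The map on `PolyQuot` induced by a linear map. -/
noncomputable def polyQuotMap (h : V →ₗ[R] W) : PolyQuot I V →ₗ[Rees I] PolyQuot I W :=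
  Submodule.mapQ _ _ (polyMap I h) fun p hp i => by
    rw [coeff_polyMap]
    exact map_pow_smul_top_le I h (i + 1) (hp i)

/-- The map of associated graded modules induced by a linear map. -/
noncomputable def grMap (h : V →ₗ[R] W) : Gr I V →ₗ[Rees I] Gr I W :=
  (polyQuotMap I h).restrict <| by
    rintro _ ⟨p, hp, rfl⟩
    refine ⟨polyMap I h p, fun i => ?_, rfl⟩
    rw [coeff_polyMap]
    exact map_pow_smul_top_le I h i (hp i)

/-- The class of a homogeneous element. -/
noncomputable def grSingle (n : ℕ) (y : V) (hy : y ∈ I ^ n • (⊤ : Submodule R V)) : Gr I V :=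
  ⟨toPolyQuot I V (PolynomialModule.single R n y), PolynomialModule.single R n y, fun i => by
    rw [PolynomialModule.coeff_single, Finsupp.single_apply]
    split_ifs with h
    · exact h ▸ hy
    · exact zero_mem _, rfl⟩

lemma grSingle_eq_zero {n : ℕ} {y : V} {hy : y ∈ I ^ n • (⊤ : Submodule R V)} :
    grSingle I n y hy = 0 ↔ y ∈ I ^ (n + 1) • (⊤ : Submodule R V) := by
  refine Subtype.ext_iff.trans ((Submodule.Quotient.mk_eq_zero _).trans ?_)
  change (∀ i, (PolynomialModule.single R n y).coeff i ∈ I ^ (i + 1) • ⊤) ↔ _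
  constructor
  · intro h
    simpa [PolynomialModule.coeff_single] using h n
  · intro h i
    rw [PolynomialModule.coeff_single, Finsupp.single_apply]
    split_ifs with h'
    · exact h' ▸ h
    · exact zero_mem _

lemma grMap_grSingle (h : V →ₗ[R] W) (n : ℕ) (y : V) (hy : y ∈ I ^ n • (⊤ : Submodule R V)) :
    grMap I h (grSingle I n y hy) = grSingle I n (h y) (map_pow_smul_top_le I h n hy) := by
  ext1
  exact congrArg (toPolyQuot I _) (PolynomialModule.map_single R h n y)

lemma grMap_id : grMap I (LinearMap.id (R := R) (M := V)) = LinearMap.id := by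
  refine LinearMap.ext ?_
  rintro ⟨_, p, hp, rfl⟩
  ext1
  refine congrArg (toPolyQuot I _) ?_
  ext i
  exact coeff_polyMap I _ p i

lemma grMap_comp {X : Type*} [AddCommGroup X] [Module R X] (g : W →ₗ[R] X) (h : V →ₗ[R] W) :
    grMap I (g ∘ₗ h) = grMap I g ∘ₗ grMap I h := by
  refine LinearMap.ext ?_
  rintro ⟨_, p, hp, rfl⟩
  ext1
  refine congrArg (toPolyQuot I _) (?_ : polyMap I _ p = polyMap I g (polyMap I h p))
  ext i
  simp [coeff_polyMap]

lemma grMap_add (g h : V →ₗ[R] W) : grMap I (g + h) = grMap I g + grMap I h := by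
  refine LinearMap.ext ?_
  rintro ⟨_, p, hp, rfl⟩
  ext1
  refine congrArg (toPolyQuot I _) (?_ : polyMap I _ p = polyMap I g p + polyMap I h p)
  ext i
  simp [coeff_polyMap]

lemma grMap_zero : grMap I (0 : V →ₗ[R] W) = 0 := by
  have := grMap_add I (0 : V →ₗ[R] W) 0
  simpa using this

lemma grMap_sum {ι : Type*} (s : Finset ι) (h : ι → V →ₗ[R] W) :
    grMap I (∑ i ∈ s, h i) = ∑ i ∈ s, grMap I (h i) := by
  classical
  induction s using Finset.induction_on with
  | empty => simp [grMap_zero]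
  | insert a s ha ih => rw [Finset.sum_insert ha, Finset.sum_insert ha, grMap_add, ih]

/-- The degree one element of the Rees algebra attached to an element of the ideal. -/
noncomputable def reesOne (x : R) (hx : x ∈ I) : Rees I :=
  ⟨monomial 1 x, reesAlgebra.monomial_mem.2 (by simpa using hx)⟩

lemma reesOne_smul_grSingle (x : R) (hx : x ∈ I) (n : ℕ) (y : V)
    (hy : y ∈ I ^ n • (⊤ : Submodule R V)) :
    reesOne I x hx • grSingle I n y hy = grSingle I (n + 1) (x • y) (by
      rw [pow_succ', Submodule.mul_smul]
      exact Submodule.smul_mem_smul hx hy) := by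
  ext1
  refine congrArg (toPolyQuot I _) (?_ :
    (monomial 1 x : R[X]) • PolynomialModule.single R n y = _)
  rw [PolynomialModule.monomial_smul_single, add_comm]

lemma grSingle_add (n : ℕ) (y z : V) (hy : y ∈ I ^ n • (⊤ : Submodule R V)) (hz) :
    grSingle I n (y + z) (add_mem hy hz) = grSingle I n y hy + grSingle I n z hz := by
  ext1
  exact congrArg (toPolyQuot I _) (PolynomialModule.single_add n y z)

lemma grSingle_sum {ι : Type*} (s : Finset ι) (n : ℕ) (y : ι → V)
    (hy : ∀ i, y i ∈ I ^ n • (⊤ : Submodule R V)) :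
    grSingle I n (∑ i ∈ s, y i) (sum_mem fun i _ => hy i) =
      ∑ i ∈ s, grSingle I n (y i) (hy i) := by
  classical
  induction s using Finset.induction_on with
  | empty =>
    simp only [Finset.sum_empty]
    exact (grSingle_eq_zero I).2 (zero_mem _)
  | insert a s ha ih =>
    simp only [Finset.sum_insert ha]
    rw [← ih, grSingle_add]

/-- The degree zero element of the Rees algebra attached to a scalar. -/
noncomputable def reesZero : R →+* Rees I := algebraMap R (reesAlgebra I)

end Gr

end Vasconcelos

namespace Vasconcelos

open Polynomial IsLocalRing

lemma exists_mul_add_mul_eq_C {E : Type*} [CommRing E] [IsDomain E] (p q : E[X])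
    (h : IsCoprime (p.map (algebraMap E (FractionRing E))) (q.map (algebraMap E (FractionRing E)))) :
    ∃ (u v : E[X]) (a : E), a ≠ 0 ∧ u * p + v * q = C a := by
  obtain ⟨u, v, huv⟩ := h
  obtain ⟨b, hb0, hb⟩ := IsLocalization.integerNormalization_spec (nonZeroDivisors E) u
  obtain ⟨c, hc0, hc⟩ := IsLocalization.integerNormalization_spec (nonZeroDivisors E) v
  set U := IsLocalization.integerNormalization (nonZeroDivisors E) u
  set V := IsLocalization.integerNormalization (nonZeroDivisors E) v
  refine ⟨C c * U, C b * V, b * c,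
    mul_ne_zero (nonZeroDivisors.ne_zero hb0) (nonZeroDivisors.ne_zero hc0), ?_⟩
  apply map_injective _ (IsFractionRing.injective E (FractionRing E))
  have hb' : U.map (algebraMap E (FractionRing E)) = C (algebraMap E (FractionRing E) b) * u := by
    rw [hb, ← algebraMap_smul (FractionRing E), smul_eq_C_mul]
  have hc' : V.map (algebraMap E (FractionRing E)) = C (algebraMap E (FractionRing E) c) * v := by
    rw [hc, ← algebraMap_smul (FractionRing E), smul_eq_C_mul]
  simp only [Polynomial.map_add, Polynomial.map_mul, map_C, hb', hc', map_mul]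
  linear_combination (C (algebraMap E (FractionRing E) b) * C (algebraMap E (FractionRing E) c)) * huv

section

variable {R : Type*} [CommRing R] [IsNoetherianRing R]
variable {N : Type*} [AddCommGroup N] [Module R N] [Module.Finite R N]

/-- The polynomial `∑ x i t T ^ i` over the Rees algebra. -/
noncomputable def genericPoly {I : Ideal R} {r : ℕ} (x : Fin r → R) (hx : ∀ i, x i ∈ I) :
    (Rees I)[X] := ∑ i : Fin r, monomial i (reesOne I (x i) (hx i))

omit [IsNoetherianRing R] in
lemma coeff_genericPoly {I : Ideal R} {r : ℕ} (x : Fin r → R) (hx : ∀ i, x i ∈ I) (i : Fin r) :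
    (genericPoly x hx).coeff i = reesOne I (x i) (hx i) := by
  simp [genericPoly, finsetSum_coeff, coeff_monomial, Fin.val_inj]

/-- The relation between a prime of the Rees algebra, the generators `x` and a polynomial `f`
that makes `∑ x i T ^ i` superficial. -/
def GoodAt {I : Ideal R} {r : ℕ} (x : Fin r → R) (hx : ∀ i, x i ∈ I) (f : R[X])
    (P : Ideal (Rees I)) : Prop :=
  (∀ i, reesOne I (x i) (hx i) ∈ P) ∨ ∃ (u v : (Rees I)[X]) (a : Rees I), a ∉ P ∧
    ∀ i, (u * genericPoly x hx + v * f.map (reesZero I) - C a).coeff i ∈ P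

omit [Module.Finite R N] in
lemma exists_pow_smul_gr {I : Ideal R} {J : Ideal R} {s : ℕ}
    (hs : J ^ s • (⊤ : Submodule R N) ≤ I • ⊤) {P : Ideal (Rees I)}
    (hP : P ∈ associatedPrimes (Rees I) (Gr I N)) : J ≤ P.comap (reesZero I) := by
  obtain ⟨hPp, z, hz⟩ := mem_associatedPrimes_iff.1 hP
  have : J ^ s ≤ P.comap (reesZero I) := by
    intro a ha
    rw [Ideal.mem_comap, hz]
    obtain ⟨_, p, hp, rfl⟩ := z
    ext1
    refine (Submodule.Quotient.mk_eq_zero _).2 (fun i => ?_ :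
      (C a : R[X]) • p ∈ (shiftFiltration I N).submodule)
    rw [← monomial_zero_left, PolynomialModule.monomial_smul_apply]
    simp only [Nat.zero_le, if_true, Nat.sub_zero]
    change _ ∈ I ^ (i + 1) • ⊤
    have h1 : a • p.coeff i ∈ J ^ s • I ^ i • (⊤ : Submodule R N) :=
      Submodule.smul_mem_smul ha (hp i)
    rw [← Submodule.mul_smul, mul_comm, Submodule.mul_smul] at h1
    rw [pow_succ, Submodule.mul_smul]
    exact smul_mono_right _ hs h1
  have := hPp.comap (reesZero I)
  exact Ideal.IsPrime.le_of_pow_le ‹_›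

lemma exists_poly_goodAt [IsLocalRing R] {I : Ideal R} {r : ℕ} (x : Fin r → R) (hx : ∀ i, x i ∈ I)
    {s : ℕ} (hs : maximalIdeal R ^ s • (⊤ : Submodule R N) ≤ I • ⊤) :
    ∃ f : R[X], f.Monic ∧ Irreducible (f.map (residue R)) ∧
      ∀ P ∈ associatedPrimes (Rees I) (Gr I N), GoodAt x hx f P := by
  classical
  set A := associatedPrimes (Rees I) (Gr I N)
  set bad : Set (ResidueField R)[X] := ⋃ P ∈ A,
    {p | p.Monic ∧ Irreducible p ∧ ∃ f : R[X], f.map (residue R) = p ∧ ¬ GoodAt x hx f P} with hbad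
  have hfin : bad.Finite := by
    refine (associatedPrimes.finite _ _).biUnion fun P hP => ?_
    by_cases hxP : ∀ i, reesOne I (x i) (hx i) ∈ P
    · convert Set.finite_empty
      ext p
      simp only [Set.mem_empty_iff_false, iff_false]
      rintro ⟨-, -, f, -, hf⟩
      exact hf (Or.inl hxP)
    have hPp : P.IsPrime := hP.1
    let j : R →+* Rees I ⧸ P := (Ideal.Quotient.mk P).comp (reesZero I)
    have hj : ∀ a ∈ maximalIdeal R, j a = 0 := fun a ha =>
      Ideal.Quotient.eq_zero_iff_mem.2 (exists_pow_smul_gr hs hP ha)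
    let e : ResidueField R →+* Rees I ⧸ P := Ideal.Quotient.lift _ j hj
    let K := FractionRing (Rees I ⧸ P)
    let g := (genericPoly x hx).map (Ideal.Quotient.mk P)
    have hg : g.map (algebraMap _ K) ≠ 0 := by
      push Not at hxP
      obtain ⟨i, hi⟩ := hxP
      intro h0
      rw [Polynomial.map_eq_zero_iff (IsFractionRing.injective _ K)] at h0
      have := congrArg (fun p => p.coeff i) h0
      simp only [g, coeff_map, coeff_genericPoly, coeff_zero] at this
      exact hi (Ideal.Quotient.eq_zero_iff_mem.1 this)
    refine (finite_setOf_not_isCoprime_map ((algebraMap _ K).comp e) _ hg).subset ?_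
    rintro p ⟨hpm, hpi, f, hf, hp⟩
    refine ⟨hpm, hpi, fun hcop => hp (Or.inr ?_)⟩
    have hfe : p.map e = (f.map (reesZero I)).map (Ideal.Quotient.mk P) := by
      rw [← hf, Polynomial.map_map, Polynomial.map_map]
      rfl
    rw [← Polynomial.map_map, hfe] at hcop
    obtain ⟨u, v, a, ha, huv⟩ := exists_mul_add_mul_eq_C _ _ hcop.symm
    obtain ⟨u, rfl⟩ := map_surjective _ Ideal.Quotient.mk_surjective u
    obtain ⟨v, rfl⟩ := map_surjective _ Ideal.Quotient.mk_surjective v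
    obtain ⟨a, rfl⟩ := Ideal.Quotient.mk_surjective a
    refine ⟨u, v, a, fun h => ha (Ideal.Quotient.eq_zero_iff_mem.2 h), fun i => ?_⟩
    rw [← Ideal.Quotient.eq_zero_iff_mem, ← coeff_map]
    simp only [Polynomial.map_sub, Polynomial.map_add, Polynomial.map_mul, map_C]
    rw [huv, sub_self, coeff_zero]
  obtain ⟨p, hpm, hpi, hpS⟩ := exists_monic_irreducible_notMem bad hfin (by
    rintro p hp
    simp only [hbad, Set.mem_iUnion] at hp
    obtain ⟨P, hP, hp⟩ := hp
    exact ⟨hp.1, hp.2.1⟩)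
  obtain ⟨f, hf, -, hfm⟩ := lifts_and_natDegree_eq_and_monic
    (map_surjective _ (residue_surjective (R := R)) p) hpm
  refine ⟨f, hfm, hf ▸ hpi, fun P hP => ?_⟩
  by_contra hcon
  refine hpS ?_
  simp only [hbad, Set.mem_iUnion]
  exact ⟨P, hP, hpm, hpi, f, hf, hcon⟩

variable {V : Type*} [AddCommGroup V] [Module R V]

omit [Module.Finite R N] in
lemma associatedPrimes_gr_subset {I : Ideal R} {κ : Type*} [Fintype κ] (π : κ → V →ₗ[R] N)
    (ι : κ → N →ₗ[R] V) (hid : ∑ j, ι j ∘ₗ π j = LinearMap.id) :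
    associatedPrimes (Rees I) (Gr I V) ⊆ associatedPrimes (Rees I) (Gr I N) := by
  intro P hP
  obtain ⟨hPp, z, hz⟩ := mem_associatedPrimes_iff.1 hP
  have hsum : ∑ j, grMap I (ι j) (grMap I (π j) z) = z := by
    have := congrArg (fun h => grMap I h z) hid
    simpa [grMap_sum, grMap_id, grMap_comp] using this
  have hle : Finset.univ.inf (fun j => LinearMap.ker (LinearMap.toSpanSingleton (Rees I) (Gr I N)
      (grMap I (π j) z))) ≤ P := by
    intro a ha
    rw [hz, ← hsum, Finset.smul_sum]
    refine Finset.sum_eq_zero fun j _ => ?_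
    have : a • grMap I (π j) z = 0 := by
      have := (Finset.inf_le (Finset.mem_univ j) :
        Finset.univ.inf (fun j => LinearMap.ker (LinearMap.toSpanSingleton (Rees I) (Gr I N)
          (grMap I (π j) z))) ≤ _) ha
      simpa using this
    rw [← map_smul, this, map_zero]
  obtain ⟨j, -, hj⟩ := (Ideal.IsPrime.inf_le' hPp).1 hle
  refine mem_associatedPrimes_iff.2 ⟨hPp, grMap I (π j) z, fun a => ⟨fun ha => ?_, fun ha => hj ?_⟩⟩
  · rw [← map_smul, (hz a).1 ha, map_zero]
  · simpa using ha

omit [IsNoetherianRing R] in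
lemma aeval_grMap_genericPoly {I : Ideal R} {r : ℕ} (x : Fin r → R) (hx : ∀ i, x i ∈ I)
    (τ : Module.End R V) {n : ℕ} {y : V} (hy : y ∈ I ^ n • (⊤ : Submodule R V))
    (h : ∑ i : Fin r, x i • (τ ^ (i : ℕ)) y ∈ I ^ (n + 2) • (⊤ : Submodule R V)) :
    aeval (grMap I τ) (genericPoly x hx) (grSingle I n y hy) = 0 := by
  have hpow : ∀ i : ℕ, ∃ hi, (grMap I τ ^ i) (grSingle I n y hy) =
      grSingle I n ((τ ^ i) y) hi := by
    intro i
    induction i with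
    | zero => exact ⟨hy, rfl⟩
    | succ i ih =>
      obtain ⟨hi, ih⟩ := ih
      refine ⟨by rw [pow_succ']; exact map_pow_smul_top_le I τ n hi, ?_⟩
      rw [pow_succ', Module.End.mul_apply, ih, grMap_grSingle]
      simp only [pow_succ', Module.End.mul_apply]
  choose hi hpow using hpow
  have hmem : ∀ i : Fin r, x i • (τ ^ (i : ℕ)) y ∈ I ^ (n + 1) • (⊤ : Submodule R V) := by
    intro i
    rw [pow_succ', Submodule.mul_smul]
    exact Submodule.smul_mem_smul (hx i) (hi i)
  have : aeval (grMap I τ) (genericPoly x hx) (grSingle I n y hy) =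
      grSingle I (n + 1) (∑ i : Fin r, x i • (τ ^ (i : ℕ)) y) (sum_mem fun i _ => hmem i) := by
    rw [grSingle_sum I _ _ _ hmem, genericPoly, map_sum, LinearMap.sum_apply]
    refine Finset.sum_congr rfl fun i _ => ?_
    rw [aeval_monomial, Module.End.mul_apply, Module.algebraMap_end_apply, hpow,
      reesOne_smul_grSingle]
  rw [this, grSingle_eq_zero]
  exact h

omit [IsNoetherianRing R] in
lemma exists_sum_smul_of_mem_span_smul {ι : Type*} [Fintype ι] (x : ι → R) (K : Submodule R V)
    {y : V} (hy : y ∈ Ideal.span (Set.range x) • K) :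
    ∃ k : ι → V, (∀ i, k i ∈ K) ∧ y = ∑ i, x i • k i := by
  classical
  induction hy using Submodule.smul_induction_on' with
  | smul a ha k hk =>
    obtain ⟨c, rfl⟩ := (Submodule.mem_span_range_iff_exists_fun R).1 ha
    refine ⟨fun i => c i • k, fun i => K.smul_mem _ hk, ?_⟩
    rw [Finset.sum_smul]
    refine Finset.sum_congr rfl fun i _ => ?_
    rw [smul_eq_mul, mul_comm, mul_smul]
  | add y _ z _ hy hz =>
    obtain ⟨k, hk, rfl⟩ := hy
    obtain ⟨l, hl, rfl⟩ := hz
    exact ⟨fun i => k i + l i, fun i => add_mem (hk i) (hl i), by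
      simp [Finset.sum_add_distrib]⟩

omit [IsNoetherianRing R] in
lemma grSingle_mem {I : Ideal R} {r : ℕ} (x : Fin r → R) (hI : I = Ideal.span (Set.range x))
    (hx : ∀ i, x i ∈ I) (n : ℕ) {y : V} (hy : y ∈ I ^ n • (⊤ : Submodule R V)) :
    grSingle I n y hy ∈ Ideal.span (Set.range fun i => reesOne I (x i) (hx i)) ^ n •
      (⊤ : Submodule (Rees I) (Gr I V)) := by
  induction n generalizing y with
  | zero => simp
  | succ n ih =>
    have hy' : y ∈ Ideal.span (Set.range x) • (I ^ n • (⊤ : Submodule R V)) := by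
      rw [← hI, ← Submodule.mul_smul, ← pow_succ']
      exact hy
    obtain ⟨k, hk, rfl⟩ := exists_sum_smul_of_mem_span_smul x _ hy'
    have hmem : ∀ i, x i • k i ∈ I ^ (n + 1) • (⊤ : Submodule R V) := by
      intro i
      rw [pow_succ', Submodule.mul_smul]
      exact Submodule.smul_mem_smul (hx i) (hk i)
    rw [grSingle_sum I _ _ _ hmem]
    refine sum_mem fun i _ => ?_
    rw [← reesOne_smul_grSingle I (x i) (hx i) n (k i) (hk i), pow_succ', Submodule.mul_smul]
    exact Submodule.smul_mem_smul (Ideal.subset_span ⟨i, rfl⟩) (ih (hk i))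

omit [IsNoetherianRing R] in
lemma aeval_grMap_map_reesZero {I : Ideal R} (τ : Module.End R V) (p : R[X]) :
    aeval (grMap I τ) (p.map (reesZero I)) = grMap I (aeval τ p) := by
  have hpow : ∀ i : ℕ, grMap I τ ^ i = grMap I (τ ^ i) := by
    intro i
    induction i with
    | zero => exact (grMap_id I).symm
    | succ i ih => rw [pow_succ', ih, pow_succ']; exact (grMap_comp I _ _).symm
  have hsc : ∀ a : R, algebraMap (Rees I) (Module.End (Rees I) (Gr I V)) (reesZero I a) =
      grMap I (algebraMap R (Module.End R V) a) := by
    intro a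
    refine LinearMap.ext ?_
    rintro ⟨_, q, hq, rfl⟩
    ext1
    refine congrArg (toPolyQuot I _) (?_ : (C a : R[X]) • q = polyMap I _ q)
    ext i
    rw [coeff_polyMap, ← monomial_zero_left, PolynomialModule.monomial_smul_apply]
    simp
  induction p using Polynomial.induction_on' with
  | add p q hp hq => rw [Polynomial.map_add, map_add, map_add, hp, hq, grMap_add]
  | monomial n a =>
    rw [map_monomial, aeval_monomial, aeval_monomial, hsc, hpow]
    exact (grMap_comp I _ _).symm

omit [Module.Finite R N] in
theorem exists_superficial_bound [Module.Finite R V] {I : Ideal R} {r : ℕ} (x : Fin r → R)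
    (hI : I = Ideal.span (Set.range x)) (hx : ∀ i, x i ∈ I) (f : R[X])
    (hgood : ∀ P ∈ associatedPrimes (Rees I) (Gr I N), GoodAt x hx f P)
    {κ : Type*} [Fintype κ] (π : κ → V →ₗ[R] N) (ι : κ → N →ₗ[R] V)
    (hid : ∑ j, ι j ∘ₗ π j = LinearMap.id) (τ : Module.End R V) (hf : aeval τ f = 0) :
    ∃ c, ∀ n ≥ c, ∀ y ∈ I ^ n • (⊤ : Submodule R V),
      ∑ i : Fin r, x i • (τ ^ (i : ℕ)) y ∈ I ^ (n + 2) • (⊤ : Submodule R V) →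
      y ∈ I ^ (n + 1) • (⊤ : Submodule R V) := by
  have hf' : aeval (grMap I τ) (f.map (reesZero I)) = 0 := by
    rw [aeval_grMap_map_reesZero, hf, grMap_zero]
  obtain ⟨c, hc⟩ := exists_pow_smul_aeval_injective (grMap I τ) (f.map (reesZero I))
    (genericPoly x hx) hf' (Ideal.span (Set.range fun i => reesOne I (x i) (hx i)))
    (fun P hP => by
      rcases hgood P (associatedPrimes_gr_subset π ι hid hP) with h | h
      · left
        rw [Ideal.span_le]
        rintro _ ⟨i, rfl⟩
        exact h i
      · exact Or.inr h)
  refine ⟨c, fun n hn y hy h => ?_⟩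
  rw [← grSingle_eq_zero I (hy := hy)]
  exact hc _ (Submodule.smul_mono_left (Ideal.pow_le_pow_right hn) (grSingle_mem x hI hx n hy))
    (aeval_grMap_genericPoly x hx τ hy h)

end

end Vasconcelos

namespace Vasconcelos

open Polynomial IsLocalRing TensorProduct

universe u v

section
variable {R : Type u} [CommRing R] [IsLocalRing R]

lemma isMaximal_map_adjoinRoot {f : R[X]} (hf : Irreducible (f.map (residue R))) :
    ((maximalIdeal R).map (algebraMap R (AdjoinRoot f))).IsMaximal := by
  have h : (Ideal.span {f.map (residue R)}).IsMaximal :=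
    PrincipalIdealRing.isMaximal_of_irreducible hf
  let e := (AdjoinRoot.quotEquivQuotMap f (maximalIdeal R)).toRingEquiv
  refine Ideal.Quotient.maximal_of_isField _ ?_
  exact MulEquiv.isField ((Ideal.Quotient.maximal_ideal_iff_isField_quotient _).1 h) e.toMulEquiv

lemma isLocalRing_adjoinRoot {f : R[X]} (hm : f.Monic) (hf : Irreducible (f.map (residue R))) :
    IsLocalRing (AdjoinRoot f) := by
  have := isMaximal_map_adjoinRoot hf
  refine .of_unique_max_ideal ⟨_, this, fun M hM => ?_⟩
  have : Module.Finite R (AdjoinRoot f) := hm.finite_adjoinRoot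
  have := Ideal.isMaximal_comap_of_isIntegral_of_isMaximal (R := R) M
  have h := IsLocalRing.eq_maximalIdeal this
  exact (Ideal.IsMaximal.eq_of_le ‹_› hM.ne_top (Ideal.map_le_iff_le_comap.2 h.ge)).symm

lemma mem_pow_map_smul_top_iff {R S : Type*} [CommRing R] [CommRing S] [Algebra R S]
    {V : Type*} [AddCommGroup V] [Module R V] [Module S V] [IsScalarTower R S V]
    (I : Ideal R) (n : ℕ) (y : V) :
    y ∈ (I.map (algebraMap R S)) ^ n • (⊤ : Submodule S V) ↔ y ∈ I ^ n • (⊤ : Submodule R V) := by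
  rw [← Ideal.map_pow, ← Submodule.restrictScalars_mem R, Ideal.smul_restrictScalars,
    Submodule.restrictScalars_top]

variable [IsNoetherianRing R]
variable (N : Type v) [AddCommGroup N] [Module R N] [Module.Finite R N]

theorem exists_superficial_extension {r : ℕ} (x : Fin (r + 1) → R)
    {s : ℕ} (hs : maximalIdeal R ^ s • (⊤ : Submodule R N) ≤ Ideal.span (Set.range x) • ⊤) :
    ∃ (S : Type u) (_ : CommRing S) (_ : IsLocalRing S) (_ : IsNoetherianRing S)
      (_ : Algebra R S) (_ : Module.Finite R S) (_ : Module.Free R S),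
      (maximalIdeal R).map (algebraMap R S) = maximalIdeal S ∧
      ∃ ξ : S, (Ideal.span (Set.range x)).map (algebraMap R S) =
        Ideal.span (Set.range (Fin.cons ξ fun i : Fin r => algebraMap R S (x i.succ))) ∧
      ∃ c, ∀ n ≥ c, ∀ y ∈ (Ideal.span (Set.range x)).map (algebraMap R S) ^ n •
          (⊤ : Submodule S (S ⊗[R] N)),
        ξ • y ∈ (Ideal.span (Set.range x)).map (algebraMap R S) ^ (n + 2) •
          (⊤ : Submodule S (S ⊗[R] N)) →
        y ∈ (Ideal.span (Set.range x)).map (algebraMap R S) ^ (n + 1) •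
          (⊤ : Submodule S (S ⊗[R] N)) := by
  set I := Ideal.span (Set.range x) with hI
  have hx : ∀ i, x i ∈ I := fun i => Ideal.subset_span ⟨i, rfl⟩
  obtain ⟨f, hfm, hfi, hgood⟩ := exists_poly_goodAt x hx hs
  have hloc := isLocalRing_adjoinRoot hfm hfi
  have hfin : Module.Finite R (AdjoinRoot f) := hfm.finite_adjoinRoot
  have hfree : Module.Free R (AdjoinRoot f) := hfm.free_adjoinRoot
  have hnoeth : IsNoetherianRing (AdjoinRoot f) := IsNoetherianRing.of_finite R _
  have hmax := IsLocalRing.eq_maximalIdeal (isMaximal_map_adjoinRoot hfi)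
  refine ⟨AdjoinRoot f, inferInstance, hloc, hnoeth, inferInstance, hfin, hfree, hmax, ?_⟩
  set S := AdjoinRoot f
  let b := Module.Free.chooseBasis R S
  let κ := Module.Free.ChooseBasisIndex R S
  let ξ : S := ∑ i : Fin (r + 1), algebraMap R S (x i) * AdjoinRoot.root f ^ (i : ℕ)
  refine ⟨ξ, ?_, ?_⟩
  · rw [hI, Ideal.map_span, ← Set.range_comp]
    apply le_antisymm
    · rw [Ideal.span_le]
      rintro _ ⟨i, rfl⟩
      have hsucc : ∀ i : Fin r, algebraMap R S (x i.succ) ∈ Ideal.span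
          (Set.range (Fin.cons ξ fun i : Fin r => algebraMap R S (x i.succ) : Fin (r + 1) → S)) :=
        fun i => Ideal.subset_span ⟨i.succ, by simp⟩
      refine Fin.cases ?_ hsucc i
      have : algebraMap R S (x 0) =
          ξ - ∑ i : Fin r, algebraMap R S (x i.succ) * AdjoinRoot.root f ^ (i.succ : ℕ) := by
        simp [ξ, Fin.sum_univ_succ]
      simp only [Function.comp_apply, SetLike.mem_coe]
      rw [this]
      exact sub_mem (Ideal.subset_span ⟨0, by simp⟩)
        (sum_mem fun i _ => Ideal.mul_mem_right _ _ (hsucc i))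
    · rw [Ideal.span_le]
      rintro _ ⟨i, rfl⟩
      have h : ∀ i, algebraMap R S (x i) ∈ Ideal.span (Set.range (algebraMap R S ∘ x)) :=
        fun i => Ideal.subset_span ⟨i, rfl⟩
      refine Fin.cases ?_ (fun i => ?_) i
      · rw [Fin.cons_zero]
        exact sum_mem fun i _ => Ideal.mul_mem_right _ _ (h i)
      · rw [Fin.cons_succ]
        exact h i.succ
  · let π : κ → S ⊗[R] N →ₗ[R] N := fun j =>
      TensorProduct.lift ((LinearMap.lsmul R N).comp (b.coord j))
    let ι : κ → N →ₗ[R] S ⊗[R] N := fun j => TensorProduct.mk R S N (b j)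
    have hid : ∑ j, ι j ∘ₗ π j = LinearMap.id := by
      refine TensorProduct.ext' fun t n => ?_
      simp only [LinearMap.sum_apply, LinearMap.comp_apply, π, ι, TensorProduct.lift.tmul,
        LinearMap.lsmul_apply, TensorProduct.mk_apply, LinearMap.id_apply]
      conv_rhs => rw [← b.sum_repr t]
      rw [TensorProduct.sum_tmul]
      refine Finset.sum_congr rfl fun j _ => ?_
      rw [TensorProduct.tmul_smul, TensorProduct.smul_tmul']
      rfl
    let τ : Module.End R (S ⊗[R] N) := Algebra.lsmul R R (S ⊗[R] N) (AdjoinRoot.root f)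
    have hτ : aeval τ f = 0 := by
      rw [aeval_algHom_apply, AdjoinRoot.aeval_eq, AdjoinRoot.mk_self, map_zero]
    obtain ⟨c, hc⟩ := exists_superficial_bound x hI hx f hgood π ι hid τ hτ
    refine ⟨c, fun n hn y hy h => ?_⟩
    rw [mem_pow_map_smul_top_iff] at hy h ⊢
    refine hc n hn y hy ?_
    convert h using 1
    rw [Finset.sum_smul]
    refine Finset.sum_congr rfl fun i _ => ?_
    rw [mul_smul, algebraMap_smul]
    simp only [τ, ← map_pow]
    rfl

end

end Vasconcelos

namespace Vasconcelos

open IsLocalRing Module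

universe u v

section
variable {R : Type u} [CommRing R] [IsLocalRing R] [IsNoetherianRing R]
variable {M : Type v} [AddCommGroup M] [Module R M] [Module.Finite R M]

lemma isFiniteLength_of_maximalIdeal_le
    (h : ∀ p ∈ Module.support R M, maximalIdeal R ≤ p.asIdeal) : IsFiniteLength R M := by
  suffices H : (∀ p ∈ Module.support R M, maximalIdeal R ≤ p.asIdeal) → IsFiniteLength R M from H h
  refine IsNoetherianRing.induction_on_isQuotientEquivQuotientPrime R (M := M) inferInstance
    (motive := fun N _ _ _ => (∀ p ∈ Module.support R N, maximalIdeal R ≤ p.asIdeal) →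
      IsFiniteLength R N) ?_ ?_ ?_
  · intro N _ _ _ _ _
    exact .of_subsingleton
  · intro N _ _ _ p e h
    have hp : p ∈ Module.support R N := by
      rw [e.support_eq, Module.support_eq_zeroLocus, Ideal.annihilator_quotient]
      exact le_refl p.1
    have hm : p.1.IsMaximal := by
      rw [← (IsLocalRing.maximalIdeal.isMaximal R).eq_of_le p.2.ne_top (h p hp)]
      exact IsLocalRing.maximalIdeal.isMaximal R
    have : IsSimpleModule R (R ⧸ p.1) := isSimpleModule_iff_isCoatom.2 hm.out
    have : IsFiniteLength R (R ⧸ p.1) :=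
      isFiniteLength_iff_isNoetherian_isArtinian.2 ⟨inferInstance, inferInstance⟩
    exact e.symm.isFiniteLength this
  · intro N₁ _ _ _ N₂ _ _ _ N₃ _ _ _ f g hf hg hfg h1 h3 h
    rw [Module.support_of_exact hfg hf hg] at h
    have h1 := h1 fun p hp => h p (Or.inl hp)
    have h3 := h3 fun p hp => h p (Or.inr hp)
    rw [← Module.length_ne_top_iff] at h1 h3 ⊢
    rw [Module.length_eq_add_of_exact f g hf hg hfg]
    simp [h1, h3]

omit [IsNoetherianRing R] [Module.Finite R M] in
lemma maximalIdeal_le_of_isFiniteLength (h : IsFiniteLength R M) :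
    ∀ p ∈ Module.support R M, maximalIdeal R ≤ p.asIdeal := by
  induction h with
  | of_subsingleton => simp [Module.support_eq_empty]
  | @of_simple_quotient M _ _ N hN h ih =>
    intro p hp
    rw [Module.support_of_exact (LinearMap.exact_subtype_mkQ N) N.subtype_injective
      N.mkQ_surjective] at hp
    rcases hp with hp | hp
    · exact ih p hp
    · have := IsSimpleModule.annihilator_isMaximal (R := R) (M := M ⧸ N)
      rw [← IsLocalRing.eq_maximalIdeal this]
      exact Module.annihilator_le_of_mem_support hp

lemma le_of_add_one_le_add_one {a : WithBot ℕ∞} {d : ℕ} (h : a + 1 ≤ d + 1) : a ≤ d := by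
  induction a with
  | bot => exact bot_le
  | coe a =>
    have h : a + 1 ≤ (d : ℕ∞) + 1 := WithBot.coe_le_coe.1 h
    exact WithBot.coe_le_coe.2 ((ENat.add_le_add_iff_right (by simp)).1 h)

/-- The ideal `Q` is, modulo the annihilator of `M`, primary to the maximal ideal. -/
def Primary (Q : Ideal R) (M : Type*) [AddCommGroup M] [Module R M] : Prop :=
  ∀ p ∈ Module.support R M, Q ≤ p.asIdeal → maximalIdeal R ≤ p.asIdeal

omit [IsLocalRing R] [IsNoetherianRing R] in
lemma mem_support_quotient_iff (Q : Ideal R) (p : PrimeSpectrum R) :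
    p ∈ Module.support R (M ⧸ Q • (⊤ : Submodule R M)) ↔
      p ∈ Module.support R M ∧ Q ≤ p.asIdeal := by
  rw [Module.support_quotient]
  rfl

lemma primary_iff {Q : Ideal R} :
    Primary Q M ↔ IsFiniteLength R (M ⧸ Q • (⊤ : Submodule R M)) := by
  constructor
  · intro h
    refine isFiniteLength_of_maximalIdeal_le fun p hp => ?_
    rw [mem_support_quotient_iff] at hp
    exact h p hp.1 hp.2
  · intro h p hp hQ
    exact maximalIdeal_le_of_isFiniteLength h p ((mem_support_quotient_iff Q p).2 ⟨hp, hQ⟩)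

variable {N : Type*} [AddCommGroup N] [Module R N]

omit [IsNoetherianRing R] [Module.Finite R M] in
lemma Primary.of_injective {Q : Ideal R} (h : Primary Q M) (f : N →ₗ[R] M)
    (hf : Function.Injective f) : Primary Q N := fun p hp =>
  h p (Module.support_subset_of_injective f hf hp)

omit [IsNoetherianRing R] [Module.Finite R M] in
lemma Primary.of_surjective {Q : Ideal R} (h : Primary Q M) (f : M →ₗ[R] N)
    (hf : Function.Surjective f) : Primary Q N := fun p hp =>
  h p (Module.support_subset_of_surjective f hf hp)

omit [IsNoetherianRing R] [Module.Finite R M] in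
lemma Primary.pow {Q : Ideal R} (h : Primary Q M) (n : ℕ) : Primary (Q ^ n) M := fun p hp hn =>
  h p hp (Ideal.IsPrime.le_of_pow_le hn)

lemma Primary.isFiniteLength {Q : Ideal R} (h : Primary Q M) (n : ℕ) :
    IsFiniteLength R (M ⧸ Q ^ n • (⊤ : Submodule R M)) := primary_iff.1 (h.pow n)

lemma Primary.length_ne_top {Q : Ideal R} (h : Primary Q M) (n : ℕ) :
    Module.length R (M ⧸ Q ^ n • (⊤ : Submodule R M)) ≠ ⊤ :=
  Module.length_ne_top_iff.2 (h.isFiniteLength n)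

omit [IsNoetherianRing R] [Module.Finite R M] in
lemma primary_maximalIdeal : Primary (maximalIdeal R) M := fun _ _ h => h

lemma exists_pow_smul_le_of_primary {Q : Ideal R} (h : Primary Q M) :
    ∃ s, maximalIdeal R ^ s • (⊤ : Submodule R M) ≤ Q • ⊤ := by
  have h1 := maximalIdeal_le_of_isFiniteLength (primary_iff.1 h)
  have : maximalIdeal R ≤ (Module.annihilator R (M ⧸ Q • (⊤ : Submodule R M))).radical := by
    rw [Ideal.radical_eq_sInf]
    refine le_sInf fun p hp => ?_
    refine h1 ⟨p, hp.2⟩ ?_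
    rw [Module.support_eq_zeroLocus]
    exact hp.1
  obtain ⟨s, hs⟩ := Ideal.exists_pow_le_of_le_radical_of_fg this
    (IsNoetherian.noetherian (maximalIdeal R))
  refine ⟨s, Submodule.smul_le.2 fun a ha x _ => ?_⟩
  have := Module.mem_annihilator.1 (hs ha) (Submodule.Quotient.mk x)
  rwa [← Submodule.Quotient.mk_smul, Submodule.Quotient.mk_eq_zero] at this

omit [IsNoetherianRing R] [Module.Finite R M] in
lemma maximalIdeal_le_of_supportDim_le_zero (h : supportDim R M ≤ 0) :
    ∀ p ∈ Module.support R M, maximalIdeal R ≤ p.asIdeal := by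
  intro p hp
  by_contra hcon
  have hle : p ≤ ⟨maximalIdeal R, inferInstance⟩ := IsLocalRing.le_maximalIdeal p.2.ne_top
  have hlt : p < ⟨maximalIdeal R, inferInstance⟩ := lt_of_le_not_ge hle hcon
  have hm := Module.mem_support_mono hle hp
  have h1 : ((⟨p, hp⟩ : Module.support R M)) < ⟨⟨maximalIdeal R, inferInstance⟩, hm⟩ := hlt
  have := (Order.krullDim_nonpos_iff_forall_isMax.1 h ⟨p, hp⟩)
  exact this.not_lt h1

omit [IsNoetherianRing R] [Module.Finite R M] in
lemma supportDim_le_zero_of_maximalIdeal_le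
    (h : ∀ p ∈ Module.support R M, maximalIdeal R ≤ p.asIdeal) : supportDim R M ≤ 0 := by
  refine iSup_le fun s => ?_
  by_contra hcon
  have hs : 0 < s.length := by
    by_contra h0
    exact hcon (by simp [show s.length = 0 by omega])
  have hlt : s 0 < s (Fin.last _) := s.strictMono (by
    rw [Fin.lt_def]; simpa using hs)
  have h0 : maximalIdeal R ≤ (s 0).1.asIdeal := h _ (s 0).2
  exact not_lt_of_ge ((IsLocalRing.le_maximalIdeal (s (Fin.last _)).1.2.ne_top).trans h0) hlt

lemma supportDim_le_zero_iff : supportDim R M ≤ 0 ↔ IsFiniteLength R M :=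
  ⟨fun h => isFiniteLength_of_maximalIdeal_le (maximalIdeal_le_of_supportDim_le_zero h),
    fun h => supportDim_le_zero_of_maximalIdeal_le (maximalIdeal_le_of_isFiniteLength h)⟩

omit [IsLocalRing R] [IsNoetherianRing R] in
lemma exists_mem_forall_notMem {J : Ideal R} {s : Set (Ideal R)} (hs : s.Finite)
    (hp : ∀ p ∈ s, p.IsPrime) (hJ : ∀ p ∈ s, ¬ J ≤ p) : ∃ x ∈ J, ∀ p ∈ s, x ∉ p := by
  by_contra hcon
  push Not at hcon
  have := (J.subset_union_prime_finite hs (f := id) 0 0 fun p h _ _ => hp p h).1 (fun x hx => by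
    obtain ⟨p, hp, hxp⟩ := hcon x hx
    exact Set.mem_biUnion hp hxp)
  obtain ⟨p, hp, hle⟩ := this
  exact hJ p hp hle

lemma supportDim_quotSMulTop_le {x : R} (hx : x ∈ maximalIdeal R) {d : ℕ}
    (hd : supportDim R M ≤ (d + 1 : ℕ))
    (h : ∀ p ∈ (annihilator R M).minimalPrimes, x ∈ p → maximalIdeal R ≤ p) :
    supportDim R (QuotSMulTop x M) ≤ d := by
  by_cases h0 : supportDim R M ≤ 0
  · exact (supportDim_le_of_surjective (Submodule.mkQ _)
      (Submodule.mkQ_surjective _)).trans (h0.trans (by exact_mod_cast Nat.zero_le d))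
  · have hn : ∀ p ∈ (annihilator R M).minimalPrimes, x ∉ p := by
      intro p hp hxp
      refine h0 (supportDim_le_zero_of_maximalIdeal_le fun q hq => ?_)
      have hle := h p hp hxp
      have hqm : annihilator R M ≤ q.asIdeal := Module.annihilator_le_of_mem_support hq
      have := hp.2 ⟨q.2, hqm⟩ ((IsLocalRing.le_maximalIdeal q.2.ne_top).trans hle)
      exact hle.trans this
    have := supportDim_quotSMulTop_succ_eq_of_notMem_minimalPrimes_of_mem_maximalIdeal hn hx
    rw [← this, Nat.cast_add, Nat.cast_one] at hd
    exact le_of_add_one_le_add_one hd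

omit [IsLocalRing R] [IsNoetherianRing R] in
lemma mem_support_of_mem_minimalPrimes {p : Ideal R} (hp : p ∈ (annihilator R M).minimalPrimes) :
    ∃ q ∈ Module.support R M, q.asIdeal = p := by
  refine ⟨⟨p, hp.1.1⟩, ?_, rfl⟩
  rw [Module.support_eq_zeroLocus]
  exact hp.1.2

lemma Primary.exists_supportDim_le {Q : Ideal R} (hQ : Primary Q M) (hQm : Q ≤ maximalIdeal R)
    {d : ℕ} (hd : supportDim R M ≤ (d + 1 : ℕ)) :
    ∃ y ∈ Q, supportDim R (QuotSMulTop y M) ≤ d := by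
  obtain ⟨y, hyQ, hy⟩ := exists_mem_forall_notMem (J := Q)
    (s := {p ∈ (annihilator R M).minimalPrimes | ¬ maximalIdeal R ≤ p})
    ((Ideal.finite_minimalPrimes_of_isNoetherianRing R _).subset fun p hp => hp.1)
    (fun p hp => hp.1.1.1) (fun p hp hle => by
      obtain ⟨q, hq, rfl⟩ := mem_support_of_mem_minimalPrimes hp.1
      exact hp.2 (hQ q hq hle))
  refine ⟨y, hyQ, supportDim_quotSMulTop_le (hQm hyQ) hd fun p hp hyp => ?_⟩
  by_contra hcon
  exact hy p ⟨hp, hcon⟩ hyp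

omit [IsLocalRing R] [IsNoetherianRing R] in
lemma mem_support_quotSMulTop_iff (x : R) (p : PrimeSpectrum R) :
    p ∈ Module.support R (QuotSMulTop x M) ↔ p ∈ Module.support R M ∧ x ∈ p.asIdeal := by
  rw [Module.support_quotSMulTop]
  simp

omit [IsNoetherianRing R] in
lemma primary_cons_iff {r : ℕ} (x : R) (y : Fin r → R) :
    Primary (Ideal.span (Set.range (Fin.cons x y : Fin (r + 1) → R))) M ↔
      Primary (Ideal.span (Set.range y)) (QuotSMulTop x M) := by
  have : ∀ p : Ideal R, Ideal.span (Set.range (Fin.cons x y : Fin (r + 1) → R)) ≤ p ↔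
      x ∈ p ∧ Ideal.span (Set.range y) ≤ p := by
    intro p
    rw [Fin.range_cons, Ideal.span_le, Set.insert_subset_iff, Ideal.span_le]
    rfl
  simp only [Primary, this, mem_support_quotSMulTop_iff]
  exact ⟨fun h p hp hy => h p hp.1 ⟨hp.2, hy⟩, fun h p hp hy => h p ⟨hp, hy.1⟩ hy.2⟩

lemma supportDim_le_of_primary {r : ℕ} (x : Fin r → R) (hx : ∀ i, x i ∈ maximalIdeal R)
    (h : Primary (Ideal.span (Set.range x)) M) : supportDim R M ≤ r := by
  induction r generalizing M with
  | zero =>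
    refine supportDim_le_zero_of_maximalIdeal_le fun p hp => h p hp ?_
    simp
  | succ r ih =>
    rw [← Fin.cons_self_tail x, primary_cons_iff] at h
    have := ih (Fin.tail x) (fun i => hx i.succ) h
    refine (supportDim_le_supportDim_quotSMulTop_succ (hx 0)).trans ?_
    push_cast
    gcongr

lemma exists_primary_of_supportDim_le {r : ℕ} (h : supportDim R M ≤ r) :
    ∃ x : Fin r → R, (∀ i, x i ∈ maximalIdeal R) ∧ Primary (Ideal.span (Set.range x)) M := by
  induction r generalizing M with
  | zero => exact ⟨Fin.elim0, fun i => i.elim0, fun p hp _ =>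
      maximalIdeal_le_of_supportDim_le_zero (by simpa using h) p hp⟩
  | succ r ih =>
    obtain ⟨y, hy, hd⟩ := primary_maximalIdeal.exists_supportDim_le le_rfl h
    obtain ⟨x, hx, hp⟩ := ih hd
    exact ⟨Fin.cons y x, Fin.cases hy hx, (primary_cons_iff y x).2 hp⟩

end

end Vasconcelos

namespace Vasconcelos

open IsLocalRing Module TensorProduct

universe u v w

section
variable {R : Type u} [CommRing R] [IsLocalRing R] [IsNoetherianRing R]
variable {M : Type v} [AddCommGroup M] [Module R M] [Module.Finite R M]
variable {S : Type w} [CommRing S] [IsLocalRing S] [Algebra R S]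

lemma eq_of_forall_le_natCast_iff {a b : WithBot ℕ∞} (h0 : a = ⊥ ↔ b = ⊥)
    (h : ∀ d : ℕ, a ≤ d ↔ b ≤ d) : a = b := by
  have key : ∀ {a b : WithBot ℕ∞}, (b = ⊥ → a = ⊥) → (∀ d : ℕ, b ≤ d → a ≤ d) → a ≤ b := by
    intro a b h0 h
    induction b with
    | bot => exact (h0 rfl).le
    | coe b =>
      induction b with
      | top => exact le_top
      | coe n => exact h n le_rfl
  exact le_antisymm (key h0.2 fun d => (h d).2) (key h0.1 fun d => (h d).1)

omit [IsNoetherianRing R] in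
lemma isLocalHom_of_map_maximalIdeal
    (hm : (maximalIdeal R).map (algebraMap R S) = maximalIdeal S) :
    IsLocalHom (algebraMap R S) where
  map_nonunit a ha := by
    by_contra h
    have h1 : algebraMap R S a ∈ maximalIdeal S := by
      rw [← hm]
      exact Ideal.mem_map_of_mem _ ((mem_maximalIdeal a).2 h)
    exact (mem_maximalIdeal _).1 h1 ha

section flat
variable [Module.Flat R S] (hm : (maximalIdeal R).map (algebraMap R S) = maximalIdeal S)
include hm

omit [IsNoetherianRing R] in
lemma faithfullyFlat_of_map_maximalIdeal : Module.FaithfullyFlat R S :=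
  haveI := isLocalHom_of_map_maximalIdeal hm
  Module.FaithfullyFlat.of_flat_of_isLocalHom

omit [IsNoetherianRing R] [Module.Finite R M] in
lemma length_tensor : Module.length S (S ⊗[R] M) = Module.length R M := by
  have := isLocalHom_of_map_maximalIdeal hm
  rw [IsLocalRing.length_baseChange, hm]
  have : IsSimpleModule S (S ⧸ maximalIdeal S) :=
    isSimpleModule_iff_isCoatom.2 (IsLocalRing.maximalIdeal.isMaximal S).out
  rw [Module.length_eq_one S (S ⧸ maximalIdeal S), mul_one]

omit [IsNoetherianRing R] [Module.Finite R M] in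
lemma length_tensor_quotient (Q : Ideal R) :
    Module.length S ((S ⊗[R] M) ⧸ Q.map (algebraMap R S) • (⊤ : Submodule S (S ⊗[R] M))) =
      Module.length R (M ⧸ Q • (⊤ : Submodule R M)) := by
  rw [(tensorQuotMapSMulEquivTensorQuot M S Q).length_eq, length_tensor hm]

omit [IsNoetherianRing R] [Module.Finite R M] in
lemma isFiniteLength_tensor_iff : IsFiniteLength S (S ⊗[R] M) ↔ IsFiniteLength R M := by
  rw [← Module.length_ne_top_iff, ← Module.length_ne_top_iff, length_tensor hm]

omit [IsNoetherianRing R] [Module.Finite R M] in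
lemma subsingleton_tensor_iff : Subsingleton (S ⊗[R] M) ↔ Subsingleton M := by
  rw [← Module.length_eq_zero_iff (R := S), ← Module.length_eq_zero_iff (R := R),
    length_tensor hm]

variable [IsNoetherianRing S]

lemma primary_tensor_iff {Q : Ideal R} :
    Primary (Q.map (algebraMap R S)) (S ⊗[R] M) ↔ Primary Q M := by
  rw [primary_iff, primary_iff, ← Module.length_ne_top_iff, ← Module.length_ne_top_iff,
    length_tensor_quotient hm]

lemma supportDim_tensor_le_of_le {d : ℕ} (h : supportDim R M ≤ d) :
    supportDim S (S ⊗[R] M) ≤ d := by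
  obtain ⟨x, hx, hp⟩ := exists_primary_of_supportDim_le h
  have h2 := (primary_tensor_iff (M := M) hm).2 hp
  rw [Ideal.map_span, ← Set.range_comp] at h2
  refine supportDim_le_of_primary _ (fun i => ?_) h2
  rw [← hm]
  exact Ideal.mem_map_of_mem _ (hx i)

omit [IsNoetherianRing R] [Flat R S] in
/-- Prime avoidance in the base ring for a flat local extension. -/
lemma exists_supportDim_tensor_quot_le {d : ℕ} (h : supportDim S (S ⊗[R] M) ≤ (d + 1 : ℕ)) :
    ∃ y ∈ maximalIdeal R,
      supportDim S (QuotSMulTop (algebraMap R S y) (S ⊗[R] M)) ≤ d := by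
  obtain ⟨y, hyQ, hy⟩ := exists_mem_forall_notMem (J := maximalIdeal R)
    (s := (fun p : Ideal S => p.comap (algebraMap R S)) ''
      {p ∈ (annihilator S (S ⊗[R] M)).minimalPrimes | ¬ maximalIdeal S ≤ p})
    (((Ideal.finite_minimalPrimes_of_isNoetherianRing S _).subset fun p hp => hp.1).image _)
    (by
      rintro _ ⟨p, hp, rfl⟩
      have := hp.1.1.1
      exact Ideal.comap_isPrime _ _) (by
      rintro _ ⟨p, hp, rfl⟩ hle
      refine hp.2 ?_
      rw [← hm]
      exact Ideal.map_le_iff_le_comap.2 hle)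
  refine ⟨y, hyQ, supportDim_quotSMulTop_le ?_ h fun p hp hyp => ?_⟩
  · rw [← hm]
    exact Ideal.mem_map_of_mem _ hyQ
  · by_contra hcon
    exact hy _ ⟨p, ⟨hp, hcon⟩, rfl⟩ hyp

lemma supportDim_tensor_le_iff {d : ℕ} :
    supportDim S (S ⊗[R] M) ≤ d ↔ supportDim R M ≤ d := by
  refine ⟨fun h => ?_, supportDim_tensor_le_of_le hm⟩
  induction d generalizing M with
  | zero =>
    rw [Nat.cast_zero, supportDim_le_zero_iff] at h ⊢
    exact (isFiniteLength_tensor_iff hm).1 h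
  | succ d ih =>
    obtain ⟨y, hy, h1⟩ := exists_supportDim_tensor_quot_le hm h
    rw [supportDim_eq_of_equiv (QuotSMulTop.algebraMapTensorEquivTensorQuotSMulTop y M S)] at h1
    refine (supportDim_le_supportDim_quotSMulTop_succ hy).trans ?_
    have := ih h1
    push_cast
    gcongr

lemma supportDim_tensor_eq : supportDim S (S ⊗[R] M) = supportDim R M := by
  by_cases hM : Subsingleton M
  · have := (subsingleton_tensor_iff (S := S) (M := M) hm).2 hM
    rw [supportDim_eq_bot_of_subsingleton, supportDim_eq_bot_of_subsingleton]
  have hM' : ¬ Subsingleton (S ⊗[R] M) := fun h => hM ((subsingleton_tensor_iff hm).1 h)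
  refine eq_of_forall_le_natCast_iff ?_ fun d => supportDim_tensor_le_iff hm
  simp [supportDim_eq_bot_iff_subsingleton, hM, hM']
end flat
end

end Vasconcelos

namespace Vasconcelos

open Finset

/-- The Hilbert polynomial of degree `t` with coefficients `s`, evaluated at `n`. -/
def hsum (t : ℕ) (s : ℕ → ℤ) (n : ℕ) : ℤ :=
  ∑ i ∈ range (t + 1), (-1 : ℤ) ^ i * s i * ((n + t - i).choose (t - i) : ℤ)

/-- `f` eventually agrees with the polynomial `hsum t s`. -/
def HP (f : ℕ → ℤ) (t : ℕ) (s : ℕ → ℤ) : Prop := ∃ N, ∀ n ≥ N, f n = hsum t s n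

lemma hsum_succ_sub (t : ℕ) (s : ℕ → ℤ) (n : ℕ) :
    hsum (t + 1) s (n + 1) - hsum (t + 1) s n = hsum t s (n + 1) := by
  rw [hsum, sum_range_succ, hsum, sum_range_succ (n := t + 1), hsum]
  simp only [Nat.sub_self, Nat.choose_zero_right]
  rw [add_sub_add_right_eq_sub, ← sum_sub_distrib]
  refine sum_congr rfl fun i hi => ?_
  obtain ⟨k, rfl⟩ := Nat.exists_eq_add_of_le (Nat.lt_succ_iff.1 (mem_range.1 hi))
  have e1 : n + 1 + (i + k + 1) - i = n + k + 1 + 1 := by omega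
  have e2 : n + (i + k + 1) - i = n + k + 1 := by omega
  have e3 : n + 1 + (i + k) - i = n + k + 1 := by omega
  have e4 : i + k + 1 - i = k + 1 := by omega
  have e5 : i + k - i = k := by omega
  rw [e1, e2, e3, e4, e5, Nat.choose_succ_succ (n + k + 1) k]
  push_cast
  ring

lemma hsum_succ_eq (t : ℕ) (s : ℕ → ℤ) (n : ℕ) :
    hsum (t + 1) s n = s 0 * ((n + t + 1).choose (t + 1) : ℤ) - hsum t (fun i => s (i + 1)) n := by
  rw [hsum, sum_range_succ', hsum, sub_eq_add_neg, ← sum_neg_distrib, add_comm]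
  congr 1
  · simp [add_assoc]
  · refine sum_congr rfl fun i hi => ?_
    have e1 : n + (t + 1) - (i + 1) = n + t - i := by omega
    have e2 : t + 1 - (i + 1) = t - i := by omega
    rw [e1, e2]
    ring

lemma hsum_sub (t : ℕ) (s s' : ℕ → ℤ) (n : ℕ) :
    hsum t (fun i => s i - s' i) n = hsum t s n - hsum t s' n := by
  rw [hsum, hsum, hsum, ← sum_sub_distrib]
  exact sum_congr rfl fun i _ => by ring

lemma hsum_update_last (t : ℕ) (s : ℕ → ℤ) (c : ℤ) (n : ℕ) :
    hsum t (fun i => if i = t then s t + (-1) ^ t * c else s i) n = hsum t s n + c := by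
  rw [hsum, sum_range_succ, hsum, sum_range_succ, add_assoc]
  congr 1
  · refine sum_congr rfl fun i hi => ?_
    rw [if_neg (mem_range.1 hi).ne]
  · have : ((-1 : ℤ) ^ t) * (-1) ^ t = 1 := by rw [← mul_pow]; simp
    simp only [if_true, Nat.sub_self, Nat.choose_zero_right, Nat.cast_one, mul_one, mul_add]
    rw [← mul_assoc, this, one_mul]

lemma abs_hsum_le (t : ℕ) (s : ℕ → ℤ) (n : ℕ) :
    |hsum t s n| ≤ (∑ i ∈ range (t + 1), |s i|) * ((n + t).choose t : ℤ) := by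
  rw [hsum, sum_mul]
  refine (abs_sum_le_sum_abs _ _).trans (sum_le_sum fun i hi => ?_)
  rw [abs_mul, abs_mul, abs_pow, abs_neg, abs_one, one_pow, one_mul, Nat.abs_cast]
  gcongr
  obtain ⟨k, rfl⟩ := Nat.exists_eq_add_of_le (Nat.lt_succ_iff.1 (mem_range.1 hi))
  have e2 : n + (i + k) - i = n + k := by omega
  have e5 : i + k - i = k := by omega
  rw [e2, e5, Nat.choose_symm_add.symm, Nat.choose_symm_add.symm]
  exact Nat.choose_le_choose n (by omega)

lemma eq_zero_of_hsum_bound {k t : ℕ} (hk : k ≤ t) {s : ℕ → ℤ} {C : ℤ} {N : ℕ}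
    (h : ∀ n ≥ N, |hsum (t + 1) s n| ≤ C * (n + 1) ^ k) : s 0 = 0 := by
  by_contra hs
  have hs1 : 1 ≤ |s 0| := Int.one_le_abs hs
  set A := ∑ i ∈ range (t + 1), |s (i + 1)| with hA
  have hC : 0 ≤ C := by
    have h1 := (abs_nonneg _).trans (h N le_rfl)
    exact nonneg_of_mul_nonneg_left h1 (by positivity)
  have key : ∀ n ≥ N, (n : ℤ) + t + 1 ≤ (t + 1) * (C * (t.factorial : ℤ) + A) := by
    intro n hn
    have h1 := h n hn
    rw [hsum_succ_eq] at h1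
    have h2 := abs_hsum_le t (fun i => s (i + 1)) n
    rw [← hA] at h2
    set D : ℤ := ((n + t).choose t : ℤ) with hD
    have hDpos : 0 < D := by
      rw [hD]; exact_mod_cast Nat.choose_pos (by omega)
    have h3 : |s 0| * ((n + t + 1).choose (t + 1) : ℤ) ≤ C * (n + 1) ^ k + A * D := by
      have := abs_sub_abs_le_abs_sub (s 0 * ((n + t + 1).choose (t + 1) : ℤ))
        (hsum t (fun i => s (i + 1)) n)
      rw [abs_mul, Nat.abs_cast] at this
      linarith
    have h4 : ((n + t + 1).choose (t + 1) : ℤ) * (t + 1) = (n + t + 1) * D := by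
      have := Nat.add_one_mul_choose_eq (n + t) t
      rw [hD]; exact_mod_cast this.symm
    have h5 : ((n : ℤ) + 1) ^ k ≤ t.factorial * D := by
      have := Nat.pow_succ_le_ascFactorial (n + 1) t
      rw [Nat.ascFactorial_eq_factorial_mul_choose] at this
      have h6 : (n + 1) ^ k ≤ (n + 1) ^ t := Nat.pow_le_pow_right (by omega) hk
      rw [hD]; exact_mod_cast h6.trans this
    have h7 : ((n : ℤ) + t + 1) * D ≤ ((t + 1) * (C * (t.factorial : ℤ) + A)) * D := by
      calc ((n : ℤ) + t + 1) * D = ((n + t + 1).choose (t + 1) : ℤ) * (t + 1) := h4.symm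
        _ ≤ (|s 0| * ((n + t + 1).choose (t + 1) : ℤ)) * (t + 1) := by
          gcongr
          exact le_mul_of_one_le_left (by positivity) hs1
        _ ≤ (C * (n + 1) ^ k + A * D) * (t + 1) := by gcongr
        _ ≤ (C * (t.factorial * D) + A * D) * (t + 1) := by gcongr
        _ = _ := by ring
    exact le_of_mul_le_mul_right h7 hDpos
  have := key (N + ((t + 1) * (C * (t.factorial : ℤ) + A)).toNat) (by omega)
  have h8 := Int.self_le_toNat ((t + 1) * (C * (t.factorial : ℤ) + A))
  push_cast at this
  omega

lemma hsum_eq_zero_of_bound {k t : ℕ} {s : ℕ → ℤ} {C : ℤ} {N : ℕ}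
    (h : ∀ n ≥ N, |hsum t s n| ≤ C * (n + 1) ^ k) {i : ℕ} (hi : i + k < t) : s i = 0 := by
  induction t generalizing s i with
  | zero => omega
  | succ t ih =>
    have h0 := eq_zero_of_hsum_bound (by omega) h
    cases i with
    | zero => exact h0
    | succ i =>
      refine ih (s := fun i => s (i + 1)) (fun n hn => ?_) (i := i) (by omega)
      have := h n hn
      rwa [hsum_succ_eq, h0, zero_mul, zero_sub, abs_neg] at this

lemma HP.eq_of_bound {f g : ℕ → ℤ} {k t : ℕ} {s s' : ℕ → ℤ} (hf : HP f t s) (hg : HP g t s')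
    {C : ℤ} (h : ∀ n, |f n - g n| ≤ C * (n + 1) ^ k) {i : ℕ} (hi : i + k < t) : s i = s' i := by
  obtain ⟨N, hN⟩ := hf
  obtain ⟨N', hN'⟩ := hg
  refine sub_eq_zero.1 (hsum_eq_zero_of_bound (s := fun i => s i - s' i) (C := C) (N := max N N')
    (fun n hn => ?_) hi)
  rw [hsum_sub, ← hN n (by omega), ← hN' n (by omega)]
  exact h n

lemma HP.sub_of_succ {f g : ℕ → ℤ} {t : ℕ} {s : ℕ → ℤ} (hf : HP f (t + 1) s) {N : ℕ}
    (h : ∀ n ≥ N, f (n + 1) - f n = g (n + 1)) : HP g t s := by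
  obtain ⟨N', hN'⟩ := hf
  refine ⟨max N N' + 1, fun n hn => ?_⟩
  obtain ⟨n, rfl⟩ := Nat.exists_eq_add_of_le' (show 1 ≤ n by omega)
  rw [← h n (by omega), hN' _ (by omega), hN' n (by omega), hsum_succ_sub]

lemma HP.exists_succ {f g : ℕ → ℤ} {t : ℕ} {s : ℕ → ℤ} (hg : HP g t s) {N : ℕ} (c : ℤ)
    (h : ∀ n ≥ N, f (n + 1) - f n = g (n + 1) + c) : ∃ s', HP f (t + 1) s' := by
  obtain ⟨N', hN'⟩ := hg
  set s₁ : ℕ → ℤ := fun i => if i = t then s t + (-1) ^ t * c else s i with hs₁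
  have h1 : ∀ n ≥ max N N', f (n + 1) - f n = hsum (t + 1) s₁ (n + 1) - hsum (t + 1) s₁ n := by
    intro n hn
    rw [h n (by omega), hN' _ (by omega), hsum_succ_sub, hs₁, hsum_update_last]
  set d := f (max N N') - hsum (t + 1) s₁ (max N N') with hd
  have h2 : ∀ n ≥ max N N', f n = hsum (t + 1) s₁ n + d := by
    intro n hn
    induction n, hn using Nat.le_induction with
    | base => rw [hd]; ring
    | succ n hn ih =>
      have := h1 n hn
      linarith
  exact ⟨_, max N N', fun n hn => by rw [h2 n hn, ← hsum_update_last]⟩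

end Vasconcelos

namespace Vasconcelos

open IsLocalRing Module TensorProduct
open scoped Pointwise

universe u v w

section
variable {R : Type u} [CommRing R]
variable {M : Type v} [AddCommGroup M] [Module R M]

/-- The Hilbert–Samuel function of `M` with respect to `Q`. -/
noncomputable def hilb (Q : Ideal R) (M : Type*) [AddCommGroup M] [Module R M] (n : ℕ) : ℤ :=
  ((Module.length R (M ⧸ Q ^ (n + 1) • (⊤ : Submodule R M))).toNat : ℤ)

lemma pow_smul_top_le_comap (Q : Ideal R) {N : Type*} [AddCommGroup N] [Module R N]
    (f : M →ₗ[R] N) (n : ℕ) :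
    Q ^ n • (⊤ : Submodule R M) ≤ (Q ^ n • (⊤ : Submodule R N)).comap f := by
  rw [← Submodule.map_le_iff_le_comap, Submodule.map_smul'']
  exact smul_mono_right _ le_top

lemma pow_smul_top_le_comap_lsmul {Q : Ideal R} {y : R} (hy : y ∈ Q) (n : ℕ) :
    Q ^ n • (⊤ : Submodule R M) ≤
      (Q ^ (n + 1) • (⊤ : Submodule R M)).comap (LinearMap.lsmul R M y) := by
  intro x hx
  rw [Submodule.mem_comap, pow_succ', Submodule.mul_smul]
  exact Submodule.smul_mem_smul hy hx

/-- Multiplication by `y ∈ Q` as a map `M/QⁿM → M/Qⁿ⁺¹M`. -/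
noncomputable def mulQuot {Q : Ideal R} {y : R} (hy : y ∈ Q) (n : ℕ) :
    (M ⧸ Q ^ n • (⊤ : Submodule R M)) →ₗ[R] (M ⧸ Q ^ (n + 1) • (⊤ : Submodule R M)) :=
  Submodule.mapQ _ _ (LinearMap.lsmul R M y) (pow_smul_top_le_comap_lsmul hy n)

/-- The map on quotients by `Qⁿ` induced by a linear map. -/
noncomputable def quotMap (Q : Ideal R) {N : Type*} [AddCommGroup N] [Module R N]
    (f : M →ₗ[R] N) (n : ℕ) :
    (M ⧸ Q ^ n • (⊤ : Submodule R M)) →ₗ[R] (N ⧸ Q ^ n • (⊤ : Submodule R N)) :=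
  Submodule.mapQ _ _ f (pow_smul_top_le_comap Q f n)

lemma quotMap_surjective (Q : Ideal R) {N : Type*} [AddCommGroup N] [Module R N]
    {f : M →ₗ[R] N} (hf : Function.Surjective f) (n : ℕ) :
    Function.Surjective (quotMap Q f n) := by
  intro x
  obtain ⟨x, rfl⟩ := Submodule.Quotient.mk_surjective _ x
  obtain ⟨y, rfl⟩ := hf x
  exact ⟨Submodule.Quotient.mk y, rfl⟩

/-- If `f` is surjective, an element mapped into `QⁿN` differs from an element of `QⁿM` by an
element of the kernel. -/
lemma exists_mem_of_map_mem (Q : Ideal R) {N : Type*} [AddCommGroup N] [Module R N]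
    {f : M →ₗ[R] N} (hf : Function.Surjective f) (n : ℕ) {x : M}
    (hx : f x ∈ Q ^ n • (⊤ : Submodule R N)) :
    ∃ y ∈ Q ^ n • (⊤ : Submodule R M), f (x - y) = 0 := by
  have : Q ^ n • (⊤ : Submodule R N) = (Q ^ n • (⊤ : Submodule R M)).map f := by
    rw [Submodule.map_smul'', Submodule.map_top, LinearMap.range_eq_top.2 hf]
  rw [this] at hx
  obtain ⟨y, hy, hxy⟩ := hx
  exact ⟨y, hy, by rw [map_sub, hxy, sub_self]⟩

lemma length_mulQuot {Q : Ideal R} {y : R} (hy : y ∈ Q) (n : ℕ) :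
    Module.length R (M ⧸ Q ^ (n + 1) • (⊤ : Submodule R M)) +
        Module.length R (LinearMap.ker (mulQuot (M := M) hy n)) =
      Module.length R (M ⧸ Q ^ n • (⊤ : Submodule R M)) +
        Module.length R (QuotSMulTop y M ⧸ Q ^ (n + 1) • (⊤ : Submodule R (QuotSMulTop y M))) := by
  have h1 := Module.length_eq_add_of_exact (LinearMap.ker (mulQuot (M := M) hy n)).subtype
    (mulQuot (M := M) hy n).rangeRestrict (Submodule.subtype_injective _)
    (LinearMap.surjective_rangeRestrict _) (by
      rw [LinearMap.exact_iff, LinearMap.ker_rangeRestrict, Submodule.range_subtype])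
  have h2 := Module.length_eq_add_of_exact (LinearMap.range (mulQuot (M := M) hy n)).subtype
    (quotMap Q (M := M) (N := QuotSMulTop y M) (Submodule.mkQ _) (n + 1)) (Submodule.subtype_injective _)
    (quotMap_surjective Q (Submodule.mkQ_surjective _) _) (by
      rw [LinearMap.exact_iff, Submodule.range_subtype]
      apply le_antisymm
      · intro x hx
        obtain ⟨x, rfl⟩ := Submodule.Quotient.mk_surjective _ x
        have hx : Submodule.mkQ (y • (⊤ : Submodule R M)) x ∈
            Q ^ (n + 1) • (⊤ : Submodule R (QuotSMulTop y M)) :=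
          (Submodule.Quotient.mk_eq_zero _).1 hx
        obtain ⟨z, hz, hxz⟩ := exists_mem_of_map_mem Q (Submodule.mkQ_surjective _) _ hx
        obtain ⟨w, -, hw⟩ := (Submodule.Quotient.mk_eq_zero _).1 hxz
        refine ⟨Submodule.Quotient.mk w, ?_⟩
        refine (Submodule.Quotient.eq _).2 ?_
        have : LinearMap.lsmul R M y w = x - z := hw
        rw [this, sub_sub_cancel_left]
        exact neg_mem hz
      · rintro _ ⟨x, rfl⟩
        obtain ⟨x, rfl⟩ := Submodule.Quotient.mk_surjective _ x
        refine (Submodule.Quotient.mk_eq_zero _).2 ?_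
        have : Submodule.mkQ (y • (⊤ : Submodule R M)) (y • x) = 0 :=
          (Submodule.Quotient.mk_eq_zero _).2 ⟨x, trivial, rfl⟩
        change Submodule.mkQ (y • (⊤ : Submodule R M)) (y • x) ∈ _
        rw [this]
        exact zero_mem _)
  rw [h1, h2]
  ring

lemma pow_smul_top_eq_of_forall_smul_eq_zero {r : ℕ} {ξ : R} (y : Fin r → R)
    (h : ∀ x : M, ξ • x = 0) (n : ℕ) :
    Ideal.span (Set.range (Fin.cons ξ y : Fin (r + 1) → R)) ^ n • (⊤ : Submodule R M) =
      Ideal.span (Set.range y) ^ n • (⊤ : Submodule R M) := by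
  induction n with
  | zero => simp
  | succ n ih =>
    rw [pow_succ', pow_succ', Submodule.mul_smul, Submodule.mul_smul, ih, Fin.range_cons,
      Ideal.span_insert, Submodule.sup_smul, sup_eq_right, Submodule.smul_le]
    intro a ha x _
    obtain ⟨b, rfl⟩ := Ideal.mem_span_singleton'.1 ha
    rw [mul_smul, h, smul_zero]
    exact zero_mem _

lemma QuotSMulTop.smul_eq_zero' (ξ : R) (x : QuotSMulTop ξ M) : ξ • x = 0 :=
  Module.mem_annihilator.1 (QuotSMulTop.mem_annihilator M ξ) x

lemma hilb_cons {r : ℕ} (ξ : R) (y : Fin r → R) :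
    hilb (Ideal.span (Set.range (Fin.cons ξ y : Fin (r + 1) → R))) (QuotSMulTop ξ M) =
      hilb (Ideal.span (Set.range y)) (QuotSMulTop ξ M) := by
  funext n
  rw [hilb, hilb, pow_smul_top_eq_of_forall_smul_eq_zero y (QuotSMulTop.smul_eq_zero' ξ)]

variable [IsLocalRing R]

lemma hilb_tensor {S : Type w} [CommRing S] [IsLocalRing S] [Algebra R S] [Module.Flat R S]
    (hm : (maximalIdeal R).map (algebraMap R S) = maximalIdeal S) (Q : Ideal R) :
    hilb (Q.map (algebraMap R S)) (S ⊗[R] M) = hilb Q M := by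
  funext n
  rw [hilb, hilb, ← Ideal.map_pow, length_tensor_quotient hm]

variable [IsNoetherianRing R] [Module.Finite R M]

lemma Primary.coe_hilb {Q : Ideal R} (h : Primary Q M) (n : ℕ) :
    Module.length R (M ⧸ Q ^ (n + 1) • (⊤ : Submodule R M)) = ((hilb Q M n).toNat : ℕ∞) := by
  rw [hilb, Int.toNat_natCast, ENat.natCast_toNat (h.length_ne_top _)]

omit [IsLocalRing R] [IsNoetherianRing R] [Module.Finite R M] in
lemma hilb_nonneg (Q : Ideal R) (n : ℕ) : 0 ≤ hilb Q M n := Int.natCast_nonneg _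

lemma Primary.hilb_succ_le {Q : Ideal R} (h : Primary Q M) {y : R} (hy : y ∈ Q) (n : ℕ) :
    hilb Q M (n + 1) ≤ hilb Q M n + hilb Q (QuotSMulTop y M) (n + 1) := by
  have h1 := length_mulQuot (M := M) hy (n + 1)
  have h2 : Primary Q (QuotSMulTop y M) := h.of_surjective _ (Submodule.mkQ_surjective _)
  rw [h.coe_hilb, h.coe_hilb, h2.coe_hilb] at h1
  have h3 := le_self_add.trans h1.le
  have := hilb_nonneg (M := M) Q n
  have := hilb_nonneg (M := M) Q (n + 1)
  have := hilb_nonneg (M := QuotSMulTop y M) Q (n + 1)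
  norm_cast at h3
  omega

lemma exists_hilb_le {Q : Ideal R} (h : Primary Q M) (hQm : Q ≤ maximalIdeal R) {d : ℕ}
    (hd : supportDim R M ≤ d) : ∃ C : ℤ, ∀ n : ℕ, hilb Q M n ≤ C * (n + 1) ^ d := by
  induction d generalizing M with
  | zero =>
    have h0 : Module.length R M ≠ ⊤ :=
      Module.length_ne_top_iff.2 (supportDim_le_zero_iff.1 (by simpa using hd))
    refine ⟨((Module.length R M).toNat : ℤ), fun n => ?_⟩
    rw [pow_zero, mul_one, hilb]
    exact_mod_cast ENat.toNat_le_toNat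
      (Module.length_le_of_surjective _ (Submodule.mkQ_surjective _)) h0
  | succ d ih =>
    obtain ⟨y, hy, hyd⟩ := h.exists_supportDim_le hQm hd
    obtain ⟨C, hC⟩ := ih (h.of_surjective _ (Submodule.mkQ_surjective _)) hyd
    have hC0 : 0 ≤ C := by
      have := (hilb_nonneg (M := QuotSMulTop y M) Q 0).trans (hC 0)
      simpa using this
    refine ⟨hilb Q M 0 + C, fun n => ?_⟩
    have h0 := hilb_nonneg (M := M) Q 0
    induction n with
    | zero => simpa using hC0
    | succ n ihn =>
      have h1 := h.hilb_succ_le hy n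
      have h2 := hC (n + 1)
      push_cast at h2 ⊢
      have h3 : ((n : ℤ) + 1) ^ d ≤ (n + 1 + 1) ^ d := by gcongr; omega
      have h4 : (0 : ℤ) ≤ (n + 1 + 1) ^ d := by positivity
      calc hilb Q M (n + 1) ≤ (hilb Q M 0 + C) * (n + 1) ^ (d + 1) + C * (n + 1 + 1) ^ d :=
            h1.trans (add_le_add ihn h2)
        _ = (hilb Q M 0 + C) * (n + 1) * (n + 1) ^ d + C * (n + 1 + 1) ^ d := by ring
        _ ≤ (hilb Q M 0 + C) * (n + 1) * (n + 1 + 1) ^ d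
            + (hilb Q M 0 + C) * (n + 1 + 1) ^ d := by
          gcongr
          omega
        _ = _ := by ring

lemma hilb_quotient_bound {Q : Ideal R} (h : Primary Q M) (L : Submodule R M) (n : ℕ) :
    |hilb Q M n - hilb Q (M ⧸ L) n| ≤ hilb Q L n := by
  have h1 : Primary Q L := h.of_injective _ L.subtype_injective
  have h2 : Primary Q (M ⧸ L) := h.of_surjective _ L.mkQ_surjective
  set g := quotMap Q L.mkQ (n + 1)
  have hg := quotMap_surjective Q L.mkQ_surjective (n + 1)
  have e1 := Module.length_eq_add_of_exact (LinearMap.ker g).subtype g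
    (Submodule.subtype_injective _) hg (by
      rw [LinearMap.exact_iff, Submodule.range_subtype])
  have hr : ∀ x, quotMap Q L.subtype (n + 1) x ∈ LinearMap.ker g := by
    intro x
    obtain ⟨x, rfl⟩ := Submodule.Quotient.mk_surjective _ x
    refine (Submodule.Quotient.mk_eq_zero _).2 ?_
    change L.mkQ x ∈ _
    rw [Submodule.mkQ_apply, (Submodule.Quotient.mk_eq_zero L).2 x.2]
    exact zero_mem _
  have e2 : Module.length R (LinearMap.ker g) ≤ _ := Module.length_le_of_surjective
    ((quotMap Q L.subtype (n + 1)).codRestrict (LinearMap.ker g) hr) (by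
      rintro ⟨x, hx⟩
      obtain ⟨x, rfl⟩ := Submodule.Quotient.mk_surjective _ x
      have hx : L.mkQ x ∈ Q ^ (n + 1) • (⊤ : Submodule R (M ⧸ L)) :=
        (Submodule.Quotient.mk_eq_zero _).1 hx
      obtain ⟨z, hz, hxz⟩ := exists_mem_of_map_mem Q (Submodule.mkQ_surjective _) _ hx
      refine ⟨Submodule.Quotient.mk ⟨x - z, (Submodule.Quotient.mk_eq_zero L).1 hxz⟩, ?_⟩
      refine Subtype.ext ((Submodule.Quotient.eq _).2 ?_)
      change (x - z) - x ∈ _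
      rw [sub_sub_cancel_left]
      exact neg_mem hz)
  have e3 : Module.length R (LinearMap.ker g) ≠ ⊤ :=
    ne_top_of_le_ne_top (h1.length_ne_top (n + 1)) e2
  rw [← ENat.natCast_toNat e3] at e1 e2
  rw [h.coe_hilb, h2.coe_hilb] at e1
  rw [h1.coe_hilb] at e2
  have := hilb_nonneg (M := M) Q n
  have := hilb_nonneg (M := L) Q n
  have := hilb_nonneg (M := M ⧸ L) Q n
  norm_cast at e1 e2
  rw [abs_le]
  omega

end

end Vasconcelos

namespace Vasconcelos

open IsLocalRing Module TensorProduct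
open scoped Pointwise

universe u v w

section
variable {R : Type u} [CommRing R] [IsLocalRing R] [IsNoetherianRing R]
variable {M : Type v} [AddCommGroup M] [Module R M] [Module.Finite R M]

lemma eq_zero_of_forall_mem_pow {Q : Ideal R} (hQm : Q ≤ maximalIdeal R) {c : ℕ} {y : M}
    (h : ∀ n ≥ c, y ∈ Q ^ n • (⊤ : Submodule R M)) : y = 0 := by
  have h1 : (⨅ i : ℕ, Q ^ i • ⊤ : Submodule R M) = ⊥ :=
    Q.iInf_pow_smul_eq_bot_of_isLocalRing
      (ne_top_of_le_ne_top (IsLocalRing.maximalIdeal.isMaximal R).ne_top hQm)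
  rw [← Submodule.mem_bot R, ← h1, Submodule.mem_iInf]
  intro i
  have := h (max i c) (le_max_right _ _)
  exact Submodule.smul_mono_left (Ideal.pow_le_pow_right (le_max_left _ _)) this

section superficial
variable {Q : Ideal R} (hQm : Q ≤ maximalIdeal R) {ξ : R} (hξ : ξ ∈ Q) {c : ℕ}
  (hc : ∀ n ≥ c, ∀ y ∈ Q ^ n • (⊤ : Submodule R M), ξ • y ∈ Q ^ (n + 2) • (⊤ : Submodule R M) →
    y ∈ Q ^ (n + 1) • (⊤ : Submodule R M))
include hQm hc

lemma eq_zero_of_superficial {y : M} (hy : y ∈ Q ^ c • (⊤ : Submodule R M)) (h : ξ • y = 0) :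
    y = 0 := by
  refine eq_zero_of_forall_mem_pow hQm (c := c) fun n hn => ?_
  induction n, hn using Nat.le_induction with
  | base => exact hy
  | succ n hn ih => exact hc n hn y ih (h ▸ zero_mem _)

lemma isFiniteLength_ker_superficial (hQ : Primary Q M) :
    IsFiniteLength R (LinearMap.ker (LinearMap.lsmul R M ξ)) := by
  rw [← Module.length_ne_top_iff]
  refine ne_top_of_le_ne_top (hQ.length_ne_top c) (Module.length_le_of_injective
    ((Submodule.mkQ (Q ^ c • (⊤ : Submodule R M))).comp
      (LinearMap.ker (LinearMap.lsmul R M ξ)).subtype) ?_)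
  rw [← LinearMap.ker_eq_bot, LinearMap.ker_eq_bot']
  rintro ⟨x, hx⟩ h
  exact Subtype.ext (eq_zero_of_superficial hQm hc ((Submodule.Quotient.mk_eq_zero _).1 h) hx)

omit [IsLocalRing R] hQm in
lemma exists_smul_eq_smul_of_superficial :
    ∃ n₀ ≥ c, ∀ n ≥ n₀, ∀ y, ξ • y ∈ Q ^ (n + 1) • (⊤ : Submodule R M) →
      ∃ z ∈ Q ^ n • (⊤ : Submodule R M), ξ • y = ξ • z := by
  obtain ⟨k, hk⟩ := Q.exists_pow_inf_eq_pow_smul (M := M) (LinearMap.range (LinearMap.lsmul R M ξ))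
  refine ⟨k + c, by omega, fun n hn y hy => ?_⟩
  have h1 : ξ • y ∈ Q ^ (n + 1) • (⊤ : Submodule R M) ⊓ LinearMap.range (LinearMap.lsmul R M ξ) :=
    ⟨hy, y, rfl⟩
  rw [hk (n + 1) (by omega)] at h1
  have h2 : ξ • y ∈ Q ^ (n + 1 - k) • LinearMap.range (LinearMap.lsmul R M ξ) :=
    (smul_mono_right _ inf_le_right : _ ≤ Q ^ (n + 1 - k) • LinearMap.range (LinearMap.lsmul R M ξ)) h1
  rw [← Submodule.map_top, ← Submodule.map_smul''] at h2
  obtain ⟨z, hz, hyz⟩ := h2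
  have hyz : ξ • z = ξ • y := hyz
  have key : ∀ i, n + 1 - k ≤ i → i ≤ n → z ∈ Q ^ i • (⊤ : Submodule R M) := by
    intro i hi
    induction i, hi using Nat.le_induction with
    | base => exact fun _ => hz
    | succ i hi ih =>
      intro hin
      refine hc i (by omega) z (ih (by omega)) ?_
      rw [hyz]
      exact Submodule.smul_mono_left (Ideal.pow_le_pow_right (by omega)) hy
  refine ⟨z, ?_, hyz.symm⟩
  by_cases hkn : 1 ≤ k
  · exact key n (by omega) le_rfl
  · exact Submodule.smul_mono_left (Ideal.pow_le_pow_right (by omega)) hz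

include hξ in
lemma hilb_sub_of_superficial (hQ : Primary Q M) :
    ∃ n₀, ∀ n ≥ n₀, hilb Q M (n + 1) - hilb Q M n = hilb Q (QuotSMulTop ξ M) (n + 1) +
      -((Module.length R (LinearMap.ker (LinearMap.lsmul R M ξ))).toNat : ℤ) := by
  obtain ⟨n₀, hn₀, hz⟩ := exists_smul_eq_smul_of_superficial hc
  refine ⟨n₀, fun n hn => ?_⟩
  have hr : ∀ x : LinearMap.ker (LinearMap.lsmul R M ξ),
      Submodule.mkQ (Q ^ (n + 1) • (⊤ : Submodule R M)) x ∈
        LinearMap.ker (mulQuot (M := M) hξ (n + 1)) := by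
    intro x
    refine (Submodule.Quotient.mk_eq_zero _).2 ?_
    rw [x.2]
    exact zero_mem _
  let φ := (((Submodule.mkQ (Q ^ (n + 1) • (⊤ : Submodule R M))).comp
      (LinearMap.ker (LinearMap.lsmul R M ξ)).subtype)).codRestrict _ hr
  have hφ : Function.Bijective φ := by
    constructor
    · rw [← LinearMap.ker_eq_bot, LinearMap.ker_eq_bot']
      rintro ⟨x, hx⟩ h
      refine Subtype.ext (eq_zero_of_superficial hQm hc ?_ hx)
      have h := (Submodule.Quotient.mk_eq_zero _).1 (congrArg Subtype.val h)
      exact Submodule.smul_mono_left (Ideal.pow_le_pow_right (by omega)) h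
    · rintro ⟨x, hx⟩
      obtain ⟨x, rfl⟩ := Submodule.Quotient.mk_surjective _ x
      obtain ⟨z, hzQ, hxz⟩ := hz (n + 1) (by omega) x ((Submodule.Quotient.mk_eq_zero _).1 hx)
      refine ⟨⟨x - z, ?_⟩, Subtype.ext ((Submodule.Quotient.eq _).2 ?_)⟩
      · change ξ • (x - z) = 0
        rw [smul_sub, hxz, sub_self]
      · change (x - z) - x ∈ _
        rw [sub_sub_cancel_left]
        exact neg_mem hzQ
  have h1 := length_mulQuot (M := M) hξ (n + 1)
  have h2 : Primary Q (QuotSMulTop ξ M) := hQ.of_surjective _ (Submodule.mkQ_surjective _)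
  rw [hQ.coe_hilb, hQ.coe_hilb, h2.coe_hilb, ← (LinearEquiv.ofBijective φ hφ).length_eq,
    ← ENat.natCast_toNat (Module.length_ne_top_iff.2 (isFiniteLength_ker_superficial hQm hc hQ))]
    at h1
  have := hilb_nonneg (M := M) Q n
  have := hilb_nonneg (M := M) Q (n + 1)
  have := hilb_nonneg (M := QuotSMulTop ξ M) Q (n + 1)
  norm_cast at h1
  omega

end superficial

end
section
variable {R : Type u} [CommRing R] [IsLocalRing R] [IsNoetherianRing R]
variable {M : Type u} [AddCommGroup M] [Module R M] [Module.Finite R M]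

/-- Existence of Hilbert coefficients. -/
theorem exists_HP {r : ℕ} (x : Fin r → R) (hx : ∀ i, x i ∈ maximalIdeal R)
    (h : Primary (Ideal.span (Set.range x)) M) :
    ∃ s, HP (hilb (Ideal.span (Set.range x)) M) r s := by
  induction r generalizing R M with
  | zero =>
    have h0 : Ideal.span (Set.range x) = ⊥ := by simp
    refine ⟨fun _ => (Module.length R (M ⧸ (⊥ : Submodule R M))).toNat, 0, fun n _ => ?_⟩
    rw [h0, hilb, ← Ideal.zero_eq_bot, zero_pow (by omega), Ideal.zero_eq_bot,
      Submodule.bot_smul, hsum]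
    simp
  | succ r ih =>
    obtain ⟨t, ht⟩ := exists_pow_smul_le_of_primary h
    obtain ⟨S, _, _, _, _, _, _, hm, ξ, hspan, c, hc⟩ := exists_superficial_extension M x ht
    have hQ := (primary_tensor_iff (M := M) hm).2 h
    have hQm : (Ideal.span (Set.range x)).map (algebraMap R S) ≤ maximalIdeal S := by
      rw [← hm]
      refine Ideal.map_mono ?_
      rw [Ideal.span_le]
      rintro _ ⟨i, rfl⟩
      exact hx i
    have hξ : ξ ∈ (Ideal.span (Set.range x)).map (algebraMap R S) := by
      rw [hspan]
      exact Ideal.subset_span ⟨0, rfl⟩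
    obtain ⟨n₀, hn₀⟩ := hilb_sub_of_superficial hQm hξ hc hQ
    have hQ' := hQ
    rw [hspan, primary_cons_iff] at hQ'
    obtain ⟨s, hs⟩ := ih (fun i => algebraMap R S (x i.succ)) (fun i => by
      rw [← hm]; exact Ideal.mem_map_of_mem _ (hx _)) hQ'
    rw [← hilb_cons, ← hspan] at hs
    rw [← hilb_tensor hm]
    exact hs.exists_succ _ hn₀

end

end Vasconcelos

namespace Vasconcelos

open IsLocalRing Module TensorProduct RingTheory.Sequence
open scoped Pointwise

universe u v w

section
variable {R : Type u} [CommRing R] [IsLocalRing R]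

/-- `M` is a nonzero Cohen–Macaulay module of dimension `d`. -/
def CMd (R : Type u) [CommRing R] [IsLocalRing R] (M : Type v) [AddCommGroup M] [Module R M]
    (d : ℕ) : Prop :=
  supportDim R M ≤ d ∧ ∃ rs : List R, rs.length = d ∧ (∀ x ∈ rs, x ∈ maximalIdeal R) ∧
    IsRegular M rs

variable {M : Type v} [AddCommGroup M] [Module R M]

lemma CMd.congr {N : Type w} [AddCommGroup N] [Module R N] {d : ℕ} (e : M ≃ₗ[R] N)
    (h : CMd R M d) : CMd R N d := by
  obtain ⟨h1, rs, h2, h3, h4⟩ := h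
  exact ⟨(supportDim_eq_of_equiv e) ▸ h1, rs, h2, h3, (e.isRegular_congr rs).1 h4⟩

lemma CMd.nontrivial {d : ℕ} (h : CMd R M d) : Nontrivial M := by
  obtain ⟨h1, rs, h2, h3, h4⟩ := h
  exact h4.nontrivial

variable [IsNoetherianRing R] [Module.Finite R M]

lemma supportDim_quotSMulTop_le_of_regular {x : R} (hx : x ∈ maximalIdeal R)
    (hr : IsSMulRegular M x) {d : ℕ} (h : supportDim R M ≤ (d + 1 : ℕ)) :
    supportDim R (QuotSMulTop x M) ≤ d := by
  refine le_of_add_one_le_add_one ?_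
  rw [supportDim_quotSMulTop_succ_eq_supportDim hr hx]
  exact_mod_cast h

lemma CMd.of_quotSMulTop {x : R} (hx : x ∈ maximalIdeal R) (hr : IsSMulRegular M x) {d : ℕ}
    (h : CMd R (QuotSMulTop x M) d) : CMd R M (d + 1) := by
  obtain ⟨h1, rs, h2, h3, h4⟩ := h
  refine ⟨?_, x :: rs, by simp [h2], ?_, (isRegular_cons_iff M x rs).2 ⟨hr, h4⟩⟩
  · rw [← supportDim_quotSMulTop_succ_eq_supportDim hr hx]
    push_cast
    gcongr
  · rintro y (_ | ⟨_, hy⟩)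
    · exact hx
    · exact h3 y hy

lemma CMd.exists_regular {d : ℕ} (h : CMd R M (d + 1)) :
    ∃ x ∈ maximalIdeal R, IsSMulRegular M x ∧ CMd R (QuotSMulTop x M) d := by
  obtain ⟨h1, rs, h2, h3, h4⟩ := h
  cases rs with
  | nil => simp at h2
  | cons x rs =>
    rw [isRegular_cons_iff] at h4
    have hx := h3 x (by simp)
    exact ⟨x, hx, h4.1, supportDim_quotSMulTop_le_of_regular hx h4.1 h1, rs, by simpa using h2,
      fun y hy => h3 y (by simp [hy]), h4.2⟩

lemma CMd.supportDim_eq {d : ℕ} (h : CMd R M d) : supportDim R M = d := by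
  obtain ⟨h1, rs, h2, h3, h4⟩ := h
  refine h1.antisymm ?_
  rw [← supportDim_add_length_eq_supportDim_of_isRegular rs h4, h2]
  have := h4.nontrivial
  have : Nontrivial (M ⧸ Ideal.ofList rs • (⊤ : Submodule R M)) :=
    Submodule.Quotient.nontrivial_iff.2 h4.top_ne_smul.symm
  have h5 := supportDim_ne_bot_of_nontrivial R (M ⧸ Ideal.ofList rs • (⊤ : Submodule R M))
  obtain ⟨a, ha⟩ := WithBot.ne_bot_iff_exists.1 h5
  rw [← ha]
  exact_mod_cast le_add_self (a := (d : ℕ∞)) (b := a)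

lemma CMd.eq_bot_of_supportDim_lt {d : ℕ} (h : CMd R M d) (L : Submodule R M)
    (hL : supportDim R L + 1 ≤ d) : L = ⊥ := by
  induction d generalizing M with
  | zero =>
    rw [← Submodule.subsingleton_iff_eq_bot, ← supportDim_eq_bot_iff_subsingleton (R := R)]
    by_contra hb
    obtain ⟨a, ha⟩ := WithBot.ne_bot_iff_exists.1 hb
    rw [← ha] at hL
    have : a + 1 ≤ ((0 : ℕ) : ℕ∞) := by exact_mod_cast hL
    simp at this
  | succ d ih =>
    obtain ⟨x, hx, hr, hC⟩ := h.exists_regular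
    induction L using WellFoundedGT.induction with
    | ind L IH =>
    have hle : L ≤ L.comap (LinearMap.lsmul R M x) := fun y hy => L.smul_mem x hy
    by_cases hlt : L < L.comap (LinearMap.lsmul R M x)
    · rw [eq_bot_iff]
      refine hle.trans (IH _ hlt ?_).le
      refine le_trans ?_ hL
      gcongr
      refine supportDim_le_of_injective ((LinearMap.lsmul R M x).restrict (q := L) fun y hy => hy)
        fun a b hab => Subtype.ext (hr ?_)
      simpa using congrArg Subtype.val hab
    · have heq := hle.eq_of_not_lt hlt
      let f : QuotSMulTop x L →ₗ[R] QuotSMulTop x M := QuotSMulTop.map x L.subtype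
      have hf : LinearMap.range f = ⊥ := by
        refine ih hC _ ?_
        have h1 : supportDim R L ≤ d := le_of_add_one_le_add_one (by exact_mod_cast hL)
        refine le_trans ?_ h1
        rw [← supportDim_quotSMulTop_succ_eq_supportDim (M := L) (x := x) ?_ hx]
        · gcongr
          exact supportDim_le_of_surjective f.rangeRestrict f.surjective_rangeRestrict
        · exact fun a b hab => Subtype.ext (hr (by simpa using congrArg Subtype.val hab))
      refine Submodule.eq_bot_of_le_smul_of_le_jacobson_bot (maximalIdeal R) L
        (IsNoetherian.noetherian L) ?_ (maximalIdeal_le_jacobson _)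
      intro y hy
      have h1 : f (Submodule.Quotient.mk ⟨y, hy⟩) = 0 := by
        rw [LinearMap.range_eq_bot] at hf
        simp [hf]
      have h2 : y ∈ x • (⊤ : Submodule R M) := (Submodule.Quotient.mk_eq_zero _).1 h1
      obtain ⟨z, -, rfl⟩ := h2
      refine Submodule.smul_mem_smul hx ?_
      rw [heq]
      exact hy

lemma CMd.isSMulRegular {d : ℕ} (h : CMd R M (d + 1)) {x : R}
    (hd : supportDim R (QuotSMulTop x M) ≤ d) : IsSMulRegular M x := by
  have h1 : LinearMap.ker (LinearMap.lsmul R M x) = ⊥ := by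
    refine h.eq_bot_of_supportDim_lt _ ?_
    push_cast
    gcongr
    refine le_trans ?_ hd
    refine Order.krullDim_le_of_strictMono
      (fun p => ⟨p.1, (mem_support_quotSMulTop_iff x p.1).2 ⟨?_, ?_⟩⟩) fun a b hab => hab
    · exact support_subset_of_injective (LinearMap.ker (LinearMap.lsmul R M x)).subtype
        Subtype.val_injective p.2
    · refine annihilator_le_of_mem_support p.2 ?_
      rw [mem_annihilator]
      exact fun y => Subtype.ext y.2
  exact LinearMap.ker_eq_bot.1 h1

end

section
variable {R : Type u} [CommRing R] [IsLocalRing R] [IsNoetherianRing R]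
variable {M : Type u} [AddCommGroup M] [Module R M] [Module.Finite R M]

open CategoryTheory Abelian in
lemma CMd.quotSMulTop {d : ℕ} (h : CMd R M (d + 1)) {x : R} (hx : x ∈ maximalIdeal R)
    (hd : supportDim R (QuotSMulTop x M) ≤ d) : CMd R (QuotSMulTop x M) d := by
  have hr := h.isSMulRegular hd
  have hM := h.nontrivial
  have hlt : ∀ (N : Type u) [AddCommGroup N] [Module R N] [Module.Finite R N] [Nontrivial N],
      maximalIdeal R • (⊤ : Submodule R N) < ⊤ := fun N _ _ _ _ => by
    refine lt_top_iff_ne_top.2 fun he => top_ne_bot (α := Submodule R N) ?_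
    exact Submodule.eq_bot_of_le_smul_of_le_jacobson_bot (maximalIdeal R) ⊤
      (IsNoetherian.noetherian _) he.ge (maximalIdeal_le_jacobson _)
  have hN : Nontrivial (QuotSMulTop x M) := by
    refine Submodule.Quotient.nontrivial_iff.2 (ne_of_lt (lt_of_le_of_lt ?_ (hlt M)))
    rintro _ ⟨y, -, rfl⟩
    exact Submodule.smul_mem_smul hx trivial
  obtain ⟨-, rs, h2, h3, h4⟩ := h
  have hs : support R (R ⧸ maximalIdeal R) = PrimeSpectrum.zeroLocus (maximalIdeal R) := by
    rw [support_eq_zeroLocus, Ideal.annihilator_quotient]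
  have h_ext := ModuleCat.subsingleton_ext_of_exists_isRegular (maximalIdeal R)
    (ModuleCat.of R (R ⧸ maximalIdeal R)) hs.le (ModuleCat.of R M) (hlt M) rs h3 h4
  refine ⟨hd, ModuleCat.exists_isRegular_of_exists_subsingleton_ext (maximalIdeal R) d
    (ModuleCat.of R (QuotSMulTop x M)) (hlt _) (ModuleCat.of R (R ⧸ maximalIdeal R)) hs ?_⟩
  intro i hi
  have z : ∀ i < d + 1, Limits.IsZero (AddCommGrpCat.of
      (Ext (ModuleCat.of R (R ⧸ maximalIdeal R)) (ModuleCat.of R M) i)) := fun i hi =>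
    AddCommGrpCat.isZero_of_iff_subsingleton.mpr (h_ext i (by omega))
  exact AddCommGrpCat.subsingleton_of_isZero <| ShortComplex.Exact.isZero_of_both_zeros
    ((Ext.covariant_sequence_exact₃' (ModuleCat.of R (R ⧸ maximalIdeal R))
      (IsSMulRegular.smulShortComplex_shortExact (M := ModuleCat.of R M) hr)) i (i + 1) rfl)
    ((z i (by omega)).eq_zero_of_src _) ((z (i + 1) (by omega)).eq_zero_of_tgt _)

end

end Vasconcelos

namespace Vasconcelos

open IsLocalRing Module TensorProduct RingTheory.Sequence
open scoped Pointwise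

universe u v w

section
variable {R : Type u} [CommRing R] [IsNoetherianRing R]
variable {M : Type v} [AddCommGroup M] [Module R M] [Module.Finite R M]

lemma exists_isSMulRegular_mem {J : Ideal R} (h : ∀ y : M, (∀ a ∈ J, a • y = 0) → y = 0) :
    ∃ a ∈ J, IsSMulRegular M a := by
  obtain ⟨a, haJ, ha⟩ := exists_mem_forall_notMem (J := J) (s := associatedPrimes R M)
    (associatedPrimes.finite R M) (fun p hp => ((mem_associatedPrimes_iff).1 hp).1) (by
      intro p hp hle
      obtain ⟨hpp, y, hy⟩ := mem_associatedPrimes_iff.1 hp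
      refine hpp.ne_top ((Ideal.eq_top_iff_one p).2 ((hy 1).2 ?_))
      rw [h y fun a ha => (hy a).1 (hle ha), smul_zero])
  refine ⟨a, haJ, ?_⟩
  by_contra hcon
  have : a ∈ ⋃ p ∈ associatedPrimes R M, (p : Set R) := by
    rw [biUnion_associatedPrimes_eq_compl_regular]
    exact hcon
  simp only [Set.mem_iUnion] at this
  obtain ⟨p, hp, hap⟩ := this
  exact ha p hp hap

omit [IsNoetherianRing R] in
lemma supportDim_le_of_annihilator_pow_le {N : Type w} [AddCommGroup N] [Module R N] {n : ℕ}
    (h : annihilator R M ^ n ≤ annihilator R N) : supportDim R N ≤ supportDim R M := by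
  refine Order.krullDim_le_of_strictMono (fun p => ⟨p.1, ?_⟩) fun a b hab => hab
  rw [mem_support_iff_of_finite]
  exact p.1.2.le_of_pow_le (h.trans (annihilator_le_of_mem_support p.2))

end

section
variable {R : Type u} [CommRing R] [IsLocalRing R] [IsNoetherianRing R]
variable {M : Type v} [AddCommGroup M] [Module R M] [Module.Finite R M]

lemma CMd.exists_regular_mem_annihilator {N : Type w} [AddCommGroup N] [Module R N]
    [Module.Finite R N] {d : ℕ} (h : CMd R M d) (hN : supportDim R N + 1 ≤ d) :
    ∃ a ∈ annihilator R N, IsSMulRegular M a := by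
  refine exists_isSMulRegular_mem fun y hy => ?_
  rw [← Submodule.span_singleton_eq_bot (R := R)]
  refine h.eq_bot_of_supportDim_lt _ (le_trans ?_ hN)
  gcongr
  refine supportDim_le_of_annihilator_pow_le (n := 1) fun a ha => ?_
  rw [pow_one] at ha
  rw [mem_annihilator]
  rintro ⟨z, hz⟩
  obtain ⟨b, rfl⟩ := Submodule.mem_span_singleton.1 hz
  ext
  simp [smul_comm a b, hy a ha]

end

section
variable {R : Type u} [CommRing R] [IsLocalRing R] [IsNoetherianRing R]
variable {M : Type u} [AddCommGroup M] [Module R M] [Module.Finite R M]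

lemma CMd.exists_regular_pair {N : Type w} [AddCommGroup N] [Module R N]
    [Module.Finite R N] [Nontrivial N] {d : ℕ} (h : CMd R M d) (hN : supportDim R N + 2 ≤ d) (k : ℕ) :
    ∃ a ∈ annihilator R N ^ (k + 1), ∃ b ∈ annihilator R N ^ (k + 1), IsSMulRegular M a ∧
      IsSMulRegular (QuotSMulTop a M) b := by
  obtain ⟨n, hn⟩ := WithBot.ne_bot_iff_exists.1 (supportDim_ne_bot_of_nontrivial R N)
  obtain ⟨d, rfl⟩ : ∃ e, d = e + 1 := by
    refine Nat.exists_eq_succ_of_ne_zero ?_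
    rintro rfl
    rw [← hn] at hN
    have : n + 2 ≤ 0 := WithBot.coe_le_coe.1 hN
    simp at this
  have hN1 : supportDim R N + 1 ≤ d := le_of_add_one_le_add_one (by
    rw [add_assoc, one_add_one_eq_two]
    exact_mod_cast hN)
  obtain ⟨a, ha, har⟩ := h.exists_regular_mem_annihilator (N := N) (le_trans (by gcongr; simp) hN)
  have ham : a ^ (k + 1) ∈ maximalIdeal R := by
    refine Ideal.pow_mem_of_mem _ (le_maximalIdeal (fun htop => ?_) ha) _ k.succ_pos
    rw [annihilator_eq_top_iff] at htop
    exact not_subsingleton N htop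
  have hC := h.quotSMulTop ham (supportDim_quotSMulTop_le_of_regular ham (har.pow _) h.1)
  obtain ⟨b, hb, hbr⟩ := hC.exists_regular_mem_annihilator hN1
  exact ⟨a ^ (k + 1), Ideal.pow_mem_pow ha _, b ^ (k + 1), Ideal.pow_mem_pow hb _, har.pow _,
    hbr.pow _⟩

end

section
variable {R : Type u} [CommRing R] [IsLocalRing R] [IsNoetherianRing R]
variable {M : Type u} [AddCommGroup M] [Module R M] [Module.Finite R M]
variable {S : Type u} [CommRing S] [IsLocalRing S] [IsNoetherianRing S] [Algebra R S]
variable [Module.Flat R S] (hm : (maximalIdeal R).map (algebraMap R S) = maximalIdeal S)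
include hm

omit [IsNoetherianRing R] [Module.Finite R M] [IsNoetherianRing S] in
lemma isSMulRegular_tensor_iff {x : R} :
    IsSMulRegular (S ⊗[R] M) (algebraMap R S x) ↔ IsSMulRegular M x := by
  have := faithfullyFlat_of_map_maximalIdeal hm
  have h1 : ∀ z : S ⊗[R] M, algebraMap R S x • z = (LinearMap.lsmul R M x).lTensor S z := by
    intro z
    induction z with
    | zero => simp
    | tmul s y => simp [algebraMap_smul, TensorProduct.smul_tmul']
    | add a b ha hb => rw [smul_add, ha, hb, map_add]
  have h2 : IsSMulRegular (S ⊗[R] M) (algebraMap R S x) ↔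
      Function.Injective ((LinearMap.lsmul R M x).lTensor S) := by
    unfold IsSMulRegular
    rw [show (fun z : S ⊗[R] M => algebraMap R S x • z) = (LinearMap.lsmul R M x).lTensor S from
      funext h1]
  rw [h2, Module.FaithfullyFlat.lTensor_injective_iff_injective]
  rfl

lemma cmd_tensor_iff {d : ℕ} : CMd S (S ⊗[R] M) d ↔ CMd R M d := by
  induction d generalizing M with
  | zero =>
    have hz : ∀ {A : Type u} [CommRing A] [IsLocalRing A] {N : Type u} [AddCommGroup N]
        [Module A N], CMd A N 0 ↔ supportDim A N ≤ (0 : ℕ) ∧ ¬ Subsingleton N := by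
      intro A _ _ N _ _
      rw [not_subsingleton_iff_nontrivial]
      exact ⟨fun h => ⟨h.1, h.nontrivial⟩, fun h => ⟨h.1, [], rfl, by simp,
        have := h.2; IsRegular.nil A N⟩⟩
    rw [hz, hz, supportDim_tensor_le_iff hm, subsingleton_tensor_iff hm]
  | succ d ih =>
    constructor
    · intro h
      obtain ⟨y, hy, h1⟩ := exists_supportDim_tensor_quot_le hm h.1
      have hr := h.isSMulRegular h1
      have hy' : algebraMap R S y ∈ maximalIdeal S := hm ▸ Ideal.mem_map_of_mem _ hy
      have h2 := (h.quotSMulTop hy' h1).congr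
        (QuotSMulTop.algebraMapTensorEquivTensorQuotSMulTop y M S)
      exact CMd.of_quotSMulTop hy ((isSMulRegular_tensor_iff hm).1 hr) (ih.1 h2)
    · intro h
      obtain ⟨y, hy, hr, h1⟩ := h.exists_regular
      have hy' : algebraMap R S y ∈ maximalIdeal S := hm ▸ Ideal.mem_map_of_mem _ hy
      exact CMd.of_quotSMulTop hy' ((isSMulRegular_tensor_iff hm).2 hr)
        ((ih.2 h1).congr (QuotSMulTop.algebraMapTensorEquivTensorQuotSMulTop y M S).symm)

end

end Vasconcelos

namespace Vasconcelos

open IsLocalRing Module TensorProduct RingTheory.Sequence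
open scoped Pointwise

universe u v w

section
variable {R : Type u} [CommRing R] {M : Type v} [AddCommGroup M] [Module R M] {x : R}

lemma mem_span_singleton_pow_smul_top {n : ℕ} {y : M} :
    y ∈ Ideal.span {x} ^ n • (⊤ : Submodule R M) ↔ ∃ z, x ^ n • z = y := by
  rw [Ideal.span_singleton_pow, Submodule.ideal_span_singleton_smul]
  exact ⟨fun ⟨z, _, h⟩ => ⟨z, h⟩, fun ⟨z, h⟩ => ⟨z, trivial, h⟩⟩

/-- The kernel of multiplication by `x` from `M/xⁿM` to `M/xⁿ⁺¹M`. -/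
noncomputable abbrev kerMul (x : R) (M : Type v) [AddCommGroup M] [Module R M] (n : ℕ) :
    Submodule R (M ⧸ Ideal.span {x} ^ n • (⊤ : Submodule R M)) :=
  LinearMap.ker (mulQuot (M := M) (Ideal.mem_span_singleton_self x) n)

lemma mk_mem_kerMul_iff {n : ℕ} {y : M} :
    (Submodule.Quotient.mk y : M ⧸ Ideal.span {x} ^ n • (⊤ : Submodule R M)) ∈ kerMul x M n ↔
      ∃ z, x ^ (n + 1) • z = x • y := by
  rw [LinearMap.mem_ker]
  refine Iff.trans (Submodule.Quotient.mk_eq_zero _) ?_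
  exact mem_span_singleton_pow_smul_top

lemma length_kerMul_mono (n : ℕ) :
    Module.length R (kerMul x M n) ≤ Module.length R (kerMul x M (n + 1)) := by
  have hle : Ideal.span {x} ^ (n + 1) • (⊤ : Submodule R M) ≤
      Ideal.span {x} ^ n • (⊤ : Submodule R M) :=
    Submodule.smul_mono_left (Ideal.pow_le_pow_right n.le_succ)
  have hf : ∀ y ∈ kerMul x M (n + 1), Submodule.factor hle y ∈ kerMul x M n := by
    intro y hy
    obtain ⟨y, rfl⟩ := Submodule.Quotient.mk_surjective _ y
    obtain ⟨z, hz⟩ := mk_mem_kerMul_iff.1 hy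
    exact mk_mem_kerMul_iff.2 ⟨x • z, by
      rw [LinearMap.id_apply, ← hz, smul_smul, ← pow_succ]⟩
  refine Module.length_le_of_surjective ((Submodule.factor hle).restrict hf) ?_
  rintro ⟨y, hy⟩
  obtain ⟨y, rfl⟩ := Submodule.Quotient.mk_surjective _ y
  obtain ⟨z, hz⟩ := mk_mem_kerMul_iff.1 hy
  refine ⟨⟨Submodule.Quotient.mk (y - x ^ n • z), mk_mem_kerMul_iff.2 ⟨0, ?_⟩⟩, ?_⟩
  · rw [smul_sub, smul_smul, ← pow_succ', hz, sub_self, smul_zero]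
  · refine Subtype.ext ((Submodule.Quotient.eq _).2 ?_)
    rw [LinearMap.id_apply, sub_sub_cancel_left]
    exact neg_mem (mem_span_singleton_pow_smul_top.2 ⟨z, rfl⟩)

variable [IsLocalRing R] [IsNoetherianRing R] [Module.Finite R M]

lemma hilb_span_singleton (h : Primary (Ideal.span {x}) M) :
    ∃ (c : ℤ) (k : ℕ → ℕ), (∀ n, (k n : ℕ∞) = Module.length R (kerMul x M n)) ∧
      hilb (Ideal.span {x}) M 0 = c ∧ ∀ n, hilb (Ideal.span {x}) M (n + 1) + k (n + 1) =
        hilb (Ideal.span {x}) M n + c := by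
  have hk : ∀ n, Module.length R (kerMul x M n) ≠ ⊤ := fun n =>
    ne_top_of_le_ne_top (h.length_ne_top n)
      (Module.length_le_of_injective (kerMul x M n).subtype Subtype.val_injective)
  have hq : ∀ n, Module.length R (QuotSMulTop x M ⧸
      Ideal.span {x} ^ (n + 1) • (⊤ : Submodule R (QuotSMulTop x M))) =
      Module.length R (M ⧸ Ideal.span {x} ^ (0 + 1) • (⊤ : Submodule R M)) := by
    intro n
    have h0 : Ideal.span {x} ^ (n + 1) • (⊤ : Submodule R (QuotSMulTop x M)) = ⊥ := by
      rw [eq_bot_iff]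
      intro y hy
      obtain ⟨z, rfl⟩ := mem_span_singleton_pow_smul_top.1 hy
      rw [pow_succ, mul_smul, QuotSMulTop.smul_eq_zero', smul_zero]
      exact zero_mem _
    rw [(Submodule.quotEquivOfEqBot _ h0).length_eq, zero_add, pow_one,
      Submodule.ideal_span_singleton_smul]
  refine ⟨hilb (Ideal.span {x}) M 0, fun n => (Module.length R (kerMul x M n)).toNat,
    fun n => ENat.natCast_toNat (hk n), rfl, fun n => ?_⟩
  have h1 := length_mulQuot (M := M) (Ideal.mem_span_singleton_self x) (n + 1)
  rw [hq, h.coe_hilb, h.coe_hilb, h.coe_hilb, ← ENat.natCast_toNat (hk (n + 1))] at h1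
  have h2 : (hilb (Ideal.span {x}) M (n + 1)).toNat + (Module.length R (kerMul x M (n + 1))).toNat =
      (hilb (Ideal.span {x}) M n).toNat + (hilb (Ideal.span {x}) M 0).toNat := by
    exact_mod_cast h1
  have := hilb_nonneg (M := M) (Ideal.span {x}) (n + 1)
  have := hilb_nonneg (M := M) (Ideal.span {x}) n
  have := hilb_nonneg (M := M) (Ideal.span {x}) 0
  beta_reduce
  omega

lemma isSMulRegular_iff_coeff_one_eq_zero (hx : x ∈ maximalIdeal R)
    (h : Primary (Ideal.span {x}) M) {s : ℕ → ℤ} (hs : HP (hilb (Ideal.span {x}) M) 1 s) :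
    s 1 = 0 ↔ IsSMulRegular M x := by
  obtain ⟨c, k, hk, h0, h1⟩ := hilb_span_singleton h
  obtain ⟨N, hN⟩ := hs
  have hN : ∀ n ≥ N, hilb (Ideal.span {x}) M n = s 0 * (n + 1) - s 1 := by
    intro n hn
    rw [hN n hn, hsum, Finset.sum_range_succ, Finset.sum_range_one]
    simp
    ring
  have hmono : Monotone k := monotone_nat_of_le_succ fun n => by
    have := length_kerMul_mono (x := x) (M := M) n
    rw [← hk, ← hk] at this
    exact_mod_cast this
  constructor
  · intro hs1
    have hc : ∀ n ≥ N, (k (n + 1) : ℤ) = c - s 0 := by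
      intro n hn
      have := h1 n
      rw [hN _ hn, hN _ (by omega)] at this
      push_cast at this
      linarith
    have hle : ∀ n, (k n : ℤ) ≤ c - s 0 := by
      intro n
      rw [← hc (n + N) (by omega)]
      exact_mod_cast hmono (by omega)
    have hge : ∀ n : ℕ, hilb (Ideal.span {x}) M n ≥ c + n * s 0 := by
      intro n
      induction n with
      | zero => simp [h0]
      | succ n ih =>
        have := h1 n
        have := hle (n + 1)
        push_cast
        linarith
    have hz : ∀ n, k n = 0 := by
      intro n
      have h2 := hge N
      rw [hN N le_rfl, hs1] at h2
      have := hle n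
      have : (k n : ℤ) ≤ 0 := by linarith
      omega
    refine isSMulRegular_iff_right_eq_zero_of_smul.2 fun y hy => ?_
    refine eq_zero_of_forall_mem_pow (Q := Ideal.span {x}) (c := 0)
      ((Ideal.span_singleton_le_iff_mem _).2 hx) fun n _ => ?_
    have h2 := hk n
    rw [hz, Nat.cast_zero, eq_comm, Module.length_eq_zero_iff,
      Submodule.subsingleton_iff_eq_bot] at h2
    have h3 : (Submodule.Quotient.mk y : M ⧸ Ideal.span {x} ^ n • (⊤ : Submodule R M)) ∈
        kerMul x M n := mk_mem_kerMul_iff.2 ⟨0, by rw [hy, smul_zero]⟩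
    rw [h2, Submodule.mem_bot] at h3
    exact (Submodule.Quotient.mk_eq_zero _).1 h3
  · intro hr
    have hz : ∀ n, k n = 0 := by
      intro n
      have : kerMul x M n = ⊥ := by
        rw [eq_bot_iff]
        intro y hy
        obtain ⟨y, rfl⟩ := Submodule.Quotient.mk_surjective _ y
        obtain ⟨z, hz⟩ := mk_mem_kerMul_iff.1 hy
        rw [pow_succ', mul_smul] at hz
        exact (Submodule.Quotient.mk_eq_zero _).2 (mem_span_singleton_pow_smul_top.2 ⟨z, hr hz⟩)
      have h2 := hk n
      rw [this, Module.length_bot] at h2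
      exact_mod_cast h2
    have hl : ∀ n : ℕ, hilb (Ideal.span {x}) M n = c * (n + 1) := by
      intro n
      induction n with
      | zero => simp [h0]
      | succ n ih =>
        have := h1 n
        rw [hz, ih] at this
        push_cast at this ⊢
        linarith
    have h2 := hN N le_rfl
    have h3 := hN (N + 1) (by omega)
    rw [hl] at h2 h3
    push_cast at h3
    have : c = s 0 := by linarith
    subst this
    linarith

end

end Vasconcelos

namespace Vasconcelos

open IsLocalRing Module TensorProduct RingTheory.Sequence
open scoped Pointwise

universe u v w

section
variable {R : Type u} [CommRing R] [IsLocalRing R] [IsNoetherianRing R]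
variable {M : Type u} [AddCommGroup M] [Module R M] [Module.Finite R M]

/-- After a finite free local extension, a superficial element lowers the number of parameters. -/
lemma exists_superficial_step {r : ℕ} (x : Fin (r + 1) → R) (hx : ∀ i, x i ∈ maximalIdeal R)
    (h : Primary (Ideal.span (Set.range x)) M) :
    ∃ (S : Type u) (_ : CommRing S) (_ : IsLocalRing S) (_ : IsNoetherianRing S)
      (_ : Algebra R S) (_ : Module.Finite R S) (_ : Module.Free R S),
      (maximalIdeal R).map (algebraMap R S) = maximalIdeal S ∧
      ∃ ξ ∈ maximalIdeal S, ∃ x' : Fin r → S, (∀ i, x' i ∈ maximalIdeal S) ∧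
        Primary (Ideal.span (Set.range x')) (QuotSMulTop ξ (S ⊗[R] M)) ∧
        IsFiniteLength S (LinearMap.ker (LinearMap.lsmul S (S ⊗[R] M) ξ)) ∧
        ∀ s, HP (hilb (Ideal.span (Set.range x)) M) (r + 1) s → IsSMulRegular (S ⊗[R] M) ξ →
          HP (hilb (Ideal.span (Set.range x')) (QuotSMulTop ξ (S ⊗[R] M))) r s := by
  obtain ⟨t, ht⟩ := exists_pow_smul_le_of_primary h
  obtain ⟨S, i1, i2, i3, i4, i5, i6, hm, ξ, hspan, c, hc⟩ := exists_superficial_extension M x ht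
  have hQ := (primary_tensor_iff (M := M) hm).2 h
  have hQm : (Ideal.span (Set.range x)).map (algebraMap R S) ≤ maximalIdeal S := by
    rw [← hm]
    refine Ideal.map_mono ?_
    rw [Ideal.span_le]
    rintro _ ⟨i, rfl⟩
    exact hx i
  have hξ : ξ ∈ (Ideal.span (Set.range x)).map (algebraMap R S) := by
    rw [hspan]
    exact Ideal.subset_span ⟨0, rfl⟩
  refine ⟨S, i1, i2, i3, i4, i5, i6, hm, ξ, hQm hξ, fun i => algebraMap R S (x i.succ),
    fun i => by rw [← hm]; exact Ideal.mem_map_of_mem _ (hx _), ?_,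
    isFiniteLength_ker_superficial hQm hc hQ, ?_⟩
  · rwa [hspan, primary_cons_iff] at hQ
  · intro s hs hr
    obtain ⟨n₀, hn₀⟩ := hilb_sub_of_superficial hQm hξ hc hQ
    rw [← hilb_tensor hm] at hs
    rw [← hilb_cons, ← hspan]
    refine hs.sub_of_succ (N := n₀) fun n hn => ?_
    have hk : LinearMap.ker (LinearMap.lsmul S (S ⊗[R] M) ξ) = ⊥ := LinearMap.ker_eq_bot.2 hr
    rw [hn₀ n hn, hk, Module.length_bot]
    simp

end

section
variable {R : Type u} [CommRing R] [IsLocalRing R] [IsNoetherianRing R]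
variable {M : Type u} [AddCommGroup M] [Module R M] [Module.Finite R M]

omit [IsLocalRing R] [IsNoetherianRing R] [Module.Finite R M] in
lemma span_range_fin_one (x : Fin 1 → R) : Ideal.span (Set.range x) = Ideal.span {x 0} := by
  rw [Set.range_unique]
  rfl

omit [IsNoetherianRing R] in
lemma supportDim_quotSMulTop_le_zero_of_primary {x : R} (h : Primary (Ideal.span {x}) M) :
    supportDim R (QuotSMulTop x M) ≤ 0 := by
  refine supportDim_le_zero_of_maximalIdeal_le fun p hp => ?_
  rw [mem_support_quotSMulTop_iff] at hp
  exact h p hp.1 ((Ideal.span_singleton_le_iff_mem _).2 hp.2)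

/-- The first Hilbert coefficient of a parameter ideal vanishes on a Cohen–Macaulay module. -/
theorem CMd.coeff_one_eq_zero {d : ℕ} (hM : CMd R M (d + 1)) (x : Fin (d + 1) → R)
    (hx : ∀ i, x i ∈ maximalIdeal R) (h : Primary (Ideal.span (Set.range x)) M) {s : ℕ → ℤ}
    (hs : HP (hilb (Ideal.span (Set.range x)) M) (d + 1) s) : s 1 = 0 := by
  induction d generalizing R M with
  | zero =>
    rw [span_range_fin_one] at hs h
    exact (isSMulRegular_iff_coeff_one_eq_zero (hx 0) h hs).2
      (hM.isSMulRegular (by simpa using supportDim_quotSMulTop_le_zero_of_primary h))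
  | succ d ih =>
    obtain ⟨S, _, _, _, _, _, _, hm, ξ, hξ, x', hx', h', hk, H⟩ := exists_superficial_step x hx h
    have hC := (cmd_tensor_iff hm).2 hM
    have hr : IsSMulRegular (S ⊗[R] M) ξ := by
      suffices LinearMap.ker (LinearMap.lsmul S (S ⊗[R] M) ξ) = ⊥ from LinearMap.ker_eq_bot.1 this
      refine hC.eq_bot_of_supportDim_lt _ ?_
      refine le_trans (b := 0 + 1) ?_ (by norm_cast; omega)
      gcongr
      exact supportDim_le_zero_iff.2 hk
    exact ih (hC.quotSMulTop hξ (supportDim_quotSMulTop_le_of_regular hξ hr hC.1)) x' hx' h'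
      (H s hs hr)

end

end Vasconcelos

namespace Vasconcelos

open IsLocalRing Module TensorProduct RingTheory.Sequence
open scoped Pointwise

universe u v w

section
variable {R : Type u} [CommRing R] {M : Type v} [AddCommGroup M] [Module R M]

/-- A successive approximation step: modulo `P` multiplication by `a`, `b` is a regular sequence,
so `z` may be corrected by a multiple of `xⁿ`. -/
lemma exists_correction {x : R} (hx : IsSMulRegular M x) {J : Ideal R} {P : Submodule R M}
    (hP : ∀ γ ∈ J, ∀ p ∈ P, ∃ v, x • v = γ • p) {n k : ℕ} {a b : R} (haJ : a ∈ J ^ n)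
    (hbJ : b ∈ J ^ n) (ha : ∀ v, a • v ∈ P → v ∈ P)
    (hb : ∀ v u, b • v - a • u ∈ P → ∃ w, v - a • w ∈ P) {z : M}
    (hz : ∀ β ∈ J ^ n, ∃ v, x ^ k • v = β • z) :
    ∃ w, ∀ β ∈ J ^ (n + 1), ∃ v, x ^ (k + 1) • v = β • (z - x ^ k • w) := by
  obtain ⟨va, hva⟩ := hz a haJ
  obtain ⟨vb, hvb⟩ := hz b hbJ
  have h1 : b • va - a • vb = 0 := by
    refine (hx.pow k) ?_
    change x ^ k • _ = x ^ k • _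
    rw [smul_sub, smul_comm, hva, smul_comm (x ^ k) a, hvb, smul_zero, smul_comm, sub_self]
  obtain ⟨w, hw⟩ := hb va vb (by rw [h1]; exact P.zero_mem)
  refine ⟨w, fun β hβ => ?_⟩
  rw [pow_succ'] at hβ
  induction hβ using Submodule.mul_induction_on' with
  | mem_mul_mem γ hγ β hβ =>
    obtain ⟨v, hv⟩ := hz β hβ
    have h2 : v - β • w ∈ P := by
      refine ha _ ?_
      have h3 : a • v = β • va := by
        refine (hx.pow k) ?_
        change x ^ k • _ = x ^ k • _
        rw [smul_comm, hv, smul_comm (x ^ k) β, hva, smul_comm]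
      rw [smul_sub, h3, smul_comm a β, ← smul_sub]
      exact P.smul_mem β hw
    obtain ⟨v', hv'⟩ := hP γ hγ _ h2
    refine ⟨v', ?_⟩
    rw [pow_succ, mul_smul, hv', smul_comm, smul_sub, hv, mul_smul, smul_sub β, smul_comm β]
  | add β _ β' _ h h' =>
    obtain ⟨v, hv⟩ := h
    obtain ⟨v', hv'⟩ := h'
    exact ⟨v + v', by rw [smul_add, hv, hv', add_smul]⟩

end

section
variable {R : Type u} [CommRing R] [IsLocalRing R] [IsNoetherianRing R]
variable {M : Type u} [AddCommGroup M] [Module R M] [Module.Finite R M]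

lemma mem_of_forall_exists_add {P : Submodule R M} {y : M}
    (h : ∀ n, ∃ p ∈ P, y - p ∈ maximalIdeal R ^ n • (⊤ : Submodule R M)) : y ∈ P := by
  rw [← Submodule.Quotient.mk_eq_zero]
  refine eq_zero_of_forall_mem_pow (le_refl (maximalIdeal R)) (c := 0) fun n _ => ?_
  obtain ⟨p, hp, hn⟩ := h n
  have h1 := pow_smul_top_le_comap (maximalIdeal R) P.mkQ n hn
  rw [Submodule.mem_comap, map_sub, P.mkQ_apply p, (Submodule.Quotient.mk_eq_zero P).2 hp,
    sub_zero] at h1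
  exact h1

lemma supportDim_span_le {x : R} (hx : x ∈ maximalIdeal R) {N : Type w} [AddCommGroup N]
    [Module R N] [Module.Finite R N] {z : M}
    (hz : ∀ n, ∀ β ∈ annihilator R N ^ n, ∃ v, x ^ n • v = β • z) :
    supportDim R (Submodule.span R {z}) ≤ supportDim R N + 1 := by
  set K := Submodule.span R {z} with hK
  refine (supportDim_le_supportDim_quotSMulTop_succ hx).trans ?_
  gcongr
  obtain ⟨k, hk⟩ := (Ideal.span {x}).exists_pow_inf_eq_pow_smul K
  refine supportDim_le_of_annihilator_pow_le (n := k + 1) fun β hβ => ?_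
  rw [mem_annihilator]
  intro y
  obtain ⟨⟨y, hy⟩, rfl⟩ := Submodule.Quotient.mk_surjective _ y
  obtain ⟨c, rfl⟩ := Submodule.mem_span_singleton.1 hy
  obtain ⟨v, hv⟩ := hz (k + 1) β hβ
  have h1 : β • c • z ∈ Ideal.span {x} ^ (k + 1) • (⊤ : Submodule R M) ⊓ K := by
    refine ⟨mem_span_singleton_pow_smul_top.2 ⟨c • v, ?_⟩, K.smul_mem _ hy⟩
    rw [smul_comm, hv, smul_comm]
  rw [hk _ k.le_succ, Nat.succ_eq_add_one, Nat.add_sub_cancel_left, pow_one,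
    Submodule.ideal_span_singleton_smul] at h1
  obtain ⟨u, hu, hxu⟩ := h1
  refine (Submodule.Quotient.mk_eq_zero _).2 ⟨⟨u, hu.2⟩, trivial, Subtype.ext hxu⟩

/-- If `M` is complete and has no nonzero submodules of dimension at most `d`, then
a submodule of `M/xM` of dimension less than `d` with Cohen–Macaulay quotient of dimension
`d + 1` vanishes. -/
theorem eq_bot_of_cmd_quotient [IsPrecomplete (maximalIdeal R) M] {x : R}
    (hx : x ∈ maximalIdeal R) (hr : IsSMulRegular M x) {d : ℕ}
    (hM : ∀ K : Submodule R M, supportDim R K ≤ d → K = ⊥) (L : Submodule R (QuotSMulTop x M))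
    (hL : supportDim R L + 1 ≤ d) (hC : CMd R (QuotSMulTop x M ⧸ L) (d + 1)) : L = ⊥ := by
  by_contra hne
  have : Nontrivial L := Submodule.nontrivial_iff_ne_bot.2 hne
  refine hne (eq_bot_iff.2 fun l hl => ?_)
  obtain ⟨z, rfl⟩ := Submodule.Quotient.mk_surjective _ l
  have hx0 : ∀ {y : M}, (Submodule.Quotient.mk y : QuotSMulTop x M) = 0 ↔ ∃ v, x • v = y := by
    intro y
    refine (Submodule.Quotient.mk_eq_zero _).trans ?_
    exact ⟨fun ⟨v, _, h⟩ => ⟨v, h⟩, fun ⟨v, h⟩ => ⟨v, trivial, h⟩⟩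
  set P : Submodule R M := L.comap (Submodule.mkQ _) with hPdef
  have hC0 : ∀ {y : M}, (Submodule.Quotient.mk (Submodule.Quotient.mk y) :
      QuotSMulTop x M ⧸ L) = 0 ↔ y ∈ P := Submodule.Quotient.mk_eq_zero _
  have hP : ∀ γ ∈ annihilator R L, ∀ p ∈ P, ∃ v, x • v = γ • p := by
    intro γ hγ p hp
    refine hx0.1 ?_
    have := mem_annihilator.1 hγ ⟨_, hp⟩
    exact congrArg Subtype.val this
  let T : ℕ → Type u := fun n =>
    {z : M // ∀ β ∈ annihilator R L ^ (n + 1), ∃ v, x ^ (n + 1) • v = β • z}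
  have step : ∀ n (z : T n), ∃ z' : T (n + 1), ∃ w, z'.1 = z.1 - x ^ (n + 1) • w := by
    rintro n ⟨z, hz⟩
    obtain ⟨a, ha, b, hb, har, hbr⟩ := hC.exists_regular_pair (N := L) (by
      rw [← one_add_one_eq_two, ← add_assoc]
      push_cast
      gcongr) n
    obtain ⟨w, hw⟩ := exists_correction hr hP ha hb
      (fun v hv => by
        rw [← hC0] at hv ⊢
        exact isSMulRegular_iff_right_eq_zero_of_smul.1 har _ hv)
      (fun v u hu => by
        rw [← hC0] at hu
        have h1 : b • (Submodule.Quotient.mk (Submodule.Quotient.mk (Submodule.Quotient.mk v)) :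
            QuotSMulTop a (QuotSMulTop x M ⧸ L)) = 0 := by
          refine (Submodule.Quotient.mk_eq_zero _).2 ⟨Submodule.Quotient.mk
            (Submodule.Quotient.mk u), trivial, ?_⟩
          exact (sub_eq_zero.1 hu).symm
        have h2 := isSMulRegular_iff_right_eq_zero_of_smul.1 hbr _ h1
        obtain ⟨w, -, hw⟩ := (Submodule.Quotient.mk_eq_zero _).1 h2
        obtain ⟨w, rfl⟩ := Submodule.Quotient.mk_surjective _ w
        obtain ⟨w, rfl⟩ := Submodule.Quotient.mk_surjective _ w
        refine ⟨w, hC0.1 ?_⟩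
        exact sub_eq_zero.2 hw.symm) hz
    exact ⟨⟨_, hw⟩, w, rfl⟩
  choose next hnext using step
  have hz0 : ∀ β ∈ annihilator R L ^ (0 + 1), ∃ v, x ^ (0 + 1) • v = β • z := by
    intro β hβ
    rw [zero_add, pow_one] at hβ ⊢
    exact hP β hβ z hl
  let Z : ∀ n, T n := fun n => Nat.rec ⟨z, hz0⟩ next n
  have hZ : ∀ n, ∃ w, (Z (n + 1)).1 = (Z n).1 - x ^ (n + 1) • w := fun n => hnext n (Z n)
  have hZZ : ∀ n m, n ≤ m → ∃ w, (Z n).1 - (Z m).1 = x ^ (n + 1) • w := by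
    intro n m h
    induction m, h using Nat.le_induction with
    | base => exact ⟨0, by simp⟩
    | succ m hm ih =>
      obtain ⟨w, hw⟩ := ih
      obtain ⟨w', hw'⟩ := hZ m
      refine ⟨w + x ^ (m - n) • w', ?_⟩
      rw [hw', smul_add, ← hw, smul_smul, ← pow_add, show n + 1 + (m - n) = m + 1 by omega]
      abel
  have hmem : ∀ n (w : M), x ^ n • w ∈ maximalIdeal R ^ n • (⊤ : Submodule R M) := fun n w =>
    Submodule.smul_mem_smul (Ideal.pow_mem_pow hx n) trivial
  obtain ⟨y, hy⟩ := IsPrecomplete.prec (I := maximalIdeal R) (M := M) inferInstance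
    (f := fun n => (Z n).1) (by
      intro n m hnm
      obtain ⟨w, hw⟩ := hZZ n m hnm
      rw [SModEq.sub_mem, hw, pow_succ, mul_smul]
      exact hmem n _)
  have hyZ : ∀ n, ∃ w, x ^ (n + 1) • w = (Z n).1 - y := by
    intro n
    rw [← mem_span_singleton_pow_smul_top]
    refine mem_of_forall_exists_add fun m => ?_
    obtain ⟨w, hw⟩ := hZZ n (max n m) (le_max_left _ _)
    refine ⟨_, mem_span_singleton_pow_smul_top.2 ⟨w, rfl⟩, ?_⟩
    rw [← hw, sub_sub_sub_cancel_left]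
    have := SModEq.sub_mem.1 (hy (max n m))
    exact Submodule.smul_mono_left (Ideal.pow_le_pow_right (le_max_right _ _)) this
  have hy0 : y = 0 := by
    rw [← Submodule.span_singleton_eq_bot (R := R)]
    refine hM _ ((supportDim_span_le hx (N := L) fun n β hβ => ?_).trans hL)
    cases n with
    | zero => exact ⟨β • y, by simp⟩
    | succ n =>
      obtain ⟨v, hv⟩ := (Z n).2 β hβ
      obtain ⟨w, hw⟩ := hyZ n
      exact ⟨v - β • w, by rw [smul_sub, hv, smul_comm, hw, smul_sub, sub_sub_cancel]⟩
  obtain ⟨w, hw⟩ := hyZ 0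
  rw [hy0, sub_zero] at hw
  replace hw : x ^ (0 + 1) • w = z := hw
  rw [zero_add, pow_one] at hw
  exact hx0.2 ⟨w, hw⟩

end

end Vasconcelos

namespace Vasconcelos

open IsLocalRing Module TensorProduct RingTheory.Sequence
open scoped Pointwise

universe u v w

section
variable {R : Type u} [CommRing R]

lemma length_le_supportDim {M : Type v} [AddCommGroup M] [Module R M]
    (l : LTSeries (PrimeSpectrum R)) (h : l.head ∈ support R M) :
    (l.length : WithBot ℕ∞) ≤ supportDim R M :=
  Order.LTSeries.length_le_krullDim (α := support R M)
    { length := l.length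
      toFun := fun i => ⟨l i, mem_support_mono (l.monotone (Fin.zero_le i)) h⟩
      step := fun i => l.step i }

lemma supportDim_le_iff_forall_length_le {M : Type v} [AddCommGroup M] [Module R M]
    {d : WithBot ℕ∞} : supportDim R M ≤ d ↔
      ∀ l : LTSeries (PrimeSpectrum R), l.head ∈ support R M → (l.length : WithBot ℕ∞) ≤ d := by
  refine ⟨fun h l hl => (length_le_supportDim l hl).trans h, fun h => ?_⟩
  refine iSup_le fun l => ?_
  exact h (l.map Subtype.val fun _ _ h => h) l.head.2

lemma supportDim_le_of_exact {A B C : Type*} [AddCommGroup A] [Module R A] [AddCommGroup B]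
    [Module R B] [AddCommGroup C] [Module R C] {f : A →ₗ[R] B} {g : B →ₗ[R] C}
    (h : Function.Exact f g) (hf : Function.Injective f) (hg : Function.Surjective g)
    {d : WithBot ℕ∞} (hA : supportDim R A ≤ d) (hC : supportDim R C ≤ d) :
    supportDim R B ≤ d := by
  rw [supportDim_le_iff_forall_length_le] at *
  intro l hl
  rw [support_of_exact h hf hg] at hl
  exact hl.elim (hA l) (hC l)

lemma supportDim_le_of_quotient {M : Type v} [AddCommGroup M] [Module R M] (L : Submodule R M)
    {d : WithBot ℕ∞} (hL : supportDim R L ≤ d) (hQ : supportDim R (M ⧸ L) ≤ d) :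
    supportDim R M ≤ d :=
  supportDim_le_of_exact (LinearMap.exact_subtype_mkQ L) L.subtype_injective L.mkQ_surjective hL hQ

/-- There is a largest submodule of dimension at most `d`, and the quotient by it has no nonzero
submodule of dimension at most `d`. -/
lemma exists_largest_submodule [IsNoetherianRing R] (M : Type v) [AddCommGroup M] [Module R M]
    [Module.Finite R M] (d : ℕ) : ∃ L : Submodule R M, supportDim R L ≤ d ∧
      ∀ K : Submodule R (M ⧸ L), supportDim R K ≤ d → K = ⊥ := by
  obtain ⟨L, hL, hmax⟩ := set_has_maximal_iff_noetherian.2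
    (inferInstance : IsNoetherian R M) {L : Submodule R M | supportDim R L ≤ d}
    ⟨⊥, by simp [supportDim_eq_bot_of_subsingleton]⟩
  refine ⟨L, hL, fun K hK => ?_⟩
  have hle : L ≤ K.comap L.mkQ := by
    intro x hx
    rw [Submodule.mem_comap, Submodule.mkQ_apply, (Submodule.Quotient.mk_eq_zero _).2 hx]
    exact K.zero_mem
  have hdim : supportDim R (K.comap L.mkQ) ≤ d := by
    let g : K.comap L.mkQ →ₗ[R] K := L.mkQ.restrict fun x hx => hx
    refine supportDim_le_of_exact (f := Submodule.inclusion hle) (g := g) ?_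
      (Submodule.inclusion_injective hle) ?_ hL hK
    · rintro ⟨x, hx⟩
      have : g ⟨x, hx⟩ = 0 ↔ x ∈ L := by
        rw [← Submodule.Quotient.mk_eq_zero L, ← Submodule.mkQ_apply, ← Submodule.coe_eq_zero]
        rfl
      rw [this]
      exact ⟨fun h => ⟨⟨x, h⟩, rfl⟩, fun ⟨y, hy⟩ => by
        have := congrArg Subtype.val hy
        exact (show (y : M) = x from this) ▸ y.2⟩
    · rintro ⟨y, hy⟩
      obtain ⟨x, rfl⟩ := L.mkQ_surjective y
      exact ⟨⟨x, hy⟩, rfl⟩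
  have heq : L = K.comap L.mkQ := by
    by_contra hne
    exact hmax _ hdim (lt_of_le_of_ne hle hne)
  rw [eq_bot_iff]
  intro y hy
  obtain ⟨x, rfl⟩ := L.mkQ_surjective y
  have : x ∈ L := heq ▸ hy
  simpa using this

end

section
variable {R : Type u} [CommRing R] {S : Type v} [CommRing S] [Algebra R S]

/-- Restricting scalars along an integral map does not raise the dimension. -/
lemma supportDim_le_of_isIntegral [Algebra.IsIntegral R S] {K : Type w} [AddCommGroup K]
    [Module R K] [Module S K] [IsScalarTower R S K] [Module.Finite R K] :
    supportDim R K ≤ supportDim S K := by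
  have : Module.Finite S K := Module.Finite.of_restrictScalars_finite R S K
  rw [supportDim_le_iff_forall_length_le]
  intro l hl
  rw [mem_support_iff_of_finite] at hl
  obtain ⟨P, hP, hPp, hPl⟩ := Ideal.exists_ideal_over_prime_of_isIntegral l.head.asIdeal
    (annihilator S K) (by
      refine le_trans (fun a ha => ?_) hl
      rw [mem_annihilator]
      intro k
      rw [← algebraMap_smul S a k]
      exact mem_annihilator.1 ha k)
  have : P.LiesOver l.head.asIdeal := ⟨hPl.symm⟩
  obtain ⟨L, hL, hh, -⟩ := Ideal.exists_ltSeries_of_hasGoingUp (S := S) l P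
  rw [← hL]
  refine length_le_supportDim L ?_
  rw [hh, mem_support_iff_of_finite]
  exact hP

/-- A module without small submodules stays so after a finite free extension. -/
lemma eq_bot_of_supportDim_le_tensor [IsNoetherianRing R] [Module.Finite R S] [Module.Free R S]
    {M : Type w} [AddCommGroup M] [Module R M] [Module.Finite R M] {d : WithBot ℕ∞}
    (h : ∀ K : Submodule R M, supportDim R K ≤ d → K = ⊥) (K : Submodule S (S ⊗[R] M))
    (hK : supportDim S K ≤ d) : K = ⊥ := by
  let K' : Submodule R (S ⊗[R] M) := K.restrictScalars R
  have hK' : supportDim R K' ≤ d := by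
    have : Module.Finite R K := inferInstanceAs (Module.Finite R K')
    exact (supportDim_le_of_isIntegral (R := R) (S := S) (K := K)).trans hK
  classical
  let b := Module.Free.chooseBasis R S
  rw [eq_bot_iff]
  intro y hy
  let e : S ⊗[R] M ≃ₗ[R] (Module.Free.ChooseBasisIndex R S →₀ M) :=
    (TensorProduct.congr b.repr (LinearEquiv.refl R M)).trans
      (TensorProduct.finsuppScalarLeft R M _)
  have hy0 : e y = 0 := by
    ext i
    let f : S ⊗[R] M →ₗ[R] M := Finsupp.lapply i ∘ₗ e.toLinearMap
    have hf : K'.map f = ⊥ := by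
      refine h _ (le_trans ?_ hK')
      refine supportDim_le_of_surjective (f.submoduleMap K') (f.submoduleMap_surjective K')
    have : f y ∈ K'.map f := Submodule.mem_map_of_mem hy
    rw [hf] at this
    exact (Submodule.mem_bot R).1 this
  exact (Submodule.mem_bot S).2 (e.map_eq_zero_iff.1 hy0)

end

end Vasconcelos

namespace Vasconcelos

open IsLocalRing Module TensorProduct RingTheory.Sequence
open scoped Pointwise

universe u v w

section
variable {R : Type u} [CommRing R] [IsLocalRing R] [IsNoetherianRing R]

omit [IsLocalRing R] [IsNoetherianRing R] in
lemma le_of_lt_add_one {a : WithBot ℕ∞} {d : ℕ} (h : a < (d + 1 : ℕ)) : a ≤ d := by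
  induction a using WithBot.recBotCoe with
  | bot => exact bot_le
  | coe a =>
    have h : a < ((d + 1 : ℕ) : ℕ∞) := WithBot.coe_lt_coe.1 h
    refine WithBot.coe_le_coe.2 ?_
    rw [Nat.cast_add, Nat.cast_one] at h
    exact ENat.lt_add_one_iff (ENat.natCast_ne_top d) |>.1 h

omit [IsLocalRing R] [IsNoetherianRing R] in
lemma eq_of_add_one_eq {a : WithBot ℕ∞} {d : ℕ} (h : a + 1 = (d + 1 : ℕ)) : a = d := by
  refine le_antisymm (le_of_add_one_le_add_one (by exact_mod_cast h.le)) ?_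
  by_contra hlt
  rw [not_le] at hlt
  cases d with
  | zero =>
    have : a = ⊥ := by
      induction a using WithBot.recBotCoe with
      | bot => rfl
      | coe a => exact absurd (WithBot.coe_lt_coe.1 hlt) (by simp)
    rw [this] at h
    exact WithBot.coe_ne_bot h.symm
  | succ d =>
    have h2 : a + 1 ≤ (d + 1 : ℕ) := by
      have := le_of_lt_add_one hlt
      push_cast
      gcongr
    rw [h] at h2
    have : d + 1 + 1 ≤ d + 1 := by exact_mod_cast h2
    omega

/-- Every finite module over `R` is complete in the sense of convergence of Cauchy sequences. -/
def FinPrecomplete (R : Type u) [CommRing R] [IsLocalRing R] : Prop :=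
  ∀ (N : Type u) [AddCommGroup N] [Module R N] [Module.Finite R N],
    IsPrecomplete (maximalIdeal R) N

omit [IsNoetherianRing R] in
lemma FinPrecomplete.of_finite (h : FinPrecomplete R) {S : Type u} [CommRing S] [IsLocalRing S]
    [Algebra R S] [Module.Finite R S]
    (hm : (maximalIdeal R).map (algebraMap R S) = maximalIdeal S) : FinPrecomplete S := by
  intro N _ _ _
  let _ : Module R N := Module.compHom N (algebraMap R S)
  have : IsScalarTower R S N := IsScalarTower.of_algebraMap_smul fun _ _ => rfl
  have : Module.Finite R N := Module.Finite.trans S N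
  rw [← hm, IsPrecomplete.map_algebraMap_iff]
  exact h N

/-- The first coefficient does not see submodules of small dimension. -/
lemma coeff_one_quotient_eq {M : Type u} [AddCommGroup M] [Module R M] [Module.Finite R M]
    {d : ℕ} {x : Fin (d + 2) → R} (hx : ∀ i, x i ∈ maximalIdeal R)
    (h : Primary (Ideal.span (Set.range x)) M) (L : Submodule R M) (hL : supportDim R L ≤ d)
    {s s' : ℕ → ℤ} (hs : HP (hilb (Ideal.span (Set.range x)) M) (d + 2) s)
    (hs' : HP (hilb (Ideal.span (Set.range x)) (M ⧸ L)) (d + 2) s') : s 1 = s' 1 := by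
  obtain ⟨C, hC⟩ := exists_hilb_le (h.of_injective _ L.subtype_injective) (by
    rw [Ideal.span_le]
    rintro _ ⟨i, rfl⟩
    exact hx i) hL
  exact hs.eq_of_bound hs' (fun n => (hilb_quotient_bound h L n).trans (hC n)) (by omega)

/-- If the first coefficient of a parameter ideal vanishes over a complete ring, then the module
is Cohen–Macaulay up to a submodule of codimension at least two. -/
theorem exists_cmd_quotient_of_coeff_one_eq_zero {d : ℕ} (hR : FinPrecomplete R) {M : Type u}
    [AddCommGroup M] [Module R M] [Module.Finite R M] (hM : supportDim R M = (d + 1 : ℕ))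
    (x : Fin (d + 1) → R) (hx : ∀ i, x i ∈ maximalIdeal R)
    (h : Primary (Ideal.span (Set.range x)) M) {s : ℕ → ℤ}
    (hs : HP (hilb (Ideal.span (Set.range x)) M) (d + 1) s) (h1 : s 1 = 0) :
    ∃ L : Submodule R M, supportDim R L + 1 ≤ d ∧ CMd R (M ⧸ L) (d + 1) := by
  induction d generalizing R M s with
  | zero =>
    have : Nontrivial M := (supportDim_ne_bot_iff_nontrivial R M).1 (by
      rw [hM]
      exact WithBot.coe_ne_bot)
    rw [span_range_fin_one] at hs h
    have hr := (isSMulRegular_iff_coeff_one_eq_zero (hx 0) h hs).1 h1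
    refine ⟨⊥, by simp [supportDim_eq_bot_of_subsingleton], ?_⟩
    refine CMd.congr (Submodule.quotEquivOfEqBot ⊥ rfl).symm ?_
    refine CMd.of_quotSMulTop (hx 0) hr ⟨?_, [], rfl, by simp, ?_⟩
    · simpa using supportDim_quotSMulTop_le_zero_of_primary h
    · have : Nontrivial (QuotSMulTop (x 0) M) := by
        refine (supportDim_ne_bot_iff_nontrivial R _).1 ?_
        rw [eq_of_add_one_eq ((supportDim_quotSMulTop_succ_eq_supportDim hr (hx 0)).trans hM)]
        exact WithBot.coe_ne_bot
      exact IsRegular.nil _ _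
  | succ d ih =>
    obtain ⟨L, hL, hmax⟩ := exists_largest_submodule (R := R) M d
    refine ⟨L, ?_, ?_⟩
    · push_cast
      gcongr
    have h' : Primary (Ideal.span (Set.range x)) (M ⧸ L) := h.of_surjective _ L.mkQ_surjective
    obtain ⟨s', hs'⟩ := exists_HP x hx h'
    have h1' : s' 1 = 0 := (coeff_one_quotient_eq hx h L hL hs hs').symm.trans h1
    have hN : supportDim R (M ⧸ L) = (d + 1 + 1 : ℕ) := by
      refine le_antisymm ?_ ?_
      · exact (supportDim_le_of_surjective L.mkQ L.mkQ_surjective).trans hM.le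
      · by_contra hlt
        have h2 := supportDim_le_of_quotient L (hL.trans (by exact_mod_cast Nat.le_succ d))
          (le_of_lt_add_one (not_le.1 hlt))
        rw [hM] at h2
        have : d + 1 + 1 ≤ d + 1 := by exact_mod_cast h2
        omega
    obtain ⟨S, i1, i2, i3, i4, i5, i6, hm, ξ, hξ, x', hx', hP', hk, H⟩ :=
      exists_superficial_step x hx h'
    have hmax' := fun K => eq_bot_of_supportDim_le_tensor (S := S) (M := M ⧸ L) hmax K
    have hr : IsSMulRegular (S ⊗[R] (M ⧸ L)) ξ := by
      refine (LinearMap.ker_eq_bot (f := LinearMap.lsmul S (S ⊗[R] (M ⧸ L)) ξ)).1 (hmax' _ ?_)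
      exact (supportDim_le_zero_iff.2 hk).trans (by positivity)
    have hdim : supportDim S (QuotSMulTop ξ (S ⊗[R] (M ⧸ L))) = (d + 1 : ℕ) := by
      refine eq_of_add_one_eq (Eq.trans ?_ ((supportDim_tensor_eq (M := M ⧸ L) hm).trans hN))
      exact supportDim_quotSMulTop_succ_eq_supportDim (M := S ⊗[R] (M ⧸ L)) hr hξ
    have hS : FinPrecomplete S := hR.of_finite hm
    obtain ⟨L', hL', hC⟩ := ih hS hdim x' hx' hP' (H s' hs' hr) h1'
    have : IsPrecomplete (maximalIdeal S) (S ⊗[R] (M ⧸ L)) := hS _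
    have hbot := eq_bot_of_cmd_quotient hξ hr hmax' L' hL' hC
    rw [← cmd_tensor_iff hm]
    refine CMd.of_quotSMulTop hξ hr (hC.congr (Submodule.quotEquivOfEqBot L' hbot))

end

end Vasconcelos

namespace Vasconcelos

open IsLocalRing Module TensorProduct RingTheory.Sequence
open scoped Pointwise

universe u v w

section
variable {R : Type u} [CommRing R] [IsNoetherianRing R]

lemma isNoetherianRing_adicCompletion (I : Ideal R) : IsNoetherianRing (AdicCompletion I R) := by
  obtain ⟨n, x, hx⟩ := Submodule.fg_iff_exists_fin_generating_family.1
    ((isNoetherianRing_iff_ideal_fg R).1 inferInstance I)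
  let J := MvPolynomial.idealOfVars (Fin n) R
  let φ : MvPolynomial (Fin n) R →+* R := (MvPolynomial.aeval x).toRingHom
  have hφC : ∀ r, φ (MvPolynomial.C r) = r := fun r => by simp [φ]
  have hJ : J.map φ = I := by
    rw [← hx, Ideal.map_span, ← Set.range_comp]
    refine congrArg (fun y => Ideal.span (Set.range y)) ?_
    ext i
    simp [φ]
  have hJn : ∀ m, J ^ m ≤ (I ^ m).comap φ := fun m => by
    rw [← Ideal.map_le_iff_le_comap, Ideal.map_pow, hJ]
  let A := AdicCompletion J (MvPolynomial (Fin n) R)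
  have : IsNoetherianRing A :=
    isNoetherianRing_of_ringEquiv _ (MvPowerSeries.toAdicCompletionAlgEquiv (Fin n) R).toRingEquiv
  let f : ∀ m, A →+* R ⧸ I ^ m := fun m =>
    (Ideal.quotientMap (I ^ m) φ (hJn m)).comp (AdicCompletion.evalₐ J m : A →+* _)
  have hf : ∀ {k l : ℕ} (hle : k ≤ l),
      (Ideal.Quotient.factorPow I hle).comp (f l) = f k := by
    intro k l hle
    ext a
    obtain ⟨a, rfl⟩ := AdicCompletion.mk_surjective J _ a
    have key : ∀ m, f m (AdicCompletion.mk J _ a) = Ideal.Quotient.mk (I ^ m) (φ (a m)) := fun m =>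
      (congrArg _ (AdicCompletion.evalₐ_mk J m a)).trans
        (Ideal.quotientMap_mk (H := hJn m))
    rw [RingHom.comp_apply, key, key, Ideal.Quotient.factor_mk, Ideal.Quotient.eq, ← map_sub]
    refine hJn k (Ideal.Quotient.eq.1 ?_)
    exact (AdicCompletion.Ideal.mk_eq_mk J hle a)
  let F : A →+* AdicCompletion I R := AdicCompletion.liftRingHom I f hf
  have hF : ∀ p, F (algebraMap _ A p) = algebraMap R _ (φ p) := by
    intro p
    refine AdicCompletion.ext_evalₐ fun m => ?_
    rw [AlgHom.commutes]
    refine (AdicCompletion.evalₐ_liftRingHom I f hf m _).trans ?_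
    exact (congrArg _ (AlgHom.commutes (AdicCompletion.evalₐ J m) p)).trans
        (Ideal.quotientMap_mk (H := hJn m))
  have hFJ : (J.map (algebraMap _ A)).map F = I.map (algebraMap R (AdicCompletion I R)) := by
    have : F.comp (algebraMap _ A) = (algebraMap R _).comp φ := RingHom.ext hF
    rw [Ideal.map_map, this, ← Ideal.map_map, hJ]
  have hIfg := (isNoetherianRing_iff_ideal_fg R).1 inferInstance I
  have h1 := AdicCompletion.isAdicComplete_self J (MvPolynomial.idealOfVars_fg (Fin n) R)
  have h2 := AdicCompletion.isAdicComplete_self I hIfg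
  have h3 : IsHausdorff ((J.map (algebraMap _ A)).map F) (AdicCompletion I R) := by
    rw [hFJ]
    exact h2.toIsHausdorff
  refine isNoetherianRing_of_surjective A _ F
    (surjective_of_mk_map_comp_surjective (I := J.map (algebraMap _ A)) F ?_)
  intro y
  obtain ⟨y, rfl⟩ := Ideal.Quotient.mk_surjective y
  obtain ⟨r, hr⟩ := Ideal.Quotient.mk_surjective (AdicCompletion.evalOneₐ I y)
  refine ⟨algebraMap (MvPolynomial (Fin n) R) A (MvPolynomial.C r), ?_⟩
  rw [RingHom.comp_apply, hF, hφC, Ideal.Quotient.eq, hFJ, ← AdicCompletion.ker_evalOneₐ_eq_map I hIfg]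
  refine (RingHom.mem_ker).2 ?_
  rw [map_sub, sub_eq_zero]
  exact (AlgHom.commutes (AdicCompletion.evalOneₐ I) r).trans hr

omit [IsNoetherianRing R] in
lemma finPrecomplete_of_isAdicComplete [IsLocalRing R] [IsAdicComplete (maximalIdeal R) R] :
    FinPrecomplete R := by
  intro N _ _ _
  rw [← AdicCompletion.of_surjective_iff]
  intro y
  obtain ⟨t, rfl⟩ := AdicCompletion.ofTensorProduct_surjective_of_finite (maximalIdeal R) N y
  induction t with
  | zero => exact ⟨0, by simp⟩
  | add a b ha hb =>
    obtain ⟨a', ha⟩ := ha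
    obtain ⟨b', hb⟩ := hb
    exact ⟨a' + b', by rw [map_add, map_add, ha, hb]⟩
  | tmul s n =>
    obtain ⟨s, rfl⟩ := (AdicCompletion.of_surjective_iff (I := maximalIdeal R) (M := R)).2
      inferInstance s
    refine ⟨s • n, ?_⟩
    rw [AdicCompletion.ofTensorProduct_tmul, map_smul]
    exact (algebraMap_smul (AdicCompletion (maximalIdeal R) R) s _).symm

variable (I : Ideal R) (M : Type u) [AddCommGroup M] [Module R M] [Module.Finite R M]

lemma finite_adicCompletion : Module.Finite (AdicCompletion I R) (AdicCompletion I M) :=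
  Module.Finite.equiv (AdicCompletion.ofTensorProductEquivOfFiniteNoetherian I M)

end

end Vasconcelos

namespace Vasconcelos

open IsLocalRing Module TensorProduct
open scoped Pointwise

universe u v w

section
variable {R : Type u} [CommRing R] [IsLocalRing R]

/-- `M` has a submodule of dimension at most `d` with Cohen–Macaulay quotient of
dimension `d + 2`. -/
def AlmostCM (R : Type u) [CommRing R] [IsLocalRing R] (M : Type v) [AddCommGroup M] [Module R M]
    (d : ℕ) : Prop :=
  ∃ L : Submodule R M, supportDim R L ≤ d ∧ CMd R (M ⧸ L) (d + 2)

lemma AlmostCM.congr {M : Type v} [AddCommGroup M] [Module R M] {N : Type w} [AddCommGroup N]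
    [Module R N] {d : ℕ} (e : M ≃ₗ[R] N) (h : AlmostCM R M d) : AlmostCM R N d := by
  obtain ⟨L, hL, hC⟩ := h
  have h1 : supportDim R (L.map e.toLinearMap) ≤ d :=
    (supportDim_eq_of_equiv (e.submoduleMap L)).symm.le.trans hL
  exact ⟨_, h1, hC.congr (Submodule.Quotient.equiv L (L.map e.toLinearMap) e rfl)⟩

variable [IsNoetherianRing R]
variable {M : Type u} [AddCommGroup M] [Module R M] [Module.Finite R M]

lemma AlmostCM.coeff_one_eq_zero {d : ℕ} (hM : AlmostCM R M d) {x : Fin (d + 2) → R}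
    (hx : ∀ i, x i ∈ maximalIdeal R) (h : Primary (Ideal.span (Set.range x)) M) {s : ℕ → ℤ}
    (hs : HP (hilb (Ideal.span (Set.range x)) M) (d + 2) s) : s 1 = 0 := by
  obtain ⟨L, hL, hC⟩ := hM
  have h' : Primary (Ideal.span (Set.range x)) (M ⧸ L) := h.of_surjective _ L.mkQ_surjective
  obtain ⟨s', hs'⟩ := exists_HP x hx h'
  rw [coeff_one_quotient_eq hx h L hL hs hs']
  exact hC.coeff_one_eq_zero x hx h' hs'

lemma AlmostCM.coeff_one_eq_zero_of_tensor {S : Type u} [CommRing S] [IsLocalRing S]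
    [IsNoetherianRing S] [Algebra R S] [Module.Flat R S]
    (hm : (maximalIdeal R).map (algebraMap R S) = maximalIdeal S) {d : ℕ}
    {x : Fin (d + 2) → R}
    (hx : ∀ i, x i ∈ maximalIdeal R) (h : Primary (Ideal.span (Set.range x)) M) {s : ℕ → ℤ}
    (hs : HP (hilb (Ideal.span (Set.range x)) M) (d + 2) s) :
    AlmostCM S (S ⊗[R] M) d → s 1 = 0 := by
  intro hM
  rw [← hilb_tensor hm, Ideal.map_span, ← Set.range_comp] at hs
  rw [← primary_tensor_iff hm, Ideal.map_span, ← Set.range_comp] at h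
  exact hM.coeff_one_eq_zero (fun i => hm ▸ Ideal.mem_map_of_mem _ (hx i)) h hs

lemma AlmostCM.tensor_of_coeff_one_eq_zero {S : Type u} [CommRing S] [IsLocalRing S]
    [IsNoetherianRing S] [Algebra R S] [Module.Flat R S] (hS : FinPrecomplete S)
    (hm : (maximalIdeal R).map (algebraMap R S) = maximalIdeal S) {d : ℕ}
    (hM : supportDim R M = (d + 2 : ℕ)) {x : Fin (d + 2) → R}
    (hx : ∀ i, x i ∈ maximalIdeal R) (h : Primary (Ideal.span (Set.range x)) M) {s : ℕ → ℤ}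
    (hs : HP (hilb (Ideal.span (Set.range x)) M) (d + 2) s) (h1 : s 1 = 0) :
    AlmostCM S (S ⊗[R] M) d := by
  rw [← hilb_tensor hm, Ideal.map_span, ← Set.range_comp] at hs
  rw [← primary_tensor_iff hm, Ideal.map_span, ← Set.range_comp] at h
  obtain ⟨L, hL, hC⟩ := exists_cmd_quotient_of_coeff_one_eq_zero hS
    ((supportDim_tensor_eq (S := S) hm).trans hM) _
    (fun i => hm ▸ Ideal.mem_map_of_mem _ (hx i)) h hs h1
  exact ⟨L, le_of_add_one_le_add_one (by exact_mod_cast hL), hC⟩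

/-- The submodule in `AlmostCM` contains every submodule of smaller dimension. -/
lemma le_of_supportDim_le {d : ℕ} {L : Submodule R M} (hC : CMd R (M ⧸ L) (d + 2))
    {N : Submodule R M} (hN : supportDim R N ≤ (d + 1 : ℕ)) : N ≤ L := by
  have h : N.map L.mkQ = ⊥ := by
    refine hC.eq_bot_of_supportDim_lt _ ?_
    have h1 := (supportDim_le_of_surjective (L.mkQ.submoduleMap N)
      (L.mkQ.submoduleMap_surjective N)).trans hN
    have : supportDim R (N.map L.mkQ) + 1 ≤ ((d + 1 : ℕ) : WithBot ℕ∞) + 1 := by gcongr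
    exact_mod_cast this
  rw [← LinearMap.le_ker_iff_map, Submodule.ker_mkQ] at h
  exact h

lemma AlmostCM.supportDim_eq {d : ℕ} (hM : AlmostCM R M d) : supportDim R M = (d + 2 : ℕ) := by
  obtain ⟨L, hL, hC⟩ := hM
  refine le_antisymm (supportDim_le_of_quotient L (hL.trans ?_) hC.supportDim_eq.le) ?_
  · exact_mod_cast Nat.le_add_right d 2
  · rw [← hC.supportDim_eq]
    exact supportDim_le_of_surjective L.mkQ L.mkQ_surjective
end

section
variable {R : Type} [CommRing R]
variable {M : Type} [AddCommGroup M] [Module R M]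

lemma mDim_eq_supportDim [Module.Finite R M] : mDim R M = supportDim R M := by
  rw [mDim, supportDim_eq_ringKrullDim_quotient_annihilator, Submodule.annihilator_top]

lemma mLength_eq_length : mLength R M = (Module.length R M : WithBot ℕ∞) :=
  (Module.coe_length R M).symm

variable [IsLocalRing R] [IsNoetherianRing R] [Module.Finite R M]

lemma hasHilbCoeffs_iff {Q : Ideal R} (h : Primary Q M) {t : ℕ} {s : ℕ → ℤ} :
    HasHilbCoeffs R Q M t s ↔ HP (hilb Q M) t s := by
  refine exists_congr fun N => forall_congr' fun n => forall_congr' fun _ => ?_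
  beta_reduce
  rw [mLength_eq_length, h.coe_hilb]
  have := hilb_nonneg (M := M) Q n
  constructor
  · rintro ⟨l, hl, hl'⟩
    have hl : (hilb Q M n).toNat = l := by exact_mod_cast hl
    rw [hsum, ← hl', ← hl]
    omega
  · intro hn
    refine ⟨_, rfl, ?_⟩
    rw [Int.toNat_of_nonneg this, hn, hsum]

lemma isParamIdeal_iff {Q : Ideal R} {r : ℕ} : IsParamIdeal R Q M r ↔
    ∃ x : Fin r → R, Q = Ideal.span (Set.range x) ∧ (∀ i, x i ∈ maximalIdeal R) ∧
      Primary (Ideal.span (Set.range x)) M := by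
  constructor
  · rintro ⟨h1, ⟨x, rfl⟩, h2⟩
    exact ⟨x, rfl, fun i => h1 (Ideal.subset_span ⟨i, rfl⟩), primary_iff.2 h2⟩
  · rintro ⟨x, rfl, h1, h2⟩
    refine ⟨Ideal.span_le.2 ?_, ⟨x, rfl⟩, primary_iff.1 h2⟩
    rintro _ ⟨i, rfl⟩
    exact h1 i

omit [IsNoetherianRing R] in
lemma isCM_iff {d : ℕ} (h : supportDim R M = d) : IsCM R M ↔ CMd R M d := by
  rw [IsCM, CMd, mDim_eq_supportDim, h]
  constructor
  · rintro ⟨rs, h1, h2, h3⟩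
    exact ⟨le_rfl, rs, by exact_mod_cast h3, h1, h2⟩
  · rintro ⟨-, rs, h1, h2, h3⟩
    exact ⟨rs, h2, h3, by rw [h1]⟩

lemma almostCM_iff_exists {d : ℕ} (h : mDim R M = ((d + 2 : ℕ) : ℕ∞)) : AlmostCM R M d ↔
    ∃ L : Submodule R M, L ≠ ⊤ ∧ IsCM R (M ⧸ L) ∧ mDim R L ≤ (d : ℕ∞) := by
  rw [mDim_eq_supportDim] at h
  refine exists_congr fun L => ?_
  rw [mDim_eq_supportDim]
  constructor
  · rintro ⟨hL, hC⟩
    have := hC.nontrivial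
    exact ⟨Submodule.Quotient.nontrivial_iff.1 this, (isCM_iff hC.supportDim_eq).2 hC, hL⟩
  · rintro ⟨-, hC, hL⟩
    refine ⟨hL, (isCM_iff (le_antisymm ?_ ?_)).1 hC⟩
    · exact (supportDim_le_of_surjective L.mkQ L.mkQ_surjective).trans h.le
    · by_contra hlt
      have h2 := supportDim_le_of_quotient L (hL.trans (by exact_mod_cast Nat.le_succ d))
          (le_of_lt_add_one (d := d + 1) (not_le.1 hlt))
      rw [h] at h2
      have : d + 2 ≤ d + 1 := by exact_mod_cast h2
      omega

lemma eq_unmixedComp {d : ℕ} {L : Submodule R M} (hL : supportDim R L ≤ d)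
    (hC : CMd R (M ⧸ L) (d + 2)) : L = unmixedComp R M := by
  have h := AlmostCM.supportDim_eq ⟨L, hL, hC⟩
  rw [unmixedComp, mDim_eq_supportDim, h]
  refine le_antisymm (le_sSup ?_) (sSup_le fun N hN => ?_)
  · rw [Set.mem_ofPred_eq, mDim_eq_supportDim]
    exact hL.trans_lt (by exact_mod_cast (by omega : d < d + 2))
  · rw [Set.mem_ofPred_eq, mDim_eq_supportDim] at hN
    exact le_of_supportDim_le hC (le_of_lt_add_one (d := d + 1) hN)

lemma almostCM_iff_unmixedComp {d : ℕ} (h : mDim R M = ((d + 2 : ℕ) : ℕ∞)) : AlmostCM R M d ↔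
    IsCM R (M ⧸ unmixedComp R M) ∧ mDim R (unmixedComp R M) ≤ (d : ℕ∞) := by
  constructor
  · rintro ⟨L, hL, hC⟩
    rw [← eq_unmixedComp hL hC, mDim_eq_supportDim]
    exact ⟨(isCM_iff hC.supportDim_eq).2 hC, hL⟩
  · rintro ⟨hC, hL⟩
    refine (almostCM_iff_exists h).2 ⟨_, ?_, hC, hL⟩
    obtain ⟨rs, -, hr, -⟩ := hC
    have := hr.nontrivial
    exact Submodule.Quotient.nontrivial_iff.1 this

end

end Vasconcelos

namespace Vasconcelos

open CategoryTheory Limits Abelian Opposite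

universe u

section
variable {R : Type u} [CommRing R]

lemma homologyMap_eq_zero {S₁ S₂ : ShortComplex (ModuleCat.{u} R)} (φ : S₁ ⟶ S₂)
    (h : ∀ z : S₁.X₂, S₁.g z = 0 → ∃ b : S₂.X₁, S₂.f b = φ.τ₂ z) :
    ShortComplex.homologyMap φ = 0 := by
  rw [← cancel_epi S₁.homologyπ, comp_zero, ShortComplex.homologyπ_naturality]
  ext c
  obtain ⟨b, hb⟩ := h (S₁.iCycles c) (by
    rw [← ConcreteCategory.comp_apply, S₁.iCycles_g]
    rfl)
  have h1 : S₂.toCycles b = ShortComplex.cyclesMap φ c := by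
    apply (ModuleCat.mono_iff_injective S₂.iCycles).1 inferInstance
    rw [← ConcreteCategory.comp_apply, ← ConcreteCategory.comp_apply, S₂.toCycles_i,
      ShortComplex.cyclesMap_i, hb]
    rfl
  rw [ConcreteCategory.comp_apply, ← h1, ← ConcreteCategory.comp_apply,
    ShortComplex.toCycles_comp_homologyπ]
  rfl

lemma homologyMap_op_eq_zero {S₁ S₂ : ShortComplex (ModuleCat.{u} R)ᵒᵖ} (φ : S₁ ⟶ S₂)
    (h : ∀ z : S₂.X₂.unop, S₂.f.unop z = 0 → ∃ b : S₁.X₃.unop, S₁.g.unop b = φ.τ₂.unop z) :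
    ShortComplex.homologyMap φ = 0 := by
  have h1 : ShortComplex.homologyMap (ShortComplex.unopMap φ) = 0 := homologyMap_eq_zero _ h
  have h2 := ShortComplex.homologyOpIso_hom_naturality (ShortComplex.unopMap φ)
  rw [h1, op_zero, comp_zero] at h2
  have h3 := congrArg (· ≫ S₂.unop.homologyOpIso.inv) h2
  simp only [Category.assoc, Iso.hom_inv_id, Category.comp_id, zero_comp] at h3
  exact h3

/-- The two definitions of `Ext` have the same vanishing behaviour on morphisms. -/
lemma ext_map_eq_zero {X X' Y : ModuleCat.{u} R} (f : X' ⟶ X) (n : ℕ)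
    (h : ∀ x : Abelian.Ext.{u} X Y (n + 1), (Abelian.Ext.mk₀ f).comp x (zero_add _) = 0) :
    ((_root_.Ext R (ModuleCat.{u} R) (n + 1)).map f.op).app Y = 0 := by
  let P := projectiveResolution X
  let P' := projectiveResolution X'
  let g := ProjectiveResolution.lift f P' P
  have hg := ProjectiveResolution.lift_commutes f P' P
  have key : (((linearYoneda R (ModuleCat.{u} R)).obj Y).rightOp.leftDerived (n + 1)).map f = 0 := by
    rw [Functor.leftDerived_map_eq _ (n + 1) f (P := P') (Q := P) g hg]
    suffices (((linearYoneda R (ModuleCat.{u} R)).obj Y).rightOp.mapHomologicalComplex _ ⋙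
        HomologicalComplex.homologyFunctor _ _ (n + 1)).map g = 0 by
      rw [this, zero_comp, comp_zero]
    refine homologyMap_op_eq_zero _ ?_
    intro z hz
    have hd : P.complex.d (n + 1 + 1) (n + 1) ≫ (z : P.complex.X (n + 1) ⟶ Y) = 0 := by
      have hz' : P.complex.d ((ComplexShape.down ℕ).prev (n + 1)) (n + 1) ≫
        (z : P.complex.X (n + 1) ⟶ Y) = 0 := hz
      rwa [ChainComplex.prev] at hz'
    have hg0 : g.f 0 ≫ P.π.f 0 = P'.π.f 0 ≫ ((ChainComplex.single₀ _).map f).f 0 :=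
      HomologicalComplex.congr_hom hg 0
    have h1 := h (P.extMk z _ rfl hd)
    rw [ProjectiveResolution.mk₀_comp_extMk z _ rfl hd
      (φ := (⟨g, hg0⟩ : ProjectiveResolution.Hom P' P f)),
      ProjectiveResolution.extMk_eq_zero_iff _ _ _ _ _ n rfl] at h1
    have h2 : ∃ b : P'.complex.X ((ComplexShape.down ℕ).next (n + 1)) ⟶ Y,
        P'.complex.d (n + 1) ((ComplexShape.down ℕ).next (n + 1)) ≫ b =
          g.f (n + 1) ≫ (z : P.complex.X (n + 1) ⟶ Y) := by
      rwa [ChainComplex.next_nat_succ]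
    exact h2
  exact congrArg Quiver.Hom.unop key

/-- The projection `R ⧸ J ^ t' ⟶ R ⧸ J ^ t`. -/
noncomputable def powProj (J : Ideal R) {t t' : ℕ} (h : t ≤ t') :
    ModuleCat.of R (R ⧸ J ^ t') ⟶ ModuleCat.of R (R ⧸ J ^ t) :=
  ModuleCat.ofHom (Submodule.mapQ _ _ LinearMap.id (Ideal.pow_le_pow_right h))

/-- The transition maps in the direct system of `Ext^n(R ⧸ J ^ t, Y)` are eventually zero. -/
def ExtVanish (J : Ideal R) (Y : ModuleCat.{u} R) (n : ℕ) : Prop :=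
  ∀ t : ℕ, ∃ (t' : ℕ) (h : t ≤ t'), ∀ x : Abelian.Ext.{u} (ModuleCat.of R (R ⧸ J ^ t)) Y n,
    (Abelian.Ext.mk₀ (powProj J h)).comp x (zero_add _) = 0

lemma ExtVanish.subsingleton_localCohomology {J : Ideal R} {Y : ModuleCat.{u} R} {n : ℕ}
    (h : ExtVanish J Y (n + 1)) : Subsingleton ((localCohomology J (n + 1)).obj Y) := by
  let D := localCohomology.diagram (localCohomology.idealPowersDiagram J) (n + 1)
  have hD : IsColimit (((evaluation _ _).obj Y).mapCocone (colimit.cocone D)) :=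
    isColimitOfPreserves _ (colimit.isColimit D)
  have h0 : IsZero (((evaluation _ _).obj Y).mapCocone (colimit.cocone D)).pt := by
    rw [IsZero.iff_id_eq_zero]
    refine hD.hom_ext fun t => ?_
    obtain ⟨t', hle, hx⟩ := h t.unop.unop
    let w : t ⟶ op (op t') := (homOfLE hle).op.op
    have h1 := (((evaluation _ _).obj Y).mapCocone (colimit.cocone D)).w w
    have h2 : (D.map w).app Y = 0 := ext_map_eq_zero (powProj J hle) n hx
    have h3 : (((evaluation _ _).obj Y).mapCocone (colimit.cocone D)).ι.app t = 0 := by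
      rw [← h1]
      exact (congrArg (· ≫ _) h2).trans zero_comp
    rw [h3, zero_comp, zero_comp]
  exact ModuleCat.subsingleton_of_isZero h0

end

end Vasconcelos

namespace Vasconcelos

open CategoryTheory Limits Abelian Opposite
open scoped Pointwise

universe u

section
variable {R : Type u} [CommRing R]

/-- Dimension shifting for the vanishing of maps on `Ext`, along a map of presentations. -/
lemma ext_comp_eq_zero_of_ker {X X' F F' : Type u} [AddCommGroup X] [Module R X]
    [AddCommGroup X'] [Module R X'] [AddCommGroup F] [Module R F] [AddCommGroup F'] [Module R F']
    [Module.Projective R F] {π : F →ₗ[R] X} (hπ : Function.Surjective π)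
    {π' : F' →ₗ[R] X'} (hπ' : Function.Surjective π') (φ : F' →ₗ[R] F) (f : X' →ₗ[R] X)
    (hφ : ∀ z, π (φ z) = f (π' z)) {Y : ModuleCat.{u} R} {n : ℕ}
    (h : ∀ y : Abelian.Ext.{u} (ModuleCat.of R (LinearMap.ker π)) Y n,
      (Abelian.Ext.mk₀ (ModuleCat.ofHom (φ.restrict (p := LinearMap.ker π') (q := LinearMap.ker π)
        fun z hz => by
          rw [LinearMap.mem_ker] at hz ⊢
          rw [hφ, hz, map_zero]))).comp y (zero_add _) = 0)
    (x : Abelian.Ext.{u} (ModuleCat.of R X) Y (n + 1)) :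
    (Abelian.Ext.mk₀ (ModuleCat.ofHom f)).comp x (zero_add _) = 0 := by
  have h1 := LinearMap.shortExact_shortComplexKer hπ
  have h2 := LinearMap.shortExact_shortComplexKer hπ'
  let ψ : π'.shortComplexKer ⟶ π.shortComplexKer :=
    { τ₁ := ModuleCat.ofHom (φ.restrict (p := LinearMap.ker π') (q := LinearMap.ker π)
        fun z hz => by
          rw [LinearMap.mem_ker] at hz ⊢
          rw [hφ, hz, map_zero])
      τ₂ := ModuleCat.ofHom φ
      τ₃ := ModuleCat.ofHom f
      comm₁₂ := by ext; rfl
      comm₂₃ := by ext z; exact hφ z }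
  have hP : Projective (ModuleCat.of R F) := inferInstance
  obtain ⟨y, hy⟩ := Abelian.Ext.contravariant_sequence_exact₃ h1 Y x
    (Abelian.Ext.eq_zero_of_projective (P := ModuleCat.of R F) _) (add_comm 1 n)
  have h3 := ShortComplex.ShortExact.extClass_naturality h2 h1 ψ
  have h4 := congrArg (fun w => Abelian.Ext.comp w y (add_comm 1 n)) h3
  rw [Abelian.Ext.comp_assoc (a₂₃ := n) _ _ _ _ (by omega) (by omega)] at h4
  rw [Abelian.Ext.comp_assoc (a₂₃ := n + 1) _ _ _ _ (by omega) (by omega)] at h4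
  have h5 : (Abelian.Ext.mk₀ ψ.τ₁).comp y (zero_add n) = 0 := h y
  rw [h5, Abelian.Ext.comp_zero] at h4
  rw [← hy]
  exact h4.symm

lemma exists_smul_top_inf_le {F : Type u} [AddCommGroup F] [Module R F] [IsNoetherianRing R]
    [Module.Finite R F] (J : Ideal R) (K : Submodule R F) (s : ℕ) :
    ∃ t, ∀ z : K, (z : F) ∈ J ^ t • (⊤ : Submodule R F) → z ∈ J ^ s • (⊤ : Submodule R K) := by
  obtain ⟨c, hc⟩ := Ideal.exists_pow_inf_eq_pow_smul J K
  refine ⟨s + c, fun z hz => ?_⟩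
  have h1 : (z : F) ∈ J ^ s • K := by
    have h2 : (z : F) ∈ J ^ (s + c) • (⊤ : Submodule R F) ⊓ K := ⟨hz, z.2⟩
    rw [hc _ (Nat.le_add_left _ _), Nat.add_sub_cancel] at h2
    exact (smul_mono_right (J ^ s) inf_le_right : _ ≤ J ^ s • K) h2
  have h3 : (J ^ s • (⊤ : Submodule R K)).map K.subtype = J ^ s • K := by
    rw [Submodule.map_smul'', Submodule.map_top, Submodule.range_subtype]
  rw [← h3] at h1
  obtain ⟨w, hw, hwz⟩ := h1
  rwa [← Subtype.ext (a1 := w) (a2 := z) hwz]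

/-- If a power of `J` kills `N`, then maps with image in a large multiple `J ^ s • X` induce
the zero map on `Ext^n(-, N)`. -/
lemma exists_forall_ext_comp_eq_zero [IsNoetherianRing R] (J : Ideal R) (N : ModuleCat.{u} R)
    {k : ℕ} (hk : J ^ k • (⊤ : Submodule R N) = ⊥) (n : ℕ) :
    ∀ (X : Type u) [AddCommGroup X] [Module R X] [Module.Finite R X], ∃ s : ℕ,
      ∀ (X' : Type u) [AddCommGroup X'] [Module R X'] (f : X' →ₗ[R] X),
        (∀ z, f z ∈ J ^ s • (⊤ : Submodule R X)) →
        ∀ x : Abelian.Ext.{u} (ModuleCat.of R X) N n,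
          (Abelian.Ext.mk₀ (ModuleCat.ofHom f)).comp x (zero_add _) = 0 := by
  induction n with
  | zero =>
    intro X _ _ _
    refine ⟨k, fun X' _ _ f hf x => ?_⟩
    obtain ⟨g, rfl⟩ := Abelian.Ext.addEquiv₀.symm.surjective x
    have h1 : ModuleCat.ofHom f ≫ g = 0 := by
      ext z
      have h2 : g.hom (f z) ∈ (J ^ k • (⊤ : Submodule R X)).map g.hom := ⟨_, hf z, rfl⟩
      rw [Submodule.map_smul''] at h2
      have h3 := (smul_mono_right (J ^ k) le_top : _ ≤ J ^ k • (⊤ : Submodule R N)) h2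
      rw [hk] at h3
      exact h3
    have h4 : Abelian.Ext.addEquiv₀.symm g = Abelian.Ext.mk₀ g := rfl
    rw [h4, Abelian.Ext.mk₀_comp_mk₀, h1, Abelian.Ext.mk₀_zero]
  | succ n ih =>
    intro X _ _ _
    obtain ⟨m, π, hπ⟩ := Module.Finite.exists_fin' R X
    obtain ⟨s, hs⟩ := ih (LinearMap.ker π)
    obtain ⟨t, ht⟩ := exists_smul_top_inf_le J (LinearMap.ker π) s
    refine ⟨t, fun X' _ _ f hf x => ?_⟩
    have h1 : ∀ z : X', ∃ w ∈ J ^ t • (⊤ : Submodule R (Fin m → R)), π w = f z := by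
      intro z
      have h2 := hf z
      rw [← LinearMap.range_eq_top.2 hπ, ← Submodule.map_top, ← Submodule.map_smul''] at h2
      exact h2
    choose w hw hwz using h1
    let φ : (X' →₀ R) →ₗ[R] (Fin m → R) := Finsupp.linearCombination R w
    have hφ : ∀ z, π (φ z) = f (Finsupp.linearCombination R id z) := by
      intro z
      have : π ∘ₗ φ = f ∘ₗ Finsupp.linearCombination R id := by
        ext z
        simp [φ, hwz]
      exact LinearMap.congr_fun this z
    have hφt : ∀ z, φ z ∈ J ^ t • (⊤ : Submodule R (Fin m → R)) := by
      intro z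
      have : LinearMap.range φ ≤ J ^ t • (⊤ : Submodule R (Fin m → R)) := by
        rw [Finsupp.range_linearCombination, Submodule.span_le]
        rintro _ ⟨z, rfl⟩
        exact hw z
      exact this ⟨z, rfl⟩
    refine ext_comp_eq_zero_of_ker hπ (Finsupp.linearCombination_id_surjective R X') φ f hφ ?_ x
    exact hs _ _ fun z => ht _ (hφt z)

lemma extVanish_succ_of_pow_smul_eq_bot [IsNoetherianRing R] (J : Ideal R) (N : ModuleCat.{u} R)
    {k : ℕ} (hk : J ^ k • (⊤ : Submodule R N) = ⊥) (n : ℕ) : ExtVanish J N (n + 1) := by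
  intro t
  obtain ⟨s, hs⟩ := exists_forall_ext_comp_eq_zero J N hk n
    (LinearMap.ker (Submodule.mkQ (J ^ t : Ideal R)))
  obtain ⟨t', ht'⟩ := exists_smul_top_inf_le J (LinearMap.ker (Submodule.mkQ (J ^ t : Ideal R))) s
  refine ⟨t + t', Nat.le_add_right _ _, fun x => ?_⟩
  refine ext_comp_eq_zero_of_ker (Submodule.mkQ_surjective (J ^ t : Ideal R))
    (Submodule.mkQ_surjective (J ^ (t + t') : Ideal R)) LinearMap.id _ (fun z => rfl) ?_ x
  refine hs _ _ fun z => ht' _ ?_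
  have h1 : (z : R) ∈ J ^ (t + t') := by
    exact (Submodule.Quotient.mk_eq_zero _).1 (LinearMap.mem_ker.1 z.2)
  have h2 : (z : R) ∈ J ^ t' • (⊤ : Submodule R R) := by
    rw [smul_eq_mul, Ideal.mul_top]
    exact Ideal.pow_le_pow_right (Nat.le_add_left _ _) h1
  exact h2

lemma powProj_comp (J : Ideal R) {t t' t'' : ℕ} (h : t ≤ t') (h' : t' ≤ t'') :
    powProj J h' ≫ powProj J h = powProj J (h.trans h') := by
  ext
  rfl

lemma ext_powProj_comp (J : Ideal R) {t t' t'' : ℕ} (h : t ≤ t') (h' : t' ≤ t'')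
    {Y : ModuleCat.{u} R} {n : ℕ} (x : Abelian.Ext.{u} (ModuleCat.of R (R ⧸ J ^ t)) Y n) :
    (Abelian.Ext.mk₀ (powProj J (h.trans h'))).comp x (zero_add _) =
      (Abelian.Ext.mk₀ (powProj J h')).comp
        ((Abelian.Ext.mk₀ (powProj J h)).comp x (zero_add _)) (zero_add _) := by
  rw [Abelian.Ext.mk₀_comp_mk₀_assoc, powProj_comp]

lemma ExtVanish.of_shortExact {J : Ideal R} {S : ShortComplex (ModuleCat.{u} R)}
    (hS : S.ShortExact) {n : ℕ} (h₁ : ExtVanish J S.X₁ n) (h₃ : ExtVanish J S.X₃ n) :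
    ExtVanish J S.X₂ n := by
  intro t
  obtain ⟨t₁, ht₁, h1⟩ := h₃ t
  obtain ⟨t₂, ht₂, h2⟩ := h₁ t₁
  refine ⟨t₂, ht₁.trans ht₂, fun x => ?_⟩
  rw [ext_powProj_comp J ht₁ ht₂]
  obtain ⟨y, hy⟩ := Abelian.Ext.covariant_sequence_exact₂ _ hS
    ((Abelian.Ext.mk₀ (powProj J ht₁)).comp x (zero_add _)) (by
      rw [Abelian.Ext.comp_assoc (a₂₃ := n) _ _ _ _ (by omega) (by omega), h1])
  rw [← hy, ← Abelian.Ext.comp_assoc (a₁₂ := n) _ _ _ (by omega) (by omega) (by omega), h2,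
    Abelian.Ext.zero_comp]

lemma pow_smul_ext_eq_zero {J : Ideal R} {y : R} (hy : y ∈ J) (t : ℕ) {Y : ModuleCat.{u} R}
    {n : ℕ} (x : Abelian.Ext.{u} (ModuleCat.of R (R ⧸ J ^ t)) Y n) : y ^ t • x = 0 := by
  have h1 : y ^ t • 𝟙 (ModuleCat.of R (R ⧸ J ^ t)) = 0 := by
    ext
    have : y ^ t • (1 : R ⧸ J ^ t) = 0 := by
      rw [Algebra.smul_def, mul_one]
      exact Ideal.Quotient.eq_zero_iff_mem.2 (Ideal.pow_mem_pow hy t)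
    exact this
  rw [← Abelian.Ext.mk₀_id_comp x, ← Abelian.Ext.smul_comp, ← Abelian.Ext.mk₀_smul, h1,
    Abelian.Ext.mk₀_zero, Abelian.Ext.zero_comp]

lemma ExtVanish.of_quotSMulTop {J : Ideal R} {y : R} (hy : y ∈ J) {Y : ModuleCat.{u} R}
    (hr : IsSMulRegular Y y) {n : ℕ} (h : ExtVanish J (ModuleCat.of R (QuotSMulTop y Y)) n) :
    ExtVanish J Y (n + 1) := by
  have hS := hr.smulShortComplex_shortExact
  have key : ∀ k t : ℕ, ∃ (t' : ℕ) (h : t ≤ t'),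
      ∀ x : Abelian.Ext.{u} (ModuleCat.of R (R ⧸ J ^ t)) Y (n + 1), y ^ k • x = 0 →
        (Abelian.Ext.mk₀ (powProj J h)).comp x (zero_add _) = 0 := by
    intro k
    induction k with
    | zero =>
      intro t
      refine ⟨t, le_rfl, fun x hx => ?_⟩
      rw [pow_zero, one_smul] at hx
      rw [hx, Abelian.Ext.comp_zero]
    | succ k ih =>
      intro t
      obtain ⟨t₁, ht₁, h1⟩ := ih t
      obtain ⟨t₂, ht₂, h2⟩ := h t₁
      refine ⟨t₂, ht₁.trans ht₂, fun x hx => ?_⟩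
      rw [pow_succ, mul_smul] at hx
      have h3 := h1 _ hx
      rw [Abelian.Ext.comp_smul, Abelian.Ext.smul_eq_comp_mk₀] at h3
      obtain ⟨w, hw⟩ := Abelian.Ext.covariant_sequence_exact₁ _ hS
        ((Abelian.Ext.mk₀ (powProj J ht₁)).comp x (zero_add _)) h3 rfl
      have h4 := Abelian.Ext.comp_assoc (a₁₂ := n) (Abelian.Ext.mk₀ (powProj J ht₂)) w hS.extClass
        (zero_add n) rfl (by omega : 0 + n + 1 = n + 1)
      rw [ext_powProj_comp J ht₁ ht₂]
      exact (congrArg (fun v => (Abelian.Ext.mk₀ (powProj J ht₂)).comp v (zero_add _)) hw).symm.trans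
        (h4.symm.trans ((congrArg (fun v => Abelian.Ext.comp v hS.extClass rfl) (h2 w)).trans
          (Abelian.Ext.zero_comp ..)))
  intro t
  obtain ⟨t', ht, h1⟩ := key t t
  exact ⟨t', ht, fun x => h1 x (pow_smul_ext_eq_zero hy t x)⟩

lemma ExtVanish.zero_of_isSMulRegular {J : Ideal R} {y : R} (hy : y ∈ J) {Y : ModuleCat.{u} R}
    (hr : IsSMulRegular Y y) : ExtVanish J Y 0 := by
  intro t
  refine ⟨t, le_rfl, fun x => ?_⟩
  have h1 : x = 0 := by
    obtain ⟨g, rfl⟩ := Abelian.Ext.addEquiv₀.symm.surjective x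
    have h2 := pow_smul_ext_eq_zero hy t (Abelian.Ext.addEquiv₀.symm g)
    have h3 : Abelian.Ext.addEquiv₀.symm g = Abelian.Ext.mk₀ g := rfl
    rw [h3, ← Abelian.Ext.mk₀_smul, Abelian.Ext.mk₀_eq_zero_iff] at h2
    rw [h3, Abelian.Ext.mk₀_eq_zero_iff]
    ext
    apply hr.pow t
    have h4 : y ^ t • g.hom (1 : R ⧸ J ^ t) = 0 :=
      congrArg (fun f : ModuleCat.of R (R ⧸ J ^ t) ⟶ Y => f.hom (1 : R ⧸ J ^ t)) h2
    exact h4.trans (smul_zero _).symm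
  rw [h1, Abelian.Ext.comp_zero]

end

end Vasconcelos

namespace Vasconcelos

open IsLocalRing Module TensorProduct CategoryTheory
open scoped Pointwise

universe u

section
variable {R : Type u} [CommRing R] [IsLocalRing R]

/-- `W` has a submodule of dimension at most `d - 1` with Cohen–Macaulay quotient of
dimension `d + 1`. -/
def NearCM (R : Type u) [CommRing R] [IsLocalRing R] (W : Type u) [AddCommGroup W] [Module R W]
    (d : ℕ) : Prop :=
  ∃ L : Submodule R W, supportDim R L + 1 ≤ d ∧ CMd R (W ⧸ L) (d + 1)

lemma NearCM.congr {W W' : Type u} [AddCommGroup W] [Module R W] [AddCommGroup W']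
    [Module R W'] {d : ℕ} (e : W ≃ₗ[R] W') (h : NearCM R W d) : NearCM R W' d := by
  obtain ⟨L, hL, hC⟩ := h
  have h1 : supportDim R (L.map e.toLinearMap) + 1 ≤ d := by
    rwa [← supportDim_eq_of_equiv (e.submoduleMap L)]
  exact ⟨_, h1, hC.congr (Submodule.Quotient.equiv L (L.map e.toLinearMap) e rfl)⟩

lemma supportDim_le_zero_of_pow_smul_eq_bot {M : Type u} [AddCommGroup M] [Module R M] {k : ℕ}
    (hk : maximalIdeal R ^ k • (⊤ : Submodule R M) = ⊥) : supportDim R M ≤ 0 := by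
  have h1 : ∀ p ∈ support R M, p = closedPoint R := by
    intro p hp
    have h2 : maximalIdeal R ^ k ≤ p.asIdeal := by
      refine le_trans ?_ (annihilator_le_of_mem_support hp)
      intro a ha
      rw [mem_annihilator]
      intro z
      have h3 : a • z ∈ maximalIdeal R ^ k • (⊤ : Submodule R M) :=
        Submodule.smul_mem_smul ha trivial
      rwa [hk] at h3
    exact PrimeSpectrum.ext ((maximalIdeal.isMaximal R).eq_of_le p.2.ne_top
      (p.2.le_of_pow_le h2)).symm
  have : Subsingleton (support R M) := ⟨fun p q => Subtype.ext ((h1 _ p.2).trans (h1 _ q.2).symm)⟩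
  exact Order.krullDim_nonpos_of_subsingleton

variable [IsNoetherianRing R]

lemma NearCM.quotient {W : Type u} [AddCommGroup W] [Module R W] [Module.Finite R W] {d : ℕ}
    (h : NearCM R W (d + 1)) (K : Submodule R W) (hK : supportDim R K ≤ 0) :
    NearCM R (W ⧸ K) (d + 1) := by
  obtain ⟨L, hL, hC⟩ := h
  have hle : K ≤ L := by
    have h1 : K.map L.mkQ = ⊥ := by
      refine hC.eq_bot_of_supportDim_lt _ ?_
      have h2 : supportDim R (K.map L.mkQ) ≤ 0 :=
        (supportDim_le_of_surjective _ (L.mkQ.submoduleMap_surjective K)).trans hK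
      calc supportDim R (K.map L.mkQ) + 1 ≤ 0 + 1 := by gcongr
        _ ≤ ((d + 1 + 1 : ℕ) : WithBot ℕ∞) := by
          rw [zero_add]
          exact_mod_cast Nat.succ_le_succ (Nat.zero_le _)
    rwa [← LinearMap.le_ker_iff_map, Submodule.ker_mkQ] at h1
  refine ⟨L.map K.mkQ, le_trans ?_ hL,
    hC.congr (Submodule.quotientQuotientEquivQuotient K L hle).symm⟩
  gcongr
  exact supportDim_le_of_surjective _ (K.mkQ.submoduleMap_surjective L)

lemma NearCM.quotSMulTop {W : Type u} [AddCommGroup W] [Module R W] [Module.Finite R W] {d : ℕ}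
    {L : Submodule R W} (hL : supportDim R L + 1 ≤ (d + 1 : ℕ)) (hC : CMd R (W ⧸ L) (d + 1 + 1))
    {x : R} (hx : x ∈ maximalIdeal R) (hr : IsSMulRegular W x) (hr' : IsSMulRegular (W ⧸ L) x) :
    NearCM R (QuotSMulTop x W) d := by
  refine ⟨L.map (x • (⊤ : Submodule R W)).mkQ, ?_, ?_⟩
  · have hrL : IsSMulRegular L x := fun a b hab =>
      Subtype.ext (hr (congrArg Subtype.val hab))
    have h1 := supportDim_quotSMulTop_succ_eq_supportDim hrL hx
    have h2 : supportDim R L ≤ d := le_of_add_one_le_add_one (by exact_mod_cast hL)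
    refine le_trans ?_ (h1.le.trans h2)
    gcongr
    let f : L →ₗ[R] L.map (x • (⊤ : Submodule R W)).mkQ :=
      (x • (⊤ : Submodule R W)).mkQ.submoduleMap L
    have hf : Function.Surjective f :=
      (x • (⊤ : Submodule R W)).mkQ.submoduleMap_surjective L
    have hle : x • (⊤ : Submodule R L) ≤ LinearMap.ker f := by
      rintro _ ⟨y, -, rfl⟩
      refine LinearMap.mem_ker.2 (Subtype.ext ?_)
      refine (Submodule.Quotient.mk_eq_zero _).2 ?_
      exact Submodule.smul_mem_pointwise_smul (y : W) x ⊤ trivial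
    refine supportDim_le_of_surjective (Submodule.liftQ _ f hle) ?_
    rw [← LinearMap.range_eq_top, Submodule.range_liftQ, LinearMap.range_eq_top]
    exact hf
  · have h1 := hC.quotSMulTop hx (supportDim_quotSMulTop_le_of_regular hx hr' hC.1)
    refine h1.congr ?_
    have h2 : x • (⊤ : Submodule R (W ⧸ L)) = (x • (⊤ : Submodule R W)).map L.mkQ := by
      rw [Submodule.map_pointwise_smul, Submodule.map_top, Submodule.range_mkQ]
    exact (Submodule.quotEquivOfEq _ _ h2).trans
      ((Submodule.quotientQuotientEquivQuotientSup L (x • ⊤)).trans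
        ((Submodule.quotEquivOfEq _ _ (sup_comm _ _)).trans
          (Submodule.quotientQuotientEquivQuotientSup (x • ⊤) L).symm))

lemma exists_submodule_pow_smul_eq_bot (M : Type u) [AddCommGroup M] [Module R M]
    [Module.Finite R M] :
    ∃ (N : Submodule R M) (k : ℕ), maximalIdeal R ^ k • (⊤ : Submodule R N) = ⊥ ∧
      ∀ z : M ⧸ N, (∀ a ∈ maximalIdeal R, a • z = 0) → z = 0 := by
  obtain ⟨N, ⟨k, hk⟩, hN⟩ := set_has_maximal_iff_noetherian.2
    (inferInstance : IsNoetherian R M)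
    {N : Submodule R M | ∃ k, maximalIdeal R ^ k • N = ⊥} ⟨⊥, 0, by simp⟩
  refine ⟨N, k, ?_, ?_⟩
  · refine (Submodule.map_injective_of_injective N.injective_subtype) ?_
    rw [Submodule.map_smul'', Submodule.map_top, Submodule.range_subtype, hk, Submodule.map_bot]
  · intro z hz
    obtain ⟨y, rfl⟩ := Submodule.mkQ_surjective N z
    by_contra hy
    refine hN (N ⊔ Submodule.span R {y}) ⟨k + 1, ?_⟩ ?_
    · have h1 : maximalIdeal R • (N ⊔ Submodule.span R {y}) ≤ N := by
        rw [Submodule.smul_sup]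
        refine sup_le Submodule.smul_le_right ?_
        rw [Submodule.smul_le]
        intro a ha w hw
        obtain ⟨c, rfl⟩ := Submodule.mem_span_singleton.1 hw
        rw [smul_comm]
        refine N.smul_mem c ?_
        exact (Submodule.Quotient.mk_eq_zero _).1 (hz a ha)
      rw [pow_succ, mul_smul, eq_bot_iff, ← hk]
      exact smul_mono_right (maximalIdeal R ^ k) h1
    · refine lt_of_le_of_ne le_sup_left fun heq => hy ?_
      refine (Submodule.Quotient.mk_eq_zero _).2 ?_
      rw [heq]
      exact Submodule.mem_sup_right (Submodule.mem_span_singleton_self y)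

end

section
variable {R : Type u} [CommRing R] [IsLocalRing R] [IsNoetherianRing R]
variable {S : Type u} [CommRing S] [IsLocalRing S] [IsNoetherianRing S] [Algebra R S]
variable (hm : (maximalIdeal R).map (algebraMap R S) = maximalIdeal S)
include hm

omit [IsNoetherianRing R] in
lemma exists_isSMulRegular_algebraMap {E : Type u} [AddCommGroup E] [Module S E]
    [Module.Finite S E] (h : ∀ y : E, (∀ a ∈ maximalIdeal S, a • y = 0) → y = 0) :
    ∃ a ∈ maximalIdeal R, IsSMulRegular E (algebraMap R S a) := by
  obtain ⟨a, haJ, ha⟩ := exists_mem_forall_notMem (J := maximalIdeal R)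
    (s := Ideal.comap (algebraMap R S) '' associatedPrimes S E)
    ((associatedPrimes.finite S E).image _) (by
      rintro _ ⟨p, hp, rfl⟩
      have := ((mem_associatedPrimes_iff).1 hp).1
      exact Ideal.IsPrime.comap _) (by
      rintro _ ⟨p, hp, rfl⟩ hle
      rw [← Ideal.map_le_iff_le_comap, hm] at hle
      obtain ⟨hpp, y, hy⟩ := mem_associatedPrimes_iff.1 hp
      refine hpp.ne_top ((Ideal.eq_top_iff_one p).2 ((hy 1).2 ?_))
      rw [h y fun a ha => (hy a).1 (hle ha), smul_zero])
  refine ⟨a, haJ, ?_⟩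
  by_contra hcon
  have : algebraMap R S a ∈ ⋃ p ∈ associatedPrimes S E, (p : Set S) := by
    rw [biUnion_associatedPrimes_eq_compl_regular]
    exact hcon
  simp only [Set.mem_iUnion] at this
  obtain ⟨p, hp, hap⟩ := this
  exact ha _ ⟨p, hp, rfl⟩ hap

variable [Module.Flat R S]

theorem NearCM.extVanish {d : ℕ} {M : Type u} [AddCommGroup M] [Module R M] [Module.Finite R M]
    (h : NearCM S (S ⊗[R] M) d) : ExtVanish (maximalIdeal R) (ModuleCat.of R M) d := by
  induction d generalizing M with
  | zero =>
    obtain ⟨L, hL, hC⟩ := h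
    have h1 : L = ⊥ := by
      rw [← Submodule.subsingleton_iff_eq_bot]
      by_contra hcon
      rw [not_subsingleton_iff_nontrivial] at hcon
      obtain ⟨n, hn⟩ := WithBot.ne_bot_iff_exists.1 (supportDim_ne_bot_of_nontrivial S L)
      rw [← hn] at hL
      have h2 : n + 1 ≤ 0 := by exact_mod_cast hL
      simp at h2
    subst h1
    obtain ⟨x, hx, hr, -⟩ := ((cmd_tensor_iff (M := M) hm).1
      (hC.congr (Submodule.quotEquivOfEqBot ⊥ rfl))).exists_regular
    exact ExtVanish.zero_of_isSMulRegular hx hr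
  | succ d ih =>
    obtain ⟨N, k, hk, hN⟩ := exists_submodule_pow_smul_eq_bot (R := R) M
    obtain ⟨y, hy, hry⟩ := exists_isSMulRegular_mem hN
    have hsurj : Function.Surjective (N.mkQ.baseChange S) :=
      LinearMap.lTensor_surjective S N.mkQ_surjective
    have hK : supportDim S (LinearMap.ker (N.mkQ.baseChange S)) ≤ 0 := by
      have h1 : supportDim S (S ⊗[R] N) ≤ 0 :=
        (supportDim_tensor_eq hm).le.trans (supportDim_le_zero_of_pow_smul_eq_bot hk)
      have h2 : ∀ z, z ∈ LinearMap.ker (N.mkQ.baseChange S) ↔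
          z ∈ LinearMap.range (N.subtype.baseChange S) := by
        intro z
        exact (lTensor_exact S (LinearMap.exact_subtype_mkQ N) N.mkQ_surjective) z
      rw [show LinearMap.ker (N.mkQ.baseChange S) = LinearMap.range (N.subtype.baseChange S) from
        Submodule.ext h2]
      exact (supportDim_le_of_surjective _
        (LinearMap.surjective_rangeRestrict (N.subtype.baseChange S))).trans h1
    obtain ⟨L, hL, hC⟩ := (h.quotient _ hK).congr
      (LinearMap.quotKerEquivOfSurjective _ hsurj)
    obtain ⟨w, hw, hrw⟩ : ∃ w ∈ maximalIdeal R, IsSMulRegular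
        ((S ⊗[R] (M ⧸ N)) × ((S ⊗[R] (M ⧸ N)) ⧸ L)) (algebraMap R S w) := by
      refine exists_isSMulRegular_algebraMap hm
        (E := (S ⊗[R] (M ⧸ N)) × ((S ⊗[R] (M ⧸ N)) ⧸ L)) fun z hz => ?_
      obtain ⟨v, hv, hrv, -⟩ := hC.exists_regular
      refine Prod.ext ((isSMulRegular_tensor_iff hm).2 hry ?_) (hrv ?_)
      · have h1 := congrArg Prod.fst (hz (algebraMap R S y) (hm ▸ Ideal.mem_map_of_mem _ hy))
        exact h1.trans (smul_zero _).symm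
      · have h1 := congrArg Prod.snd (hz v hv)
        exact h1.trans (smul_zero _).symm
    have hw' : algebraMap R S w ∈ maximalIdeal S := hm ▸ Ideal.mem_map_of_mem _ hw
    have hr1 : IsSMulRegular (S ⊗[R] (M ⧸ N)) (algebraMap R S w) := fun a b hab =>
      congrArg Prod.fst (@hrw (a, 0) (b, 0) (Prod.ext hab rfl))
    have hr2 : IsSMulRegular ((S ⊗[R] (M ⧸ N)) ⧸ L) (algebraMap R S w) := fun a b hab =>
      congrArg Prod.snd (@hrw (0, a) (0, b) (Prod.ext rfl hab))
    have h3 := ih ((NearCM.quotSMulTop hL hC hw' hr1 hr2).congr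
      (QuotSMulTop.algebraMapTensorEquivTensorQuotSMulTop w (M ⧸ N) S))
    have h4 : ExtVanish (maximalIdeal R) (ModuleCat.of R (M ⧸ N)) (d + 1) :=
      ExtVanish.of_quotSMulTop hw ((isSMulRegular_tensor_iff hm).1 hr1) h3
    have h5 : ExtVanish (maximalIdeal R) (ModuleCat.of R N) (d + 1) :=
      extVanish_succ_of_pow_smul_eq_bot _ _ hk d
    exact ExtVanish.of_shortExact (ModuleCat.shortComplex_shortExact
      (ModuleCat.shortComplexOfCompEqZero N.subtype N.mkQ (by ext; simp))
      (LinearMap.exact_subtype_mkQ N) N.injective_subtype N.mkQ_surjective) h5 h4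

theorem AlmostCM.subsingleton_localCohomology {d : ℕ} {M : Type u} [AddCommGroup M] [Module R M]
    [Module.Finite R M] (h : AlmostCM S (S ⊗[R] M) d) :
    Subsingleton ((localCohomology (maximalIdeal R) (d + 1)).obj (ModuleCat.of R M)) := by
  obtain ⟨L, hL, hC⟩ := h
  refine ExtVanish.subsingleton_localCohomology (NearCM.extVanish hm ⟨L, ?_, hC⟩)
  push_cast
  gcongr

end

end Vasconcelos

namespace Vasconcelos

open IsLocalRing Module TensorProduct

section
variable {R : Type} [CommRing R] [IsLocalRing R] [IsNoetherianRing R]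
variable {M : Type} [AddCommGroup M] [Module R M] [Module.Finite R M]

lemma exists_isParamIdeal_hasHilbCoeffs {r : ℕ} (h : supportDim R M ≤ r) :
    ∃ Q e, IsParamIdeal R Q M r ∧ HasHilbCoeffs R Q M r e := by
  obtain ⟨x, hx, hp⟩ := exists_primary_of_supportDim_le h
  obtain ⟨s, hs⟩ := exists_HP x hx hp
  exact ⟨_, s, isParamIdeal_iff.2 ⟨x, rfl, hx, hp⟩, (hasHilbCoeffs_iff hp).2 hs⟩

omit [IsNoetherianRing R] [Module.Finite R M] in
lemma isVasconcelos_iff {d : ℕ} (h : mDim R M = ((d + 2 : ℕ) : ℕ∞)) :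
    IsVasconcelos R M ↔ ∃ (Q : Ideal R) (e : ℕ → ℤ),
      IsParamIdeal R Q M (d + 2) ∧ HasHilbCoeffs R Q M (d + 2) e ∧ e 1 = 0 := by
  have h0 : 0 < mDim R M := by
    rw [h]
    exact_mod_cast Nat.succ_pos _
  constructor
  · rintro (h1 | ⟨-, r, Q, e, hr, hQ⟩)
    · exact absurd h1 h0.not_ge
    · rw [h] at hr
      have : d + 2 = r := by exact_mod_cast hr
      subst this
      exact ⟨Q, e, hQ⟩
  · rintro ⟨Q, e, hQ⟩
    exact Or.inr ⟨h0, _, Q, e, h, hQ⟩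

variable {S : Type} [CommRing S] [IsLocalRing S] [IsNoetherianRing S] [Algebra R S]
variable [Module.Flat R S] (hm : (maximalIdeal R).map (algebraMap R S) = maximalIdeal S)
include hm

lemma AlmostCM.coeff_one_eq_zero_of_hasHilbCoeffs {d : ℕ} (h : AlmostCM S (S ⊗[R] M) d)
    {Q : Ideal R} {e : ℕ → ℤ} (hQ : IsParamIdeal R Q M (d + 2))
    (he : HasHilbCoeffs R Q M (d + 2) e) : e 1 = 0 := by
  obtain ⟨x, rfl, hx, hp⟩ := isParamIdeal_iff.1 hQ
  exact AlmostCM.coeff_one_eq_zero_of_tensor hm hx hp ((hasHilbCoeffs_iff hp).1 he) h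

lemma AlmostCM.isVasconcelos {d : ℕ} (hd : mDim R M = ((d + 2 : ℕ) : ℕ∞))
    (h : AlmostCM S (S ⊗[R] M) d) : IsVasconcelos R M := by
  obtain ⟨Q, e, hQ, he⟩ := exists_isParamIdeal_hasHilbCoeffs
    ((mDim_eq_supportDim (R := R) (M := M)).symm.le.trans hd.le)
  exact (isVasconcelos_iff hd).2
    ⟨Q, e, hQ, he, AlmostCM.coeff_one_eq_zero_of_hasHilbCoeffs hm h hQ he⟩

lemma isVasconcelos_iff_almostCM (hS : FinPrecomplete S) {d : ℕ}
    (hd : mDim R M = ((d + 2 : ℕ) : ℕ∞)) : IsVasconcelos R M ↔ AlmostCM S (S ⊗[R] M) d := by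
  refine ⟨fun h => ?_, AlmostCM.isVasconcelos hm hd⟩
  obtain ⟨Q, e, hQ, he, h1⟩ := (isVasconcelos_iff hd).1 h
  obtain ⟨x, rfl, hx, hp⟩ := isParamIdeal_iff.1 hQ
  exact AlmostCM.tensor_of_coeff_one_eq_zero hS hm
    ((mDim_eq_supportDim (R := R) (M := M)).symm.trans hd) hx hp ((hasHilbCoeffs_iff hp).1 he) h1

end

end Vasconcelos

open Vasconcelos TensorProduct

theorem statement9 (R : Type) [CommRing R] [IsLocalRing R] [IsNoetherianRing R]
    (M : Type) [AddCommGroup M] [Module R M] [Module.Finite R M]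
    (r : ℕ) (hr : mDim R M = (r : ℕ∞)) (hr2 : 2 ≤ r)
    [IsLocalRing (AdicCompletion (maximalIdeal R) R)] :
    -- (1) ↔ (2)
    (IsVasconcelos R M ↔
      ∀ (Q : Ideal R) (e : ℕ → ℤ), IsParamIdeal R Q M r →
        HasHilbCoeffs R Q M r e → e 1 = 0) ∧
    -- (1) ↔ (3)
    (IsVasconcelos R M ↔
      (IsCM (AdicCompletion (maximalIdeal R) R)
          (AdicCompletion (maximalIdeal R) M ⧸
            unmixedComp (AdicCompletion (maximalIdeal R) R)
              (AdicCompletion (maximalIdeal R) M)) ∧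
        mDim (AdicCompletion (maximalIdeal R) R)
          ↥(unmixedComp (AdicCompletion (maximalIdeal R) R)
            (AdicCompletion (maximalIdeal R) M)) ≤ ((r - 2 : ℕ) : ℕ∞))) ∧
    -- (1) ↔ (4)
    (IsVasconcelos R M ↔
      ∃ L : Submodule (AdicCompletion (maximalIdeal R) R)
          (AdicCompletion (maximalIdeal R) M),
        L ≠ ⊤ ∧
        IsCM (AdicCompletion (maximalIdeal R) R)
          (AdicCompletion (maximalIdeal R) M ⧸ L) ∧
        mDim (AdicCompletion (maximalIdeal R) R) ↥L ≤ ((r - 2 : ℕ) : ℕ∞)) ∧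
    -- consequence
    (IsVasconcelos R M →
      (IsVasconcelos (AdicCompletion (maximalIdeal R) R)
          (AdicCompletion (maximalIdeal R) M) ∧
        Subsingleton ↥(LC R (r - 1) M))) := by
  obtain ⟨d, rfl⟩ := Nat.exists_eq_add_of_le' hr2
  have hS : IsNoetherianRing (AdicCompletion (maximalIdeal R) R) :=
    isNoetherianRing_adicCompletion _
  have hfin : Module.Finite (AdicCompletion (maximalIdeal R) R)
      (AdicCompletion (maximalIdeal R) M) := finite_adicCompletion _ _
  have hflat : Module.Flat R (AdicCompletion (maximalIdeal R) R) :=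
    AdicCompletion.flat_of_isNoetherian _
  have hpre : FinPrecomplete (AdicCompletion (maximalIdeal R) R) :=
    finPrecomplete_of_isAdicComplete
  have hm := (AdicCompletion.maximalIdeal_eq_map (R := R)).symm
  let φ := AdicCompletion.ofTensorProductEquivOfFiniteNoetherian (maximalIdeal R) M
  have key : IsVasconcelos R M ↔ AlmostCM (AdicCompletion (maximalIdeal R) R)
      (AdicCompletion (maximalIdeal R) M) d :=
    (isVasconcelos_iff_almostCM hm hpre hr).trans
      ⟨fun h => h.congr φ, fun h => h.congr φ.symm⟩
  have hd : mDim (AdicCompletion (maximalIdeal R) R) (AdicCompletion (maximalIdeal R) M) =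
      ((d + 2 : ℕ) : ℕ∞) := by
    rw [mDim_eq_supportDim, ← Module.supportDim_eq_of_equiv φ, supportDim_tensor_eq hm,
      ← mDim_eq_supportDim, hr]
  refine ⟨⟨fun h Q e hQ he => AlmostCM.coeff_one_eq_zero_of_hasHilbCoeffs hm
      ((key.1 h).congr φ.symm) hQ he, fun h => ?_⟩, key.trans (almostCM_iff_unmixedComp hd),
    key.trans (almostCM_iff_exists hd), fun h => ⟨?_, ?_⟩⟩
  · obtain ⟨Q, e, hQ, he⟩ := exists_isParamIdeal_hasHilbCoeffs
      ((mDim_eq_supportDim (R := R) (M := M)).symm.le.trans hr.le)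
    exact (isVasconcelos_iff hr).2 ⟨Q, e, hQ, he, h Q e hQ he⟩
  · refine AlmostCM.isVasconcelos
      (S := AdicCompletion (maximalIdeal R) R) (Ideal.map_id _) hd ?_
    exact (key.1 h).congr (TensorProduct.lid _ _).symm
  · exact AlmostCM.subsingleton_localCohomology hm ((key.1 h).congr φ.symm)
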